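/- For any fixed A > 0 there exist a constant C > 0 and a function L : ℕ → (0,∞) with lim_{d→∞} L(d) = 0 such that for every integer d ≥ C, every ξ ≥ L(d), every probability space (Ω, ℙ) carrying a white-noise Gaussian process (h_n(x)) as in the context, and every pair of disjoint compact sets K_1, K_2 ⊂ ℝ^d with non-empty interiors, the probabilities ℙ[D_n(K_1, K_2) ≤ 2^{−Aξn}] tend to 1 as n → ∞. -/

import Mathlib

open MeasureTheory ProbabilityTheory

/-- The covariance kernel of the white-noise approximation of the log-correlated field:
`K((n,x),(m,y)) = ∫_{2^{−min(n,m)}}^{1} [vol(B_t(x) ∩ B_t(y)) / vol(B_t(0))] t⁻¹ dt`. -/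
noncomputable def wnKernel (d : ℕ) (n m : ℕ) (x y : EuclideanSpace ℝ (Fin d)) : ℝ :=
  ∫ t in Set.Ioc ((2 : ℝ) ^ (-(min n m : ℤ))) 1,
    (volume (Metric.ball x t ∩ Metric.ball y t)).toReal /
      (volume (Metric.ball (0 : EuclideanSpace ℝ (Fin d)) t)).toReal * t⁻¹

/-- `(h_n(x))_{n ≥ 1}` is a centered Gaussian process with covariance kernel `wnKernel`,
each `h_n(·)(ω)` being continuous. -/
def IsWhiteNoiseField (d : ℕ) {Ω : Type} [MeasurableSpace Ω] (P : Measure Ω)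
    (h : ℕ → EuclideanSpace ℝ (Fin d) → Ω → ℝ) : Prop :=
  (∀ n x, Measurable (h n x)) ∧
  (∀ (N : ℕ) (idx : Fin N → ℕ × EuclideanSpace ℝ (Fin d)) (c : Fin N → ℝ),
    (∀ i, 1 ≤ (idx i).1) →
    P.map (fun ω => ∑ i, c i * h (idx i).1 (idx i).2 ω) =
      gaussianReal 0 (Real.toNNReal (∑ i, ∑ j,
        c i * c j * wnKernel d (idx i).1 (idx j).1 (idx i).2 (idx j).2))) ∧
  (∀ ω n, Continuous (fun x => h n x ω))

/-- A piecewise continuously differentiable path on `[0,1]`: continuous on `[0,1]` and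
`C¹` on each piece of some finite partition `0 = t_0 < t_1 < ⋯ < t_m = 1`. -/
def PiecewiseC1Path (d : ℕ) (f : ℝ → EuclideanSpace ℝ (Fin d)) : Prop :=
  ContinuousOn f (Set.Icc 0 1) ∧
    ∃ (m : ℕ) (t : ℕ → ℝ), t 0 = 0 ∧ t m = 1 ∧ (∀ i < m, t i < t (i + 1)) ∧
      ∀ i < m, ContDiffOn ℝ 1 f (Set.Icc (t i) (t (i + 1)))

/-- The exponential metric `D_n(K₁, K₂)` at level `n`, for a realization `H = h_n(·)(ω)`:
the infimum over piecewise `C¹` paths from `K₁` to `K₂` of `∫_0^1 e^{ξ H(P(t))} ‖P'(t)‖ dt`. -/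
noncomputable def expMetricSetDist (d : ℕ) (ξ : ℝ) (H : EuclideanSpace ℝ (Fin d) → ℝ)
    (K₁ K₂ : Set (EuclideanSpace ℝ (Fin d))) : ℝ :=
  sInf {r : ℝ | ∃ f : ℝ → EuclideanSpace ℝ (Fin d), PiecewiseC1Path d f ∧
    f 0 ∈ K₁ ∧ f 1 ∈ K₂ ∧
    r = ∫ t in Set.Icc (0 : ℝ) 1, Real.exp (ξ * H (f t)) * ‖deriv f t‖}

/-- The normalised volume of the intersection of two balls of radius `t`. -/
noncomputable def ballOverlap (d : ℕ) (x y : EuclideanSpace ℝ (Fin d)) (t : ℝ) : ℝ :=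
  (volume (Metric.ball x t ∩ Metric.ball y t)).toReal /
    (volume (Metric.ball (0 : EuclideanSpace ℝ (Fin d)) t)).toReal

section BallOverlap

variable {d : ℕ}

theorem ballOverlap_nonneg (x y : EuclideanSpace ℝ (Fin d)) (t : ℝ) : 0 ≤ ballOverlap d x y t := by
  unfold ballOverlap; positivity

theorem toReal_volume_ball_center (x : EuclideanSpace ℝ (Fin d)) (t : ℝ) :
    (volume (Metric.ball x t)).toReal =
      (volume (Metric.ball (0 : EuclideanSpace ℝ (Fin d)) t)).toReal := by
  rw [Measure.addHaar_ball_center]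

theorem volume_ball_inter_ne_top (x y : EuclideanSpace ℝ (Fin d)) (t : ℝ) :
    volume (Metric.ball x t ∩ Metric.ball y t) ≠ ⊤ :=
  ((measure_mono Set.inter_subset_left).trans_lt measure_ball_lt_top).ne

theorem toReal_volume_ball_pos {t : ℝ} (ht : 0 < t) :
    0 < (volume (Metric.ball (0 : EuclideanSpace ℝ (Fin d)) t)).toReal :=
  ENNReal.toReal_pos (Metric.measure_ball_pos _ _ ht).ne' measure_ball_lt_top.ne

theorem toReal_volume_ball_mul (x : EuclideanSpace ℝ (Fin d)) {t q : ℝ} (hq : 0 < q) :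
    (volume (Metric.ball x (t * q))).toReal =
      q ^ d * (volume (Metric.ball (0 : EuclideanSpace ℝ (Fin d)) t)).toReal := by
  rw [mul_comm t q, Measure.addHaar_ball_mul_of_pos volume x hq t]
  simp [ENNReal.toReal_mul, hq.le]

theorem ballOverlap_le_one (x y : EuclideanSpace ℝ (Fin d)) (t : ℝ) : ballOverlap d x y t ≤ 1 := by
  unfold ballOverlap
  refine div_le_one_of_le₀ ?_ ENNReal.toReal_nonneg
  rw [← toReal_volume_ball_center x]
  exact ENNReal.toReal_mono measure_ball_lt_top.ne (measure_mono Set.inter_subset_left)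

theorem ballOverlap_comm (x y : EuclideanSpace ℝ (Fin d)) : ballOverlap d x y = ballOverlap d y x := by
  ext t; unfold ballOverlap; rw [Set.inter_comm]

theorem ballOverlap_self (x : EuclideanSpace ℝ (Fin d)) {t : ℝ} (ht : 0 < t) :
    ballOverlap d x x t = 1 := by
  unfold ballOverlap
  rw [Set.inter_self, toReal_volume_ball_center, div_self (toReal_volume_ball_pos ht).ne']

theorem measurable_ballOverlap (x y : EuclideanSpace ℝ (Fin d)) :
    Measurable (ballOverlap d x y) := by
  unfold ballOverlap
  refine Measurable.div (Monotone.measurable ?_) (Monotone.measurable ?_)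
  · intro s t hst
    exact ENNReal.toReal_mono (volume_ball_inter_ne_top x y t) (measure_mono
      (Set.inter_subset_inter (Metric.ball_subset_ball hst) (Metric.ball_subset_ball hst)))
  · intro s t hst
    exact ENNReal.toReal_mono measure_ball_lt_top.ne (measure_mono (Metric.ball_subset_ball hst))

theorem ballOverlap_le_exp (x y : EuclideanSpace ℝ (Fin d)) {t : ℝ} (ht : 0 < t) :
    ballOverlap d x y t ≤ Real.exp (-(d * dist x y ^ 2 / (8 * t ^ 2))) := by
  unfold ballOverlap
  rw [div_le_iff₀ (toReal_volume_ball_pos ht)]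
  set q := Real.exp (-(dist x y ^ 2 / (8 * t ^ 2))) with hq
  have hsub : Metric.ball x t ∩ Metric.ball y t ⊆ Metric.ball (midpoint ℝ x y) (t * q) := by
    rintro w ⟨hx, hy⟩
    rw [Metric.mem_ball, dist_eq_norm] at hx hy ⊢
    have hpar := parallelogram_law_with_norm ℝ (w - x) (w - y)
    have h1 : (w - x) + (w - y) = (2 : ℝ) • (w - midpoint ℝ x y) := by
      rw [midpoint_eq_smul_add, smul_sub, smul_smul]; norm_num; rw [two_smul]; abel
    have h2 : (w - x) - (w - y) = -(x - y) := by abel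
    rw [h1, h2, norm_smul, norm_neg, ← dist_eq_norm x y] at hpar
    norm_num at hpar
    have hx2 : ‖w - x‖ ^ 2 < t ^ 2 := by gcongr
    have hy2 : ‖w - y‖ ^ 2 < t ^ 2 := by gcongr
    have hqq : q ^ 2 ≥ 1 - dist x y ^ 2 / (4 * t ^ 2) := by
      rw [hq, ← Real.exp_nat_mul]
      refine le_trans ?_ (Real.add_one_le_exp _)
      apply le_of_eq; field_simp; push_cast; ring
    have hqt : (t * q) ^ 2 ≥ t ^ 2 - dist x y ^ 2 / 4 := by
      calc (t * q) ^ 2 = t ^ 2 * q ^ 2 := by ring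
        _ ≥ t ^ 2 * (1 - dist x y ^ 2 / (4 * t ^ 2)) := by gcongr
        _ = _ := by field_simp
    have : ‖w - midpoint ℝ x y‖ ^ 2 < (t * q) ^ 2 := by nlinarith
    exact lt_of_pow_lt_pow_left₀ 2 (by positivity) this
  calc (volume (Metric.ball x t ∩ Metric.ball y t)).toReal
      ≤ (volume (Metric.ball (midpoint ℝ x y) (t * q))).toReal :=
        ENNReal.toReal_mono measure_ball_lt_top.ne (measure_mono hsub)
    _ = q ^ d * (volume (Metric.ball (0 : EuclideanSpace ℝ (Fin d)) t)).toReal :=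
        toReal_volume_ball_mul _ (Real.exp_pos _)
    _ = _ := by rw [hq, ← Real.exp_nat_mul]; congr 2; ring

theorem half_exp_le_ballOverlap (x y : EuclideanSpace ℝ (Fin d)) {t : ℝ} (ht : 0 < t)
    (hxy : 2 * dist x y ^ 2 ≤ t ^ 2) :
    Real.exp (-(d * (dist x y ^ 2 / t ^ 2))) / 2 ≤ ballOverlap d x y t := by
  unfold ballOverlap
  rw [le_div_iff₀ (toReal_volume_ball_pos ht)]
  set s := dist x y ^ 2 / t ^ 2 with hs
  have hs0 : 0 ≤ s := by positivity
  have hs1 : s ≤ 1 / 2 := by rw [hs, div_le_iff₀ (by positivity)]; linarith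
  set q := Real.exp (-s) with hq
  have hq1 : q ≤ 1 := by rw [hq]; exact Real.exp_le_one_iff.2 (by linarith)
  have hq2 : q ^ 2 ≤ 1 - s := by
    have h1 : q ^ 2 * Real.exp (2 * s) = 1 := by
      rw [hq, ← Real.exp_nat_mul, ← Real.exp_add]; simp
    have h2 : 1 + 2 * s ≤ Real.exp (2 * s) := by linarith [Real.add_one_le_exp (2 * s)]
    have h3 : 1 ≤ (1 - s) * Real.exp (2 * s) := by
      nlinarith
    have h4 := Real.exp_pos (2 * s)
    nlinarith
  let S : Set (EuclideanSpace ℝ (Fin d)) :=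
    {w | w ∈ Metric.ball x (t * q) ∧ 0 ≤ inner ℝ (w - x) (y - x)}
  have hcov : Metric.ball x (t * q) ⊆ S ∪ (fun w => (x + x) - w) ⁻¹' S := by
    intro w hw
    by_cases h : 0 ≤ inner ℝ (w - x) (y - x)
    · exact Or.inl ⟨hw, h⟩
    · refine Or.inr ⟨?_, ?_⟩
      · rw [Metric.mem_ball, dist_eq_norm] at hw ⊢
        rwa [show x + x - w - x = -(w - x) by abel, norm_neg]
      · rw [show x + x - w - x = -(w - x) by abel, inner_neg_left]
        linarith
  have hS : S ⊆ Metric.ball x t ∩ Metric.ball y t := by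
    rintro w ⟨hw, hin⟩
    rw [Metric.mem_ball, dist_eq_norm] at hw
    have hq0 := Real.exp_pos (-s)
    refine ⟨?_, ?_⟩
    · rw [Metric.mem_ball, dist_eq_norm]
      nlinarith
    · rw [Metric.mem_ball, dist_eq_norm]
      have h1 : w - y = (w - x) - (y - x) := by abel
      have h2 := norm_sub_sq_real (w - x) (y - x)
      rw [← h1] at h2
      have h3 : ‖y - x‖ = dist x y := by rw [dist_comm, dist_eq_norm]
      rw [h3] at h2
      have h4 : ‖w - x‖ ^ 2 < (t * q) ^ 2 := by gcongr
      have h5 : dist x y ^ 2 = s * t ^ 2 := by rw [hs]; field_simp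
      have h6 : (t * q) ^ 2 ≤ t ^ 2 * (1 - s) := by
        rw [mul_pow]; gcongr
      have : ‖w - y‖ ^ 2 < t ^ 2 := by nlinarith
      exact lt_of_pow_lt_pow_left₀ 2 ht.le this
  have hSm : MeasurableSet S := by
    apply MeasurableSet.inter (s₁ := Metric.ball x (t * q)) (s₂ := {w | 0 ≤ inner ℝ (w - x) (y - x)})
    · exact measurableSet_ball
    · exact (isClosed_le (by fun_prop) (by fun_prop)).measurableSet
  have hmp : volume ((fun w => (x + x) - w) ⁻¹' S) = volume S :=
    (Measure.measurePreserving_sub_left volume (x + x)).measure_preimage hSm.nullMeasurableSet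
  have hle : volume (Metric.ball x (t * q)) ≤ 2 * volume S := by
    calc _ ≤ volume (S ∪ (fun w => (x + x) - w) ⁻¹' S) := measure_mono hcov
      _ ≤ volume S + volume ((fun w => (x + x) - w) ⁻¹' S) := measure_union_le _ _
      _ = _ := by rw [hmp, two_mul]
  have hle2 : (volume (Metric.ball x (t * q))).toReal ≤
      2 * (volume (Metric.ball x t ∩ Metric.ball y t)).toReal := by
    have := ENNReal.toReal_mono (ENNReal.mul_ne_top (by simp) (volume_ball_inter_ne_top x y t))
      (hle.trans (mul_le_mul_right (measure_mono hS) 2))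
    simpa using this
  rw [toReal_volume_ball_mul _ (Real.exp_pos _), ← Real.exp_nat_mul] at hle2
  rw [show -(d * s) = (d : ℝ) * -s by ring]
  linarith

theorem one_sub_le_ballOverlap (x y : EuclideanSpace ℝ (Fin d)) {t : ℝ} (ht : 0 < t) :
    1 - d * dist x y / t ≤ ballOverlap d x y t := by
  by_cases hz : t ≤ dist x y
  · rcases Nat.eq_zero_or_pos d with rfl | hd
    · exfalso
      have : x = y := Subsingleton.elim _ _
      rw [this, dist_self] at hz; linarith
    · have h1 : (1 : ℝ) ≤ d := by exact_mod_cast hd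
      have : 1 ≤ d * dist x y / t := by
        rw [le_div_iff₀ ht]; nlinarith
      linarith [ballOverlap_nonneg x y t]
  · push Not at hz
    unfold ballOverlap
    rw [le_div_iff₀ (toReal_volume_ball_pos ht)]
    set q := 1 - dist x y / t with hq
    have hq0 : 0 < q := by
      rw [hq, sub_pos, div_lt_one ht]; exact hz
    have hsub : Metric.ball x (t * q) ⊆ Metric.ball x t ∩ Metric.ball y t := by
      have htq : t * q = t - dist x y := by rw [hq]; field_simp
      rw [htq]
      refine Set.subset_inter (Metric.ball_subset_ball (by linarith [dist_nonneg (x := x) (y := y)]))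
        (Metric.ball_subset_ball' ?_)
      linarith
    have h1 := ENNReal.toReal_mono (volume_ball_inter_ne_top x y t) (measure_mono hsub)
    rw [toReal_volume_ball_mul _ hq0] at h1
    refine le_trans (mul_le_mul_of_nonneg_right ?_ ENNReal.toReal_nonneg) h1
    have h2 := one_add_mul_le_pow (a := -(dist x y / t)) (by
      have : dist x y / t < 1 := by rw [div_lt_one ht]; exact hz
      linarith) d
    calc 1 - d * dist x y / t = 1 + d * -(dist x y / t) := by ring
      _ ≤ _ := h2
      _ = q ^ d := by rw [hq]; ring

theorem ballOverlap_sub_le (x y w : EuclideanSpace ℝ (Fin d)) {t : ℝ} (ht : 0 < t) :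
    ballOverlap d x w t - ballOverlap d y w t ≤ d * dist x y / t := by
  have h := one_sub_le_ballOverlap x y ht
  suffices ballOverlap d x w t + ballOverlap d x y t ≤ 1 + ballOverlap d y w t by linarith
  have hv := toReal_volume_ball_pos (d := d) ht
  unfold ballOverlap
  rw [← add_div, ← sub_nonneg, show ∀ a b c : ℝ, 1 + a / c - b / c = 1 + (a - b) / c by intros; ring,
    ← neg_le_iff_add_nonneg', ← sub_nonneg]
  suffices (volume (Metric.ball x t ∩ Metric.ball w t)).toReal +
      (volume (Metric.ball x t ∩ Metric.ball y t)).toReal ≤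
      (volume (Metric.ball (0 : EuclideanSpace ℝ (Fin d)) t)).toReal +
      (volume (Metric.ball y t ∩ Metric.ball w t)).toReal by
    rw [sub_neg_eq_add, div_add_one hv.ne']
    apply div_nonneg _ hv.le
    linarith
  rw [← toReal_volume_ball_center x, ← ENNReal.toReal_add (volume_ball_inter_ne_top _ _ _)
    (volume_ball_inter_ne_top _ _ _), ← ENNReal.toReal_add measure_ball_lt_top.ne
    (volume_ball_inter_ne_top _ _ _)]
  refine ENNReal.toReal_mono (ENNReal.add_ne_top.2 ⟨measure_ball_lt_top.ne,
    volume_ball_inter_ne_top _ _ _⟩) ?_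
  rw [← measure_union_add_inter (Metric.ball x t ∩ Metric.ball w t)
    (measurableSet_ball.inter measurableSet_ball : MeasurableSet (Metric.ball x t ∩ Metric.ball y t))]
  refine add_le_add (measure_mono ?_) (measure_mono ?_)
  · exact Set.union_subset Set.inter_subset_left Set.inter_subset_left
  · rintro z ⟨⟨_, h2⟩, ⟨_, h4⟩⟩; exact ⟨h4, h2⟩

theorem abs_ballOverlap_sub_le (x y w : EuclideanSpace ℝ (Fin d)) {t : ℝ} (ht : 0 < t) :
    |ballOverlap d x w t - ballOverlap d y w t| ≤ d * dist x y / t := by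
  rw [abs_le]
  constructor
  · have := ballOverlap_sub_le y x w ht
    rw [dist_comm] at this; linarith
  · exact ballOverlap_sub_le x y w ht

theorem integrableOn_ballOverlap (x y : EuclideanSpace ℝ (Fin d)) {a b : ℝ} (ha : 0 < a) :
    IntegrableOn (fun t => ballOverlap d x y t * t⁻¹) (Set.Ioc a b) := by
  refine Measure.integrableOn_of_bounded (M := a⁻¹) (by simp) ?_ ?_
  · exact ((measurable_ballOverlap x y).mul measurable_inv).aestronglyMeasurable
  · refine (ae_restrict_iff' measurableSet_Ioc).2 (Filter.Eventually.of_forall fun t ht => ?_)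
    have ht0 : 0 < t := ha.trans ht.1
    rw [Real.norm_of_nonneg (mul_nonneg (ballOverlap_nonneg _ _ _) (by positivity))]
    calc ballOverlap d x y t * t⁻¹ ≤ 1 * t⁻¹ := by gcongr; exact ballOverlap_le_one _ _ _
      _ ≤ a⁻¹ := by rw [one_mul]; gcongr; exact ht.1.le

theorem wnKernel_eq (n m : ℕ) (x y : EuclideanSpace ℝ (Fin d)) :
    wnKernel d n m x y =
      ∫ t in Set.Ioc ((1 / 2 : ℝ) ^ min n m) 1, ballOverlap d x y t * t⁻¹ := by
  unfold wnKernel ballOverlap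
  rw [← Nat.cast_min, zpow_neg, zpow_natCast, one_div, inv_pow]

theorem wnKernel_comm (n m : ℕ) (x y : EuclideanSpace ℝ (Fin d)) :
    wnKernel d n m x y = wnKernel d m n y x := by
  rw [wnKernel_eq, wnKernel_eq, min_comm, ballOverlap_comm]

theorem wnKernel_eq_of_min_eq {n m k : ℕ} (hk : min n m = k) (x y : EuclideanSpace ℝ (Fin d)) :
    wnKernel d n m x y = wnKernel d k k x y := by
  rw [wnKernel_eq, wnKernel_eq, hk, min_self]

/-- The covariance carried by the scales between `2^{-(k+1)}` and `2^{-k}`. -/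
noncomputable def dyadicKernel (d k : ℕ) (x y : EuclideanSpace ℝ (Fin d)) : ℝ :=
  ∫ t in Set.Ioc ((1 / 2 : ℝ) ^ (k + 1)) ((1 / 2) ^ k), ballOverlap d x y t * t⁻¹

theorem dyadicKernel_nonneg (k : ℕ) (x y : EuclideanSpace ℝ (Fin d)) : 0 ≤ dyadicKernel d k x y := by
  refine setIntegral_nonneg measurableSet_Ioc fun t ht => ?_
  have : 0 < t := lt_trans (by positivity) ht.1
  exact mul_nonneg (ballOverlap_nonneg _ _ _) (by positivity)

theorem wnKernel_zero (x y : EuclideanSpace ℝ (Fin d)) : wnKernel d 0 0 x y = 0 := by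
  simp [wnKernel_eq]

theorem wnKernel_succ (k : ℕ) (x y : EuclideanSpace ℝ (Fin d)) :
    wnKernel d (k + 1) (k + 1) x y = wnKernel d k k x y + dyadicKernel d k x y := by
  rw [wnKernel_eq, wnKernel_eq, min_self, min_self, dyadicKernel,
    add_comm (integral _ _)]
  have h1 : (1 / 2 : ℝ) ^ (k + 1) ≤ (1 / 2) ^ k := pow_le_pow_of_le_one (by norm_num) (by norm_num) (by simp)
  have h2 : (1 / 2 : ℝ) ^ k ≤ 1 := pow_le_one₀ (by norm_num) (by norm_num)
  rw [← Set.Ioc_union_Ioc_eq_Ioc h1 h2, setIntegral_union (Set.Ioc_disjoint_Ioc_of_le le_rfl)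
    measurableSet_Ioc (integrableOn_ballOverlap x y (by positivity))
    (integrableOn_ballOverlap x y (by positivity))]

theorem dyadicKernel_le {k : ℕ} {x y : EuclideanSpace ℝ (Fin d)} {c : ℝ}
    (hc : ∀ t ∈ Set.Ioc ((1 / 2 : ℝ) ^ (k + 1)) ((1 / 2) ^ k), ballOverlap d x y t ≤ c) :
    dyadicKernel d k x y ≤ c := by
  have hr : (0 : ℝ) < (1 / 2) ^ k := by positivity
  have hmem : ((1 / 2 : ℝ) ^ k) ∈ Set.Ioc ((1 / 2 : ℝ) ^ (k + 1)) ((1 / 2) ^ k) :=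
    ⟨by rw [pow_succ]; linarith, le_rfl⟩
  have hc0 : 0 ≤ c := (ballOverlap_nonneg _ _ _).trans (hc _ hmem)
  calc dyadicKernel d k x y
      ≤ ∫ t in Set.Ioc ((1 / 2 : ℝ) ^ (k + 1)) ((1 / 2) ^ k), c * (2 / (1 / 2) ^ k) := by
        refine setIntegral_mono_on (integrableOn_ballOverlap x y (by positivity))
          (integrableOn_const (by simp))
          measurableSet_Ioc fun t ht => ?_
        have ht0 : 0 < t := lt_trans (by positivity) ht.1
        refine mul_le_mul (hc t ht) ?_ (by positivity) hc0
        rw [inv_le_comm₀ ht0 (by positivity), inv_div]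
        have := ht.1
        rw [pow_succ] at this; linarith
    _ = c := by
        simp only [integral_const, MeasurableSet.univ, measureReal_restrict_apply, Set.univ_inter,
          Real.volume_real_Ioc, smul_eq_mul]
        rw [max_eq_left (by rw [pow_succ]; linarith), pow_succ]
        field_simp
        ring

theorem le_dyadicKernel {k : ℕ} {x y : EuclideanSpace ℝ (Fin d)} {c : ℝ}
    (hc : ∀ t ∈ Set.Ioc ((1 / 2 : ℝ) ^ (k + 1)) ((1 / 2) ^ k), c ≤ ballOverlap d x y t) :
    c / 2 ≤ dyadicKernel d k x y := by
  have hr : (0 : ℝ) < (1 / 2) ^ k := by positivity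
  calc c / 2 = ∫ t in Set.Ioc ((1 / 2 : ℝ) ^ (k + 1)) ((1 / 2) ^ k), c * (1 / (1 / 2) ^ k) := by
        simp only [integral_const, MeasurableSet.univ, measureReal_restrict_apply, Set.univ_inter,
          Real.volume_real_Ioc, smul_eq_mul]
        rw [max_eq_left (by rw [pow_succ]; linarith), pow_succ]
        field_simp
        ring
    _ ≤ _ := by
        refine setIntegral_mono_on (integrableOn_const (by simp)) (integrableOn_ballOverlap x y (by positivity))
          measurableSet_Ioc fun t ht => ?_
        have ht0 : 0 < t := lt_trans (by positivity) ht.1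
        refine mul_le_mul (hc t ht) ?_ (by positivity) (ballOverlap_nonneg _ _ _)
        rw [one_div]
        gcongr
        exact ht.2

theorem dyadicKernel_le_exp (k : ℕ) (x y : EuclideanSpace ℝ (Fin d)) :
    dyadicKernel d k x y ≤ Real.exp (-(d * dist x y ^ 2 / (8 * ((1 / 2) ^ k) ^ 2))) := by
  refine dyadicKernel_le fun t ht => ?_
  have ht0 : 0 < t := lt_trans (by positivity) ht.1
  refine (ballOverlap_le_exp x y ht0).trans (Real.exp_le_exp.2 (neg_le_neg ?_))
  have := ht.2
  gcongr

theorem dyadicKernel_le_one (k : ℕ) (x y : EuclideanSpace ℝ (Fin d)) : dyadicKernel d k x y ≤ 1 :=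
  dyadicKernel_le fun _ _ => ballOverlap_le_one _ _ _

theorem exp_le_dyadicKernel (hd : 2592 ≤ d) (k : ℕ) (x y : EuclideanSpace ℝ (Fin d))
    (hxy : d * dist x y ^ 2 ≤ 324 * ((1 / 2) ^ k) ^ 2) :
    Real.exp (-1296) / 4 ≤ dyadicKernel d k x y := by
  have hd' : (2592 : ℝ) ≤ d := by exact_mod_cast hd
  rw [show Real.exp (-1296) / 4 = Real.exp (-1296) / 2 / 2 by ring]
  refine le_dyadicKernel fun t ht => ?_
  have ht0 : 0 < t := lt_trans (by positivity) ht.1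
  have h1 : ((1 / 2 : ℝ) ^ k) ^ 2 ≤ 4 * t ^ 2 := by
    have : (1 / 2 : ℝ) ^ k ≤ 2 * t := by have := ht.1; rw [pow_succ] at this; linarith
    calc ((1 / 2 : ℝ) ^ k) ^ 2 ≤ (2 * t) ^ 2 := by gcongr
      _ = _ := by ring
  have h2 : d * dist x y ^ 2 ≤ 1296 * t ^ 2 := by linarith
  refine le_trans ?_ (half_exp_le_ballOverlap x y ht0 ?_)
  · gcongr
    rw [← mul_div_assoc, div_le_iff₀ (by positivity)]
    exact h2
  · have : 2592 * dist x y ^ 2 ≤ d * dist x y ^ 2 := by gcongr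
    linarith

theorem wnKernel_diag_le (k : ℕ) (x y : EuclideanSpace ℝ (Fin d)) : wnKernel d k k x y ≤ k := by
  induction k with
  | zero => rw [wnKernel_zero]; simp
  | succ k ih => rw [wnKernel_succ]; push_cast; linarith [dyadicKernel_le_one k x y]

theorem wnKernel_one_pos (x : EuclideanSpace ℝ (Fin d)) : 0 < wnKernel d 1 1 x x := by
  have h := wnKernel_succ 0 x x
  rw [wnKernel_zero, zero_add, zero_add] at h
  rw [h]
  refine lt_of_lt_of_le (by norm_num) (le_dyadicKernel (c := 1) fun t ht => ?_)
  rw [ballOverlap_self x (lt_trans (by positivity) ht.1)]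

theorem abs_wnKernel_diag_sub_le (k : ℕ) (x y w : EuclideanSpace ℝ (Fin d)) :
    |wnKernel d k k x w - wnKernel d k k y w| ≤ d * dist x y * 4 ^ k := by
  have hr : (0 : ℝ) < (1 / 2) ^ k := by positivity
  have hr1 : (1 / 2 : ℝ) ^ k ≤ 1 := pow_le_one₀ (by norm_num) (by norm_num)
  rw [wnKernel_eq, wnKernel_eq, min_self, ← integral_sub
    (integrableOn_ballOverlap x w (by positivity)) (integrableOn_ballOverlap y w (by positivity)),
    ← Real.norm_eq_abs]
  refine (norm_setIntegral_le_of_norm_le_const (C := d * dist x y * 4 ^ k) (by simp)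
    fun t ht => ?_).trans ?_
  · have ht0 : 0 < t := lt_trans (by positivity) ht.1
    rw [← sub_mul, norm_mul, Real.norm_eq_abs, Real.norm_of_nonneg (by positivity : 0 ≤ t⁻¹)]
    have h4 : t⁻¹ ≤ 2 ^ k := by
      rw [inv_le_comm₀ ht0 (by positivity)]
      have := ht.1.le
      rwa [one_div, inv_pow] at this
    calc |ballOverlap d x w t - ballOverlap d y w t| * t⁻¹ ≤ (d * dist x y / t) * t⁻¹ := by
          gcongr; exact abs_ballOverlap_sub_le x y w ht0
      _ = d * dist x y * (t⁻¹ * t⁻¹) := by rw [div_eq_mul_inv]; ring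
      _ ≤ d * dist x y * (2 ^ k * 2 ^ k) := by gcongr
      _ = _ := by rw [← mul_pow]; norm_num
  · rw [Real.volume_real_Ioc, max_eq_left (by linarith)]
    have : (0:ℝ) ≤ d * dist x y * 4 ^ k := by positivity
    nlinarith

end BallOverlap

section GaussianFamily

variable {T Ω : Type*}

/-- The bilinear form on finite formal linear combinations induced by a kernel. -/
noncomputable def kernelForm (K : T → T → ℝ) : (T →₀ ℝ) →ₗ[ℝ] (T →₀ ℝ) →ₗ[ℝ] ℝ :=
  Finsupp.linearCombination ℝ fun s => Finsupp.linearCombination ℝ (K s)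

/-- The evaluation of a process on finite formal linear combinations of indices. -/
noncomputable def processEval (X : T → Ω → ℝ) (f : T →₀ ℝ) (ω : Ω) : ℝ :=
  Finsupp.linearCombination ℝ (fun t => X t ω) f

theorem kernelForm_single (K : T → T → ℝ) (s t : T) (a b : ℝ) :
    kernelForm K (Finsupp.single s a) (Finsupp.single t b) = a * b * K s t := by
  simp [kernelForm, mul_assoc]

theorem kernelForm_apply (K : T → T → ℝ) (f g : T →₀ ℝ) :
    kernelForm K f g = ∑ s ∈ f.support, ∑ t ∈ g.support, f s * g t * K s t := by
  simp [kernelForm, Finsupp.linearCombination_apply, Finsupp.sum, Finset.mul_sum, mul_assoc]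

theorem kernelForm_comm {K : T → T → ℝ} (hK : ∀ s t, K s t = K t s) (f g : T →₀ ℝ) :
    kernelForm K f g = kernelForm K g f := by
  rw [kernelForm_apply, kernelForm_apply, Finset.sum_comm]
  refine Finset.sum_congr rfl fun s _ => Finset.sum_congr rfl fun t _ => ?_
  rw [hK s t]; ring

@[simp] theorem processEval_single (X : T → Ω → ℝ) (t : T) (a : ℝ) (ω : Ω) :
    processEval X (Finsupp.single t a) ω = a * X t ω := by simp [processEval]

@[simp] theorem processEval_add (X : T → Ω → ℝ) (f g : T →₀ ℝ) (ω : Ω) :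
    processEval X (f + g) ω = processEval X f ω + processEval X g ω := by simp [processEval]

@[simp] theorem processEval_sub (X : T → Ω → ℝ) (f g : T →₀ ℝ) (ω : Ω) :
    processEval X (f - g) ω = processEval X f ω - processEval X g ω := by simp [processEval]

@[simp] theorem processEval_neg (X : T → Ω → ℝ) (f : T →₀ ℝ) (ω : Ω) :
    processEval X (-f) ω = -processEval X f ω := by simp [processEval]

@[simp] theorem processEval_smul (X : T → Ω → ℝ) (a : ℝ) (f : T →₀ ℝ) (ω : Ω) :
    processEval X (a • f) ω = a * processEval X f ω := by simp [processEval]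

theorem processEval_apply (X : T → Ω → ℝ) (f : T →₀ ℝ) (ω : Ω) :
    processEval X f ω = ∑ s ∈ f.support, f s * X s ω := by
  simp [processEval, Finsupp.linearCombination_apply, Finsupp.sum]

variable [MeasurableSpace Ω] {P : Measure Ω}

/-- A family of random variables all of whose finite linear combinations are centred Gaussian with
variance given by a symmetric kernel that does not vanish on the diagonal. -/
structure IsGaussianFamily (P : Measure Ω) (X : T → Ω → ℝ) (K : T → T → ℝ) : Prop where
  measurable : ∀ t, Measurable (X t)
  symm : ∀ s t, K s t = K t s
  exists_pos : ∃ t, 0 < K t t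
  map_eq : ∀ (N : ℕ) (idx : Fin N → T) (c : Fin N → ℝ),
    P.map (fun ω => ∑ i, c i * X (idx i) ω) =
      gaussianReal 0 (Real.toNNReal (∑ i, ∑ j, c i * c j * K (idx i) (idx j)))

namespace IsGaussianFamily

variable {X : T → Ω → ℝ} {K : T → T → ℝ}

theorem measurable_processEval (h : IsGaussianFamily P X K) (f : T →₀ ℝ) :
    Measurable (processEval X f) := by
  have : processEval X f = fun ω => ∑ s ∈ f.support, f s * X s ω := by
    ext ω; exact processEval_apply X f ω
  rw [this]
  exact Finset.measurable_sum _ fun s _ => (h.measurable s).const_mul _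

theorem map_processEval (h : IsGaussianFamily P X K) (f : T →₀ ℝ) :
    P.map (processEval X f) = gaussianReal 0 (Real.toNNReal (kernelForm K f f)) := by
  let e := f.support.equivFin.symm
  have h1 := h.map_eq _ (fun i => (e i : T)) (fun i => f (e i))
  have key : ∀ F : T → ℝ, ∑ i, F (e i) = ∑ s ∈ f.support, F s := fun F => by
    rw [Equiv.sum_comp e (fun s : f.support => F s), Finset.sum_coe_sort f.support F]
  have h2 : (fun ω => ∑ i, f (e i) * X (e i) ω) = processEval X f := by
    ext ω; exact (key fun s => f s * X s ω).trans (processEval_apply X f ω).symm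
  rw [h2] at h1
  rw [h1, kernelForm_apply]
  congr 2
  refine Eq.trans ?_ (key fun s => ∑ t ∈ f.support, f s * f t * K s t)
  exact Finset.sum_congr rfl fun i _ => key fun t => f (e i) * f t * K (e i) t

theorem lintegral_exp_of_nonneg (h : IsGaussianFamily P X K) {f : T →₀ ℝ}
    (hf : 0 ≤ kernelForm K f f) :
    ∫⁻ ω, ENNReal.ofReal (Real.exp (processEval X f ω)) ∂P =
      ENNReal.ofReal (Real.exp (kernelForm K f f / 2)) := by
  have hm : Measurable fun x : ℝ => ENNReal.ofReal (Real.exp x) := by fun_prop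
  rw [← lintegral_map hm (h.measurable_processEval f), h.map_processEval]
  have h1 := integrable_exp_mul_gaussianReal (μ := 0) (v := Real.toNNReal (kernelForm K f f)) 1
  have h2 := mgf_gaussianReal (p := gaussianReal 0 (Real.toNNReal (kernelForm K f f)))
    (X := id) (by rw [Measure.map_id]) 1
  simp only [one_mul] at h1
  rw [← ofReal_integral_eq_lintegral_ofReal h1 (Filter.Eventually.of_forall fun _ => by positivity)]
  simp only [mgf, id, one_mul] at h2
  rw [h2, Real.coe_toNNReal _ hf]
  simp

theorem kernelForm_self_nonneg (h : IsGaussianFamily P X K) (f : T →₀ ℝ) :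
    0 ≤ kernelForm K f f := by
  by_contra! hneg
  have hzero : ∀ g : T →₀ ℝ, kernelForm K g g ≤ 0 → processEval X g =ᵐ[P] 0 := by
    intro g hg
    have h1 := h.map_processEval g
    rw [Real.toNNReal_of_nonpos hg, gaussianReal_zero_var] at h1
    have h2 : ∀ᵐ x ∂(P.map (processEval X g)), x = 0 := by
      rw [h1]; simp
    exact ae_of_ae_map (h.measurable_processEval g).aemeasurable h2
  obtain ⟨t, ht⟩ := h.exists_pos
  set e : T →₀ ℝ := Finsupp.single t 1
  have he : 0 < kernelForm K e e := by rw [kernelForm_single]; simpa using ht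
  set β := kernelForm K e f
  set q := kernelForm K f f
  obtain ⟨s, hs⟩ : ∃ s : ℝ, kernelForm K (e + s • f) (e + s • f) ≤ 0 := by
    have hform : ∀ s : ℝ, kernelForm K (e + s • f) (e + s • f) =
        kernelForm K e e + 2 * s * β + s ^ 2 * q := by
      intro s
      simp only [map_add, map_smul, LinearMap.add_apply, LinearMap.smul_apply, smul_eq_mul]
      rw [kernelForm_comm h.symm f e]; ring
    refine ⟨(kernelForm K e e + 2 * |β| + 1) / -q + 1, ?_⟩
    rw [hform]
    set s := (kernelForm K e e + 2 * |β| + 1) / -q + 1 with hs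
    have hq : 0 < -q := by linarith
    have hs1 : 1 ≤ s := by
      rw [hs, le_add_iff_nonneg_left]; positivity
    have hs2 : s * -q ≥ kernelForm K e e + 2 * |β| + 1 := by
      rw [hs, add_mul, div_mul_cancel₀ _ hq.ne']; linarith
    have h3 : s * β ≤ s * |β| := by gcongr; exact le_abs_self β
    nlinarith
  have h1 : processEval X e =ᵐ[P] 0 := by
    filter_upwards [hzero _ hs, hzero f hneg.le] with ω h1 h2
    simp only [processEval_add, processEval_smul, Pi.zero_apply] at h1 h2 ⊢
    rw [h2] at h1; linarith
  have h2 := h.lintegral_exp_of_nonneg he.le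
  have hz : ∫⁻ ω, ENNReal.ofReal (Real.exp (processEval X (0 : T →₀ ℝ) ω)) ∂P =
      ENNReal.ofReal (Real.exp (kernelForm K 0 0 / 2)) :=
    h.lintegral_exp_of_nonneg (by simp)
  have h3 : ∫⁻ ω, ENNReal.ofReal (Real.exp (processEval X e ω)) ∂P =
      ∫⁻ ω, ENNReal.ofReal (Real.exp (processEval X (0 : T →₀ ℝ) ω)) ∂P := by
    refine lintegral_congr_ae ?_
    filter_upwards [h1] with ω hω
    rw [hω]; simp [processEval]
  rw [h2, hz, ENNReal.ofReal_eq_ofReal_iff (by positivity) (by positivity), Real.exp_eq_exp] at h3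
  simp only [map_zero] at h3
  linarith

theorem lintegral_exp (h : IsGaussianFamily P X K) (f : T →₀ ℝ) :
    ∫⁻ ω, ENNReal.ofReal (Real.exp (processEval X f ω)) ∂P =
      ENNReal.ofReal (Real.exp (kernelForm K f f / 2)) :=
  h.lintegral_exp_of_nonneg (h.kernelForm_self_nonneg f)

/-- The Cameron–Martin density which shifts the process by `-kernelForm K g`. -/
noncomputable def tiltDensity (X : T → Ω → ℝ) (K : T → T → ℝ) (g : T →₀ ℝ) (ω : Ω) : ENNReal :=
  ENNReal.ofReal (Real.exp (-processEval X g ω - kernelForm K g g / 2))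

theorem measurable_tiltDensity (h : IsGaussianFamily P X K) (g : T →₀ ℝ) :
    Measurable (tiltDensity X K g) := by
  have := h.measurable_processEval g
  unfold tiltDensity
  fun_prop

theorem lintegral_tiltDensity_mul_exp (h : IsGaussianFamily P X K) (g f : T →₀ ℝ) :
    ∫⁻ ω, tiltDensity X K g ω * ENNReal.ofReal (Real.exp (processEval X f ω)) ∂P =
      ENNReal.ofReal (Real.exp (kernelForm K f f / 2 - kernelForm K g f)) := by
  have h1 : ∀ ω, tiltDensity X K g ω * ENNReal.ofReal (Real.exp (processEval X f ω)) =
      ENNReal.ofReal (Real.exp (processEval X (f - g) ω)) *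
        ENNReal.ofReal (Real.exp (-(kernelForm K g g / 2))) := by
    intro ω
    rw [tiltDensity, ← ENNReal.ofReal_mul (by positivity), ← ENNReal.ofReal_mul (by positivity),
      ← Real.exp_add, ← Real.exp_add, processEval_sub]
    congr 2; ring
  simp_rw [h1]
  have := h.measurable_processEval (f - g)
  rw [lintegral_mul_const _ (by fun_prop), h.lintegral_exp, ← ENNReal.ofReal_mul (by positivity),
    ← Real.exp_add]
  congr 2
  simp only [map_sub, LinearMap.sub_apply]
  rw [kernelForm_comm h.symm f g]; ring

theorem lintegral_tiltDensity (h : IsGaussianFamily P X K) (g : T →₀ ℝ) :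
    ∫⁻ ω, tiltDensity X K g ω ∂P = 1 := by
  have := h.lintegral_tiltDensity_mul_exp g 0
  simpa [processEval] using this

theorem lintegral_tiltDensity_mul_tiltDensity (h : IsGaussianFamily P X K) (f g : T →₀ ℝ) :
    ∫⁻ ω, tiltDensity X K f ω * tiltDensity X K g ω ∂P =
      ENNReal.ofReal (Real.exp (kernelForm K f g)) := by
  have h1 : ∀ ω, tiltDensity X K f ω * tiltDensity X K g ω =
      (tiltDensity X K f ω * ENNReal.ofReal (Real.exp (processEval X (-g) ω))) *
        ENNReal.ofReal (Real.exp (-(kernelForm K g g / 2))) := by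
    intro ω
    rw [mul_assoc]
    congr 1
    rw [tiltDensity, ← ENNReal.ofReal_mul (by positivity), ← Real.exp_add, processEval_neg]
    congr 2
  simp_rw [h1]
  have := h.measurable_processEval (-g)
  have h2 := h.measurable_tiltDensity f
  rw [lintegral_mul_const _ (by fun_prop), h.lintegral_tiltDensity_mul_exp,
    ← ENNReal.ofReal_mul (by positivity), ← Real.exp_add]
  congr 2
  simp only [map_neg, LinearMap.neg_apply]
  ring

end IsGaussianFamily

/-- A second-moment bound for a mixture of densities: if the bad events have small mass under
every tilted measure and the mixture has second moment close to one, then the complement of some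
bad event occurs with probability close to one. -/
theorem one_le_measure_iUnion_compl_add [IsProbabilityMeasure P] {ι : Type*} [Fintype ι] [Nonempty ι]
    {w : ι → Ω → ENNReal} {bad : ι → Set Ω} {ε η : ENNReal}
    (hw : ∀ i, Measurable (w i)) (hbad : ∀ i, MeasurableSet (bad i))
    (hw1 : ∀ i, ∫⁻ ω, w i ω ∂P = 1) (hε : ∀ i, ∫⁻ ω in bad i, w i ω ∂P ≤ ε)
    (hη : ∀ i, ∑ j, ∫⁻ ω, w i ω * w j ω ∂P ≤ (1 + η) * Fintype.card ι) :
    1 ≤ P (⋃ i, (bad i)ᶜ) + η + 2 * ε := by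
  set N : ENNReal := (Fintype.card ι : ENNReal) with hN
  have hN0 : N ≠ 0 := by simp [hN]
  have hNt : N ≠ ⊤ := by simp [hN]
  set Z : Ω → ENNReal := fun ω => N⁻¹ * ∑ i, (bad i)ᶜ.indicator (w i) ω with hZ
  set W : Ω → ENNReal := fun ω => N⁻¹ * ∑ i, w i ω with hW
  have hZm : Measurable Z := by
    refine Measurable.const_mul (Finset.measurable_sum _ fun i _ => ?_) _
    exact (hw i).indicator (hbad i).compl
  have hWm : Measurable W := Measurable.const_mul (Finset.measurable_sum _ fun i _ => hw i) _
  have hww : ∀ i j, Measurable fun ω => w i ω * w j ω := fun i j => (hw i).mul (hw j)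
  have hWW : Measurable fun ω => W ω * W ω := hWm.mul hWm
  have hGm : MeasurableSet (⋃ i, (bad i)ᶜ) := MeasurableSet.iUnion fun i => (hbad i).compl
  have hZ1 : 1 ≤ ∫⁻ ω, Z ω ∂P + ε := by
    rw [hZ, lintegral_const_mul _ (Finset.measurable_sum _ fun i _ =>
      (hw i).indicator (hbad i).compl), lintegral_finsetSum _ fun i _ =>
      (hw i).indicator (hbad i).compl]
    have h1 : ∀ i, 1 ≤ ∫⁻ ω, (bad i)ᶜ.indicator (w i) ω ∂P + ε := by
      intro i
      rw [← hw1 i, ← lintegral_add_compl _ (hbad i), lintegral_indicator (hbad i).compl, add_comm]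
      gcongr
      exact hε i
    calc (1 : ENNReal) = N⁻¹ * ∑ _i : ι, 1 := by
          simp [← hN, ENNReal.inv_mul_cancel hN0 hNt]
      _ ≤ N⁻¹ * ∑ i, (∫⁻ ω, (bad i)ᶜ.indicator (w i) ω ∂P + ε) := by
          gcongr with i; exact h1 i
      _ = _ := by
          rw [Finset.sum_add_distrib, mul_add]
          simp [← hN, ← mul_assoc, ENNReal.inv_mul_cancel hN0 hNt]
  have hW2 : ∫⁻ ω, W ω * W ω ∂P ≤ 1 + η := by
    have h1 : ∀ ω, W ω * W ω = N⁻¹ * N⁻¹ * ∑ i, ∑ j, w i ω * w j ω := by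
      intro ω
      rw [hW]; simp only
      rw [← Finset.sum_mul_sum]; ring
    simp_rw [h1]
    rw [lintegral_const_mul _ (Finset.measurable_sum _ fun i _ => Finset.measurable_sum _ fun j _ => hww i j), lintegral_finsetSum _ fun i _ => Finset.measurable_sum _ fun j _ => hww i j]
    calc _ ≤ N⁻¹ * N⁻¹ * ∑ _i : ι, (1 + η) * N := by
          gcongr with i
          rw [lintegral_finsetSum _ fun j _ => hww i j]
          exact hη i
      _ = (N⁻¹ * N) * (N⁻¹ * N) * (1 + η) := by
          simp [← hN]; ring
      _ = _ := by rw [ENNReal.inv_mul_cancel hN0 hNt]; simp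
  have hpt : ∀ ω, 2 * Z ω ≤ (⋃ i, (bad i)ᶜ).indicator 1 ω + W ω * W ω := by
    intro ω
    by_cases hω : ω ∈ ⋃ i, (bad i)ᶜ
    · rw [Set.indicator_of_mem hω]
      have hZW : Z ω ≤ W ω := by
        simp only [hZ, hW]
        gcongr
        exact Set.indicator_le_self _ _ _
      refine (mul_le_mul_right hZW 2).trans ?_
      rcases eq_or_ne (W ω) ⊤ with h | h
      · simp [h]
      · lift W ω to NNReal using h with x
        simp only [Pi.one_apply]
        norm_cast
        have : (0 : ℝ) ≤ (x - 1) ^ 2 := sq_nonneg _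
        rw [← NNReal.coe_le_coe]; push_cast; nlinarith
    · have : Z ω = 0 := by
        simp only [hZ]
        rw [Finset.sum_eq_zero, mul_zero]
        intro i _
        refine Set.indicator_of_notMem (fun h => hω (Set.mem_iUnion.2 ⟨i, h⟩)) _
      simp [this]
  have h_lint : 2 * ∫⁻ ω, Z ω ∂P ≤ P (⋃ i, (bad i)ᶜ) + (1 + η) := by
    rw [← lintegral_const_mul _ hZm]
    refine (lintegral_mono hpt).trans ?_
    rw [lintegral_add_right _ hWW, lintegral_indicator_one hGm]
    gcongr
  have h2 : (1 : ENNReal) + 1 ≤ 1 + (P (⋃ i, (bad i)ᶜ) + η + 2 * ε) := by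
    calc (1 : ENNReal) + 1 = 2 * 1 := by norm_num
      _ ≤ 2 * (∫⁻ ω, Z ω ∂P + ε) := by gcongr
      _ = 2 * ∫⁻ ω, Z ω ∂P + 2 * ε := mul_add _ _ _
      _ ≤ P (⋃ i, (bad i)ᶜ) + (1 + η) + 2 * ε := by gcongr
      _ = _ := by ring
  exact (ENNReal.add_le_add_iff_left (by simp)).1 h2

end GaussianFamily

section Tent

/-- The tent function supported on `[-1, 1]`. -/
noncomputable def tent (x : ℝ) : ℝ := max 0 (1 - |x|)

theorem tent_nonneg (x : ℝ) : 0 ≤ tent x := le_max_left _ _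

theorem tent_eq_zero {x : ℝ} (h : 1 ≤ |x|) : tent x = 0 := max_eq_left (by linarith)

theorem tent_eq {x : ℝ} (h : |x| ≤ 1) : tent x = 1 - |x| := max_eq_right (by linarith)

theorem abs_tent_sub_le (x y : ℝ) : |tent x - tent y| ≤ |x - y| := by
  unfold tent
  calc |max 0 (1 - |x|) - max 0 (1 - |y|)| = |max (1 - |x|) 0 - max (1 - |y|) 0| := by
        rw [max_comm, max_comm 0]
    _ ≤ |(1 - |x|) - (1 - |y|)| := abs_max_sub_max_le_abs _ _ _
    _ = |(|y| - |x|)| := by congr 1; ring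
    _ ≤ |y - x| := abs_abs_sub_abs_le_abs_sub _ _
    _ = |x - y| := abs_sub_comm _ _

theorem half_le_tent {x : ℝ} (h : |x| ≤ 1 / 2) : 1 / 2 ≤ tent x :=
  le_trans (by linarith) (le_max_right _ _)

theorem eq_floor_or_eq_floor_add_one_of_tent_ne_zero {τ : ℝ} (hτ : 0 ≤ τ) {κ : ℕ}
    (h : tent (τ - κ) ≠ 0) : κ = ⌊τ⌋₊ ∨ κ = ⌊τ⌋₊ + 1 := by
  have h1 : |τ - κ| < 1 := by
    by_contra! hc; exact h (tent_eq_zero hc)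
  rw [abs_lt] at h1
  have h2 := Nat.floor_le hτ
  have h3 := Nat.lt_floor_add_one τ
  have h4 : (κ : ℝ) < (⌊τ⌋₊ : ℝ) + 2 := by linarith
  have h5 : (⌊τ⌋₊ : ℝ) < κ + 1 := by linarith
  have h4' : κ < ⌊τ⌋₊ + 2 := by exact_mod_cast h4
  have h5' : ⌊τ⌋₊ < κ + 1 := by exact_mod_cast h5
  omega

theorem sum_tent_le_one {τ : ℝ} (hτ : 0 ≤ τ) (s : Finset ℕ) :
    ∑ κ ∈ s, tent (τ - κ) ≤ 1 := by
  have h2 := Nat.floor_le hτ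
  have h3 := Nat.lt_floor_add_one τ
  calc ∑ κ ∈ s, tent (τ - κ) ≤ ∑ κ ∈ s ∪ {⌊τ⌋₊, ⌊τ⌋₊ + 1}, tent (τ - κ) :=
        Finset.sum_le_sum_of_subset_of_nonneg Finset.subset_union_left fun _ _ _ => tent_nonneg _
    _ = ∑ κ ∈ {⌊τ⌋₊, ⌊τ⌋₊ + 1}, tent (τ - κ) := by
        refine (Finset.sum_subset Finset.subset_union_right fun κ _ hκ => ?_).symm
        by_contra h
        have := eq_floor_or_eq_floor_add_one_of_tent_ne_zero hτ h
        exact hκ (by simpa using this)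
    _ = tent (τ - ⌊τ⌋₊) + tent (τ - (⌊τ⌋₊ + 1)) := by
        rw [Finset.sum_pair (by simp)]; push_cast; rfl
    _ = 1 := by
        rw [tent_eq, tent_eq, abs_of_nonneg, abs_of_nonpos] <;> try rw [abs_le]
        · ring
        all_goals first | linarith | constructor <;> linarith
    _ ≤ 1 := le_rfl

theorem sum_abs_tent_sub_le {τ τ' : ℝ} (hτ : 0 ≤ τ) (hτ' : 0 ≤ τ') (s : Finset ℕ) :
    ∑ κ ∈ s, |tent (τ - κ) - tent (τ' - κ)| ≤ 4 * |τ - τ'| := by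
  set U : Finset ℕ := {⌊τ⌋₊, ⌊τ⌋₊ + 1, ⌊τ'⌋₊, ⌊τ'⌋₊ + 1}
  calc ∑ κ ∈ s, |tent (τ - κ) - tent (τ' - κ)|
      ≤ ∑ κ ∈ s ∪ U, |tent (τ - κ) - tent (τ' - κ)| :=
        Finset.sum_le_sum_of_subset_of_nonneg Finset.subset_union_left fun _ _ _ => abs_nonneg _
    _ = ∑ κ ∈ U, |tent (τ - κ) - tent (τ' - κ)| := by
        refine (Finset.sum_subset Finset.subset_union_right fun κ _ hκ => ?_).symm
        simp only [U, Finset.mem_insert, Finset.mem_singleton, not_or] at hκ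
        have h1 : tent (τ - κ) = 0 := by
          by_contra h
          have := eq_floor_or_eq_floor_add_one_of_tent_ne_zero hτ h
          tauto
        have h2 : tent (τ' - κ) = 0 := by
          by_contra h
          have := eq_floor_or_eq_floor_add_one_of_tent_ne_zero hτ' h
          tauto
        rw [h1, h2]; simp
    _ ≤ ∑ κ ∈ U, |τ - τ'| := by
        refine Finset.sum_le_sum fun κ _ => (abs_tent_sub_le _ _).trans (le_of_eq ?_)
        congr 1; ring
    _ = U.card * |τ - τ'| := by simp
    _ ≤ 4 * |τ - τ'| := by
        gcongr
        exact_mod_cast (Finset.card_insert_le _ _).trans (by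
          have := Finset.card_le_three (a := ⌊τ⌋₊ + 1) (b := ⌊τ'⌋₊) (c := ⌊τ'⌋₊ + 1)
          omega)

variable {ι : Type*} [DecidableEq ι]

/-- The total tent weight at `τ` of the integers `κ < K` carrying the label `x`. -/
noncomputable def labelWeight (K : ℕ) (f : ℕ → ι) (x : ι) (τ : ℝ) : ℝ :=
  ∑ κ ∈ Finset.range K, if f κ = x then tent (τ - κ) else 0

theorem labelWeight_nonneg (K : ℕ) (f : ℕ → ι) (x : ι) (τ : ℝ) : 0 ≤ labelWeight K f x τ :=
  Finset.sum_nonneg fun κ _ => by split_ifs <;> simp [tent_nonneg]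

theorem labelWeight_le_one (K : ℕ) (f : ℕ → ι) (x : ι) {τ : ℝ} (hτ : 0 ≤ τ) :
    labelWeight K f x τ ≤ 1 := by
  refine le_trans (Finset.sum_le_sum fun κ _ => ?_) (sum_tent_le_one hτ (Finset.range K))
  split_ifs <;> simp [tent_nonneg]

theorem abs_labelWeight_sub_le (K : ℕ) (f : ℕ → ι) (x : ι) {τ τ' : ℝ} (hτ : 0 ≤ τ) (hτ' : 0 ≤ τ') :
    |labelWeight K f x τ - labelWeight K f x τ'| ≤ 4 * |τ - τ'| := by
  unfold labelWeight
  rw [← Finset.sum_sub_distrib]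
  refine (Finset.abs_sum_le_sum_abs _ _).trans
    (le_trans (Finset.sum_le_sum fun κ _ => ?_) (sum_abs_tent_sub_le hτ hτ' (Finset.range K)))
  split_ifs <;> simp

theorem labelWeight_eq_zero {K : ℕ} {f : ℕ → ι} {x : ι} {τ : ℝ}
    (h : ∀ κ < K, f κ = x → 1 ≤ |τ - κ|) : labelWeight K f x τ = 0 :=
  Finset.sum_eq_zero fun κ hκ => by
    split_ifs with hx
    · exact tent_eq_zero (h κ (Finset.mem_range.1 hκ) hx)
    · rfl

theorem half_le_labelWeight {K : ℕ} {f : ℕ → ι} {τ : ℝ} {κ : ℕ} (hκ : κ < K)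
    (h : |τ - κ| ≤ 1 / 2) : 1 / 2 ≤ labelWeight K f (f κ) τ := by
  refine (half_le_tent h).trans ?_
  have := Finset.single_le_sum (f := fun κ' : ℕ => if f κ' = f κ then tent (τ - κ') else 0)
    (fun κ' _ => by split_ifs <;> simp [tent_nonneg]) (Finset.mem_range.2 hκ)
  simpa [labelWeight] using this

theorem eq_or_eq_of_labelWeight_pos {K : ℕ} {f : ℕ → ι} {x : ι} {τ : ℝ} (hτ : 0 ≤ τ)
    (h : 0 < labelWeight K f x τ) : x = f ⌊τ⌋₊ ∨ x = f (⌊τ⌋₊ + 1) := by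
  obtain ⟨κ, -, hκ⟩ := Finset.exists_ne_zero_of_sum_ne_zero h.ne'
  split_ifs at hκ with hx
  · rcases eq_floor_or_eq_floor_add_one_of_tent_ne_zero hτ hκ with rfl | rfl
    · exact Or.inl hx.symm
    · exact Or.inr hx.symm
  · exact absurd rfl hκ

end Tent

/-- The ratio of the mesh sizes of two consecutive levels of the path construction. -/
def mesh : ℕ := 262144

theorem cast_mesh : (mesh : ℝ) = 262144 := by norm_num [mesh]

theorem mesh_pos : 0 < mesh := by norm_num [mesh]

theorem cast_mesh_pos : (0 : ℝ) < mesh := by norm_num [mesh]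

section PathCoord

variable {ι : Type*} [DecidableEq ι]

/-- The rescaled displacement in direction `x` produced by the first `m` levels of zigzags. -/
noncomputable def pathCoord (K : ℕ) (f : ℕ → ℕ → ι) (m : ℕ) (x : ι) (u : ℝ) : ℝ :=
  ∑ i ∈ Finset.range m, (1 / 64 : ℝ) ^ i * labelWeight K (f i) x (mesh ^ (i + 1) * u)

theorem pathCoord_succ (K : ℕ) (f : ℕ → ℕ → ι) (m : ℕ) (x : ι) (u : ℝ) :
    pathCoord K f (m + 1) x u =
      pathCoord K f m x u + (1 / 64) ^ m * labelWeight K (f m) x (mesh ^ (m + 1) * u) :=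
  Finset.sum_range_succ _ _

theorem pathCoord_congr (K : ℕ) {f f' : ℕ → ℕ → ι} {m : ℕ} (h : ∀ i < m, f i = f' i) (x : ι)
    (u : ℝ) : pathCoord K f m x u = pathCoord K f' m x u :=
  Finset.sum_congr rfl fun i hi => by rw [h i (Finset.mem_range.1 hi)]

theorem sum_range_pow_le (m : ℕ) : ∑ i ∈ Finset.range m, (4096 : ℝ) ^ i ≤ 4096 ^ m / 4095 := by
  rw [geom_sum_eq (by norm_num)]
  norm_num
  gcongr
  linarith

theorem abs_pathCoord_sub_le (K : ℕ) (f : ℕ → ℕ → ι) (m : ℕ) (x : ι) {u u' : ℝ} (hu : 0 ≤ u)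
    (hu' : 0 ≤ u') :
    |pathCoord K f m x u - pathCoord K f m x u'| ≤ (1 / 64) ^ m * (4 / 4095) *
      (mesh ^ (m + 1) * |u - u'|) := by
  unfold pathCoord
  rw [← Finset.sum_sub_distrib]
  calc _ ≤ ∑ i ∈ Finset.range m, 4 * mesh * |u - u'| * 4096 ^ i := by
        refine (Finset.abs_sum_le_sum_abs _ _).trans (Finset.sum_le_sum fun i _ => ?_)
        rw [← mul_sub, abs_mul, abs_of_nonneg (by positivity : (0:ℝ) ≤ (1 / 64) ^ i)]
        calc _ ≤ (1 / 64 : ℝ) ^ i * (4 * |mesh ^ (i + 1) * u - mesh ^ (i + 1) * u'|) := by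
              gcongr
              exact abs_labelWeight_sub_le _ _ _ (by positivity) (by positivity)
          _ = _ := by
              rw [← mul_sub, abs_mul, abs_of_nonneg (by positivity : (0:ℝ) ≤ mesh ^ (i + 1)),
                show (4096 : ℝ) = 1 / 64 * mesh by rw [cast_mesh]; norm_num, mul_pow, pow_succ]
              ring
    _ ≤ 4 * mesh * |u - u'| * (4096 ^ m / 4095) := by
        rw [← Finset.mul_sum]
        gcongr
        exact sum_range_pow_le m
    _ = _ := by
        rw [show (4096 : ℝ) = 1 / 64 * mesh by rw [cast_mesh]; norm_num, mul_pow, pow_succ]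
        rw [show (4095 : ℝ) = 4095 by rfl]
        ring

theorem abs_pathCoord_sub_pathCoord_le (K : ℕ) (f f' : ℕ → ℕ → ι) {l m : ℕ} (hlm : l ≤ m) (x : ι)
    {u u' : ℝ} (hu : 0 ≤ u) (hu' : 0 ≤ u') :
    |pathCoord K f l x u - pathCoord K f' l x u'| ≤
      |pathCoord K f m x u - pathCoord K f' m x u'| +
        ((1 / 64) ^ l - (1 / 64) ^ m) * (64 / 63) := by
  induction m, hlm using Nat.le_induction with
  | base => simp
  | succ m _ ih =>
    refine ih.trans ?_
    rw [pathCoord_succ, pathCoord_succ]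
    set X := pathCoord K f m x u - pathCoord K f' m x u'
    have h1 := labelWeight_nonneg K (f m) x (mesh ^ (m + 1) * u)
    have h2 := labelWeight_nonneg K (f' m) x (mesh ^ (m + 1) * u')
    have h3 := labelWeight_le_one K (f m) x (τ := mesh ^ (m + 1) * u) (by positivity)
    have h4 := labelWeight_le_one K (f' m) x (τ := mesh ^ (m + 1) * u') (by positivity)
    set w := labelWeight K (f m) x (mesh ^ (m + 1) * u)
    set w' := labelWeight K (f' m) x (mesh ^ (m + 1) * u')
    have hp : (0 : ℝ) < (1 / 64) ^ m := by positivity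
    have h5 : |X| ≤ |X + (1 / 64) ^ m * (w - w')| + (1 / 64) ^ m := by
      calc |X| = |(X + (1 / 64) ^ m * (w - w')) - (1 / 64) ^ m * (w - w')| := by ring_nf
        _ ≤ _ := (abs_sub _ _)
        _ ≤ _ := by
          gcongr
          rw [abs_mul, abs_of_pos hp]
          have : |w - w'| ≤ 1 := by rw [abs_le]; constructor <;> linarith
          nlinarith
    rw [show pathCoord K f m x u + (1 / 64) ^ m * w - (pathCoord K f' m x u' + (1 / 64) ^ m * w') =
      X + (1 / 64) ^ m * (w - w') by simp only [X]; ring, pow_succ]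
    linarith

end PathCoord

section Separation

/-- The label of the deterministic direction used by the `κ`-th zigzag of level `i`. -/
def detLabel (i κ : ℕ) : Fin 2 × Fin (4 * mesh) :=
  (⟨i % 2, Nat.mod_lt _ two_pos⟩, ⟨κ % (4 * mesh), Nat.mod_lt _ (by norm_num [mesh])⟩)

theorem exists_nat_abs_sub_le_half {τ : ℝ} (hτ : 0 ≤ τ) :
    ∃ κ : ℕ, |τ - κ| ≤ 1 / 2 ∧ (κ = ⌊τ⌋₊ ∨ κ = ⌊τ⌋₊ + 1) := by
  have h1 := Nat.floor_le hτ
  have h2 := Nat.lt_floor_add_one τ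
  by_cases h : τ ≤ ⌊τ⌋₊ + 1 / 2
  · exact ⟨⌊τ⌋₊, by rw [abs_le]; constructor <;> linarith, Or.inl rfl⟩
  · push Not at h
    exact ⟨⌊τ⌋₊ + 1, by rw [abs_le]; push_cast; constructor <;> linarith, Or.inr rfl⟩

theorem abs_pathCoord_detLabel_sub_le (K i κ : ℕ) {u u' : ℝ} (hu : 0 ≤ u) (hu' : 0 ≤ u')
    (h : mesh ^ i * |u - u'| ≤ 2) :
    |pathCoord K detLabel i (detLabel i κ) u - pathCoord K detLabel i (detLabel i κ) u'| ≤
      (1 / 64) ^ i * (512 / 4095) := by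
  cases i with
  | zero => simp [pathCoord]; positivity
  | succ i =>
    have hz : ∀ τ : ℝ, labelWeight K (detLabel i) (detLabel (i + 1) κ) τ = 0 := by
      intro τ
      refine labelWeight_eq_zero fun κ' _ hκ' => ?_
      have := congrArg (fun z => (z.1 : ℕ)) hκ'
      simp only [detLabel] at this
      omega
    rw [pathCoord_succ, pathCoord_succ, hz, hz, mul_zero, add_zero, add_zero]
    refine (abs_pathCoord_sub_le K _ i _ hu hu').trans ?_
    calc (1 / 64 : ℝ) ^ i * (4 / 4095) * (mesh ^ (i + 1) * |u - u'|)
        ≤ (1 / 64 : ℝ) ^ i * (4 / 4095) * 2 := by gcongr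
      _ = _ := by rw [pow_succ]; ring

theorem abs_sub_lt_of_detLabel_near_aux {K i : ℕ} {u u' : ℝ} (hK : mesh ^ (i + 1) + 2 ≤ K)
    (hu : 0 ≤ u) (hu1 : u ≤ 1) (hu' : 0 ≤ u') (hi : mesh ^ i * |u - u'| ≤ 2)
    (h : ∀ x, |pathCoord K detLabel (i + 1) x u - pathCoord K detLabel (i + 1) x u'| ≤
      (1 / 64) ^ i / 8) :
    mesh ^ (i + 1) * |u - u'| < 2 := by
  by_contra! h2
  obtain ⟨κ, hκ, hκf⟩ := exists_nat_abs_sub_le_half (τ := mesh ^ (i + 1) * u) (by positivity)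
  have habs : |(mesh : ℝ) ^ (i + 1) * u - mesh ^ (i + 1) * u'| = mesh ^ (i + 1) * |u - u'| := by
    rw [← mul_sub, abs_mul, abs_of_nonneg (by positivity : (0 : ℝ) ≤ mesh ^ (i + 1))]
  have hup : |(mesh : ℝ) ^ (i + 1) * u - mesh ^ (i + 1) * u'| ≤ 2 * mesh := by
    rw [habs, pow_succ]; nlinarith [cast_mesh_pos]
  have hlow : 2 ≤ |(mesh : ℝ) ^ (i + 1) * u - mesh ^ (i + 1) * u'| := by rw [habs]; exact h2
  have hκK : κ < K := by
    have h3 : (κ : ℝ) < mesh ^ (i + 1) + 2 := by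
      have := (abs_le.1 hκ).1
      have : (mesh : ℝ) ^ (i + 1) * u ≤ mesh ^ (i + 1) := mul_le_of_le_one_right (by positivity) hu1
      linarith
    have h4 : κ < mesh ^ (i + 1) + 2 := by exact_mod_cast h3
    omega
  have hcoarse := abs_pathCoord_detLabel_sub_le K i κ hu hu' hi
  have hx := h (detLabel i κ)
  have hw : 1 / 2 ≤ labelWeight K (detLabel i) (detLabel i κ) (mesh ^ (i + 1) * u) :=
    half_le_labelWeight hκK hκ
  have hw' : labelWeight K (detLabel i) (detLabel i κ) (mesh ^ (i + 1) * u') = 0 := by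
    refine labelWeight_eq_zero fun κ' _ hκ' => ?_
    by_contra! h3
    have hmod : κ' % (4 * mesh) = κ % (4 * mesh) := congrArg (fun z => (z.2 : ℕ)) hκ'
    have hm : (262144 : ℝ) = mesh := cast_mesh.symm
    rw [abs_le] at hκ hup
    rw [abs_lt] at h3
    have h5 : (κ' : ℝ) < κ + 4 * mesh := by linarith
    have h6 : (κ : ℝ) < κ' + 4 * mesh := by linarith
    have h5' : κ' < κ + 4 * mesh := by exact_mod_cast h5
    have h6' : κ < κ' + 4 * mesh := by exact_mod_cast h6
    have heq : κ' = κ := by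
      have hpos := mesh_pos
      rcases le_total κ κ' with hle | hle
      · have h7 := (Nat.modEq_iff_dvd' hle).1 hmod.symm
        have h8 := Nat.eq_zero_of_dvd_of_lt h7 (by omega)
        omega
      · have h7 := (Nat.modEq_iff_dvd' hle).1 hmod
        have h8 := Nat.eq_zero_of_dvd_of_lt h7 (by omega)
        omega
    subst heq
    have : |(mesh : ℝ) ^ (i + 1) * u - mesh ^ (i + 1) * u'| < 2 := by
      rw [abs_lt]; constructor <;> linarith
    linarith
  rw [pathCoord_succ, pathCoord_succ, hw', mul_zero, add_zero] at hx
  have hp : (0 : ℝ) < (1 / 64) ^ i := by positivity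
  rw [abs_le] at hx hcoarse
  nlinarith

theorem abs_sub_lt_of_detLabel_near {K i : ℕ} {u u' : ℝ} (hK : mesh ^ (i + 1) + 2 ≤ K)
    (hu : 0 ≤ u) (hu1 : u ≤ 1) (hu' : 0 ≤ u') (hu1' : u' ≤ 1)
    (h : ∀ l ≤ i, ∀ x, |pathCoord K detLabel (l + 1) x u - pathCoord K detLabel (l + 1) x u'| ≤
      (1 / 64) ^ l / 8) :
    mesh ^ (i + 1) * |u - u'| < 2 := by
  induction i with
  | zero =>
    refine abs_sub_lt_of_detLabel_near_aux hK hu hu1 hu' ?_ (h 0 le_rfl)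
    rw [pow_zero, one_mul, abs_le]; constructor <;> linarith
  | succ i ih =>
    refine abs_sub_lt_of_detLabel_near_aux hK hu hu1 hu' (ih ?_ fun l hl => h l (by omega)).le
      (h _ le_rfl)
    have : mesh ^ (i + 1) ≤ mesh ^ (i + 1 + 1) := Nat.pow_le_pow_right mesh_pos (by omega)
    omega

variable {D : ℕ}

/-- Two path parameters are near at level `i` if the rescaled displacements accumulated up to
level `i` nearly agree in all directions. -/
def LevelNear (K : ℕ) (c c' : ℕ → ℕ → Fin D) (i : ℕ) (u u' : ℝ) : Prop :=
  (∀ x, |pathCoord K c (i + 1) x u - pathCoord K c' (i + 1) x u'| ≤ (1 / 64) ^ i / 8) ∧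
    ∀ x, |pathCoord K detLabel (i + 1) x u - pathCoord K detLabel (i + 1) x u'| ≤ (1 / 64) ^ i / 8

/-- The directions in which the path with choices `c` lags substantially behind the path with
choices `c'`, at the `κ`-th zigzag of level `i`. -/
noncomputable def laggingLabels (K : ℕ) (c c' : ℕ → ℕ → Fin D) (i κ : ℕ) : Finset (Fin D) :=
  Finset.univ.filter fun y =>
    pathCoord K c i y (κ / mesh ^ (i + 1)) - pathCoord K c' i y (κ / mesh ^ (i + 1)) <
      -((1 / 64) ^ i / 4)

/-- A set of at most nine directions containing the direction of the `κ`-th zigzag of level `i`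
whenever the two paths stay near at that level. -/
noncomputable def badLabels (K : ℕ) (c c' : ℕ → ℕ → Fin D) (i κ : ℕ) : Finset (Fin D) :=
  (if (laggingLabels K c c' i κ).card ≤ 2 then laggingLabels K c c' i κ else ∅) ∪
    (Finset.Icc (κ - 3) (κ + 3)).image (c' i)

theorem card_badLabels_le (K : ℕ) (c c' : ℕ → ℕ → Fin D) (i κ : ℕ) :
    (badLabels K c c' i κ).card ≤ 9 := by
  refine (Finset.card_union_le _ _).trans ?_
  have h1 : (if (laggingLabels K c c' i κ).card ≤ 2 then laggingLabels K c c' i κ else ∅).card ≤ 2 := by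
    split_ifs with h
    · exact h
    · simp
  have h2 := Finset.card_image_le (s := Finset.Icc (κ - 3) (κ + 3)) (f := c' i)
  rw [Nat.card_Icc] at h2
  omega

theorem badLabels_congr (K : ℕ) {c d : ℕ → ℕ → Fin D} (c' : ℕ → ℕ → Fin D) {i : ℕ}
    (h : ∀ l < i, c l = d l) (κ : ℕ) : badLabels K c c' i κ = badLabels K d c' i κ := by
  unfold badLabels laggingLabels
  simp_rw [pathCoord_congr K h]

theorem exists_mem_badLabels {K i : ℕ} {c c' : ℕ → ℕ → Fin D} {u u' : ℝ}
    (hK : mesh ^ (i + 1) + 2 ≤ K) (hu : 0 ≤ u) (hu1 : u ≤ 1) (hu' : 0 ≤ u')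
    (hd : mesh ^ (i + 1) * |u - u'| < 2) (hn : LevelNear K c c' i u u') :
    ∃ κ, (κ = ⌊(mesh : ℝ) ^ (i + 1) * u⌋₊ ∨ κ = ⌊(mesh : ℝ) ^ (i + 1) * u⌋₊ + 1) ∧
      c i κ ∈ badLabels K c c' i κ := by
  set τ : ℝ := mesh ^ (i + 1) * u with hτ
  set τ' : ℝ := mesh ^ (i + 1) * u' with hτ'
  have hm : (0 : ℝ) < mesh ^ (i + 1) := pow_pos cast_mesh_pos _
  have hp : (0 : ℝ) < (1 / 64) ^ i := by positivity
  have hdτ : |τ - τ'| < 2 := by rwa [hτ, hτ', ← mul_sub, abs_mul, abs_of_pos hm]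
  obtain ⟨κ, hκ, hκf⟩ := exists_nat_abs_sub_le_half (τ := τ) (by positivity)
  refine ⟨κ, hκf, ?_⟩
  unfold badLabels
  rw [Finset.mem_union, or_iff_not_imp_right]
  intro hc'
  have hκK : κ < K := by
    have h3 : (κ : ℝ) < mesh ^ (i + 1) + 2 := by
      have := (abs_le.1 hκ).1
      have : τ ≤ mesh ^ (i + 1) := mul_le_of_le_one_right (by positivity) hu1
      linarith
    have h4 : κ < mesh ^ (i + 1) + 2 := by exact_mod_cast h3
    omega
  set v : ℝ := κ / mesh ^ (i + 1) with hv
  have hv0 : 0 ≤ v := by positivity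
  have hmv : mesh ^ (i + 1) * v = κ := by rw [hv]; field_simp
  have hshift : ∀ y, |(pathCoord K c i y u - pathCoord K c' i y u') -
      (pathCoord K c i y v - pathCoord K c' i y v)| ≤ (1 / 64) ^ i * (12 / 4095) := by
    intro y
    have h1 := abs_pathCoord_sub_le K c i y hu hv0
    have h2 := abs_pathCoord_sub_le K c' i y hu' hv0
    have h3 : mesh ^ (i + 1) * |u - v| ≤ 1 / 2 := by
      rw [← abs_of_pos hm, ← abs_mul, mul_sub, hmv]; exact hκ
    have h4 : mesh ^ (i + 1) * |u' - v| ≤ 5 / 2 := by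
      rw [← abs_of_pos hm, ← abs_mul, mul_sub, hmv, ← hτ']
      rw [abs_le] at hκ ⊢; rw [abs_lt] at hdτ
      constructor <;> linarith
    have h5 : (1 / 64 : ℝ) ^ i * (4 / 4095) * (mesh ^ (i + 1) * |u - v|) ≤
        (1 / 64) ^ i * (4 / 4095) * (1 / 2) := by gcongr
    have h6 : (1 / 64 : ℝ) ^ i * (4 / 4095) * (mesh ^ (i + 1) * |u' - v|) ≤
        (1 / 64) ^ i * (4 / 4095) * (5 / 2) := by gcongr
    rw [abs_le] at h1 h2 ⊢
    constructor <;> linarith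
  have hnear := hn.1
  simp_rw [pathCoord_succ] at hnear
  rw [← hτ, ← hτ'] at hnear
  have hmem : c i κ ∈ laggingLabels K c c' i κ := by
    have hw : 1 / 2 ≤ labelWeight K (c i) (c i κ) τ := half_le_labelWeight hκK hκ
    have hw' : labelWeight K (c' i) (c i κ) τ' = 0 := by
      refine labelWeight_eq_zero fun κ' _ hκ' => ?_
      by_contra! h3
      refine hc' (Finset.mem_image.2 ⟨κ', ?_, hκ'⟩)
      rw [abs_lt] at h3 hdτ
      rw [abs_le] at hκ
      have h5 : (κ' : ℝ) < κ + 4 := by linarith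
      have h6 : (κ : ℝ) < κ' + 4 := by linarith
      have h5' : κ' < κ + 4 := by exact_mod_cast h5
      have h6' : κ < κ' + 4 := by exact_mod_cast h6
      rw [Finset.mem_Icc]; omega
    have h1 := hnear (c i κ)
    have h2 := hshift (c i κ)
    rw [hw', mul_zero, add_zero] at h1
    simp only [laggingLabels, Finset.mem_filter, Finset.mem_univ, true_and]
    rw [← hv]
    rw [abs_le] at h1 h2
    nlinarith
  have hcard : (laggingLabels K c c' i κ).card ≤ 2 := by
    refine (Finset.card_le_card (t := {c i ⌊τ⌋₊, c i (⌊τ⌋₊ + 1)}) fun y hy => ?_).trans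
      Finset.card_le_two
    simp only [laggingLabels, Finset.mem_filter, Finset.mem_univ, true_and] at hy
    rw [← hv] at hy
    have h1 := hnear y
    have h2 := hshift y
    have h3 := labelWeight_nonneg K (c' i) y τ'
    have h4 : 0 < labelWeight K (c i) y τ := by
      rw [abs_le] at h1 h2
      by_contra! h4
      nlinarith
    simpa using eq_or_eq_of_labelWeight_pos (by positivity) h4
  rw [if_pos hcard]
  exact hmem

end Separation

section ActiveCells

variable {D : ℕ}

/-- The cells of level `l` in which the path with choices `c` may have stayed near the path with
choices `c'` at all coarser levels. -/
noncomputable def activeCells (K : ℕ) (c c' : ℕ → ℕ → Fin D) : ℕ → Finset ℕ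
  | 0 => {0}
  | l + 1 => (Finset.range (mesh ^ (l + 1))).filter fun k =>
      k / mesh ∈ activeCells K c c' l ∧
        (c l k ∈ badLabels K c c' l k ∨ c l (k + 1) ∈ badLabels K c c' l (k + 1))

theorem activeCells_congr (K : ℕ) {c d : ℕ → ℕ → Fin D} (c' : ℕ → ℕ → Fin D) {m : ℕ}
    (h : ∀ l < m, c l = d l) : activeCells K c c' m = activeCells K d c' m := by
  induction m with
  | zero => rfl
  | succ m ih =>
    simp only [activeCells]
    rw [ih fun l hl => h l (by omega), h m (by omega)]
    simp_rw [badLabels_congr K c' fun l hl => h l (Nat.lt_succ_of_lt hl)]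

theorem abs_sub_lt_of_levelNear {K i : ℕ} {c c' : ℕ → ℕ → Fin D} {u u' : ℝ}
    (hK : mesh ^ (i + 1) + 2 ≤ K) (hu : 0 ≤ u) (hu1 : u < 1) (hu' : 0 ≤ u') (hu1' : u' < 1)
    (hn : ∀ l ≤ i, LevelNear K c c' l u u') : mesh ^ (i + 1) * |u - u'| < 2 :=
  abs_sub_lt_of_detLabel_near hK hu hu1.le hu' hu1'.le fun l hl => (hn l hl).2

theorem floor_mem_activeCells {K m : ℕ} {c c' : ℕ → ℕ → Fin D} {u u' : ℝ}
    (hK : mesh ^ m + 2 ≤ K) (hu : 0 ≤ u) (hu1 : u < 1) (hu' : 0 ≤ u') (hu1' : u' < 1)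
    (hn : ∀ l < m, LevelNear K c c' l u u') : ⌊(mesh : ℝ) ^ m * u⌋₊ ∈ activeCells K c c' m := by
  induction m with
  | zero => simpa [activeCells, Nat.floor_eq_zero] using hu1
  | succ m ih =>
    have hm : (0 : ℝ) < mesh ^ (m + 1) := pow_pos cast_mesh_pos _
    simp only [activeCells, Finset.mem_filter, Finset.mem_range]
    refine ⟨?_, ?_, ?_⟩
    · rw [Nat.floor_lt (by positivity)]
      push_cast
      exact mul_lt_of_lt_one_right hm hu1
    · rw [← Nat.floor_div_natCast]
      have : (mesh : ℝ) ^ (m + 1) * u / mesh = mesh ^ m * u := by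
        have := cast_mesh_pos
        rw [pow_succ]
        field_simp
      rw [this]
      refine ih ?_ fun l hl => hn l (by omega)
      have : mesh ^ m ≤ mesh ^ (m + 1) := Nat.pow_le_pow_right mesh_pos (by omega)
      omega
    · obtain ⟨κ, hκ, hmem⟩ := exists_mem_badLabels hK hu hu1.le hu'
        (abs_sub_lt_of_levelNear hK hu hu1 hu' hu1' fun l hl => hn l (by omega)) (hn m (by omega))
      rcases hκ with rfl | rfl
      · exact Or.inl hmem
      · exact Or.inr hmem

theorem card_filter_div_le (s : Finset ℕ) (n : ℕ) {m : ℕ} (hm : 0 < m) :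
    ((Finset.range n).filter fun κ => κ / m ∈ s).card ≤ s.card * m := by
  calc _ ≤ (s.biUnion fun a => Finset.Ico (a * m) (a * m + m)).card := by
        refine Finset.card_le_card fun κ hκ => ?_
        rw [Finset.mem_filter] at hκ
        refine Finset.mem_biUnion.2 ⟨κ / m, hκ.2, ?_⟩
        rw [Finset.mem_Ico]
        exact ⟨Nat.div_mul_le_self κ m, Nat.lt_div_mul_add hm⟩
    _ ≤ s.card * m := Finset.card_biUnion_le_card_mul _ _ _ fun a _ => by simp

theorem card_filter_near_le (n κ m : ℕ) :
    ((Finset.range n).filter fun κ' => κ < κ' + 2 * m ∧ κ' < κ + 2 * m).card ≤ 4 * m := by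
  refine (Finset.card_le_card (t := Finset.Ico (κ + 1 - 2 * m) (κ + 2 * m)) fun κ' h => ?_).trans ?_
  · rw [Finset.mem_filter] at h
    rw [Finset.mem_Ico]; omega
  · rw [Nat.card_Ico]; omega

/-- The largest covariance at a tilting level of two points whose paths separate `q` levels before
the tilting level. -/
noncomputable def separationWeight : ℕ → ℝ
  | 0 => 1
  | q + 1 => Real.exp (-((64 ^ q) ^ 2 / 2048))

theorem separationWeight_nonneg (q : ℕ) : 0 ≤ separationWeight q := by
  cases q <;> simp only [separationWeight] <;> positivity

theorem exp_coord_le_separationWeight {ι : Type*} [DecidableEq ι] {K j l : ℕ} (hl : l ≤ j)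
    {f f' : ℕ → ℕ → ι} {x : ι} {u u' : ℝ} (hu : 0 ≤ u) (hu' : 0 ≤ u')
    (h : (1 / 64) ^ l / 8 < |pathCoord K f (l + 1) x u - pathCoord K f' (l + 1) x u'|) :
    Real.exp (-((64 ^ j) ^ 2 * (pathCoord K f (j + 1) x u - pathCoord K f' (j + 1) x u') ^ 2 / 8)) ≤
      separationWeight (j + 1 - l) := by
  obtain ⟨q, rfl⟩ := Nat.exists_eq_add_of_le hl
  rw [show l + q + 1 - l = q + 1 by omega, separationWeight]
  have h1 := abs_pathCoord_sub_pathCoord_le K f f' (show l + 1 ≤ l + q + 1 by omega) x hu hu'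
  set Δ := pathCoord K f (l + q + 1) x u - pathCoord K f' (l + q + 1) x u'
  have hp : (0 : ℝ) < (1 / 64) ^ l := by positivity
  have hp2 : (0 : ℝ) < (1 / 64) ^ (l + q + 1) := by positivity
  have h2 : (1 / 64 : ℝ) ^ l / 16 ≤ |Δ| := by
    rw [pow_succ (1 / 64 : ℝ) l] at h1
    linarith
  apply Real.exp_le_exp.2 (neg_le_neg _)
  have h3 : (64 : ℝ) ^ q / 16 ≤ 64 ^ (l + q) * |Δ| := by
    calc (64 : ℝ) ^ q / 16 = 64 ^ (l + q) * ((1 / 64) ^ l / 16) := by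
          rw [pow_add, one_div, inv_pow]; field_simp
      _ ≤ _ := by gcongr
  have h4 : ((64 : ℝ) ^ q / 16) ^ 2 ≤ (64 ^ (l + q) * |Δ|) ^ 2 := by gcongr
  rw [mul_pow, sq_abs] at h4
  linarith

theorem sum_le_sum_card_activeCells {K j : ℕ} {c c' : ℕ → ℕ → Fin D}
    (hK : mesh ^ (j + 1) + 2 ≤ K) {Γ : ℕ → ℕ → ℝ} (hΓ1 : ∀ κ κ', Γ κ κ' ≤ 1)
    (hΓ : ∀ κ κ' : ℕ, ∀ x, Γ κ κ' ≤ Real.exp (-((64 ^ j) ^ 2 *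
      (pathCoord K c (j + 1) x (κ / mesh ^ (j + 1)) -
        pathCoord K c' (j + 1) x (κ' / mesh ^ (j + 1))) ^ 2 / 8)))
    (hΓ' : ∀ κ κ' : ℕ, ∀ x, Γ κ κ' ≤ Real.exp (-((64 ^ j) ^ 2 *
      (pathCoord K detLabel (j + 1) x (κ / mesh ^ (j + 1)) -
        pathCoord K detLabel (j + 1) x (κ' / mesh ^ (j + 1))) ^ 2 / 8))) :
    ∑ κ ∈ Finset.range (mesh ^ (j + 1)), ∑ κ' ∈ Finset.range (mesh ^ (j + 1)), Γ κ κ' ≤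
      ∑ l ∈ Finset.range (j + 2), ((activeCells K c c' l).card : ℝ) *
        (4 * (mesh ^ (j + 1 - l)) ^ 2 * separationWeight (j + 1 - l)) := by
  classical
  have hm : (0 : ℝ) < mesh ^ (j + 1) := pow_pos cast_mesh_pos _
  set n := mesh ^ (j + 1) with hn
  let p : ℕ → ℕ → ℕ → Prop := fun l κ κ' => κ / mesh ^ (j + 1 - l) ∈ activeCells K c c' l ∧
    (κ < κ' + 2 * mesh ^ (j + 1 - l) ∧ κ' < κ + 2 * mesh ^ (j + 1 - l))
  have hpt : ∀ κ ∈ Finset.range n, ∀ κ' ∈ Finset.range n, Γ κ κ' ≤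
      ∑ l ∈ Finset.range (j + 2), if p l κ κ' then separationWeight (j + 1 - l) else 0 := by
    intro κ hκ κ' hκ'
    rw [Finset.mem_range] at hκ hκ'
    set u : ℝ := κ / mesh ^ (j + 1) with hu
    set u' : ℝ := κ' / mesh ^ (j + 1) with hu'
    have hu0 : 0 ≤ u := by positivity
    have hu0' : 0 ≤ u' := by positivity
    have hu1 : u < 1 := by rw [hu, div_lt_one hm]; exact_mod_cast hκ
    have hu1' : u' < 1 := by rw [hu', div_lt_one hm]; exact_mod_cast hκ'
    obtain ⟨l, hl, hnear, hΓl⟩ : ∃ l ≤ j + 1, (∀ i < l, LevelNear K c c' i u u') ∧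
        Γ κ κ' ≤ separationWeight (j + 1 - l) := by
      by_cases hall : ∀ i ≤ j, LevelNear K c c' i u u'
      · exact ⟨j + 1, le_rfl, fun i hi => hall i (by omega), by
          simpa [separationWeight] using hΓ1 κ κ'⟩
      · push Not at hall
        obtain ⟨l, hmin, hlt⟩ : ∃ l, (l ≤ j ∧ ¬LevelNear K c c' l u u') ∧
            ∀ i < l, ¬(i ≤ j ∧ ¬LevelNear K c c' i u u') :=
          ⟨Nat.find hall, Nat.find_spec hall, fun i hi => Nat.find_min hall hi⟩
        refine ⟨l, by omega, fun i hi => ?_, ?_⟩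
        · by_contra hcon
          exact hlt i hi ⟨by omega, hcon⟩
        · have h2 := hmin.2
          unfold LevelNear at h2
          rw [not_and_or] at h2
          push Not at h2
          rcases h2 with ⟨x, hx⟩ | ⟨x, hx⟩
          · exact (hΓ κ κ' x).trans (exp_coord_le_separationWeight hmin.1 hu0 hu0' hx)
          · exact (hΓ' κ κ' x).trans (exp_coord_le_separationWeight hmin.1 hu0 hu0' hx)
    have hpl : p l κ κ' := by
      have hsplit : mesh ^ (j + 1) = mesh ^ l * mesh ^ (j + 1 - l) := by
        rw [← pow_add]; congr 1; omega
      have hq : (0 : ℝ) < mesh ^ (j + 1 - l) := pow_pos cast_mesh_pos _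
      have hl0 : (0 : ℝ) < mesh ^ l := pow_pos cast_mesh_pos _
      have hsplit' : (mesh : ℝ) ^ (j + 1) = mesh ^ l * mesh ^ (j + 1 - l) := by
        exact_mod_cast hsplit
      have hKl : mesh ^ l + 2 ≤ K := by
        have : mesh ^ l ≤ mesh ^ (j + 1) := Nat.pow_le_pow_right mesh_pos hl
        omega
      refine ⟨?_, ?_⟩
      · have h1 := floor_mem_activeCells hKl hu0 hu1 hu0' hu1' hnear
        have h2 : (mesh : ℝ) ^ l * u = κ / (mesh ^ (j + 1 - l) : ℕ) := by
          rw [hu, hsplit']; push_cast; field_simp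
        rwa [h2, Nat.floor_div_eq_div] at h1
      · have h1 : (mesh : ℝ) ^ l * |u - u'| < 2 := by
          rcases Nat.eq_zero_or_pos l with rfl | hlpos
          · rw [pow_zero, one_mul, abs_lt]; constructor <;> linarith
          · obtain ⟨i, rfl⟩ : ∃ i, l = i + 1 := ⟨l - 1, by omega⟩
            exact abs_sub_lt_of_levelNear hKl hu0 hu1 hu0' hu1' fun i' hi' => hnear i' (by omega)
        have h2 : |(κ : ℝ) - κ'| < 2 * mesh ^ (j + 1 - l) := by
          have : (κ : ℝ) - κ' = mesh ^ l * mesh ^ (j + 1 - l) * (u - u') := by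
            rw [← hsplit', hu, hu']; field_simp
          rw [this, abs_mul, abs_of_pos (by positivity)]
          nlinarith
        rw [abs_lt] at h2
        have h3 : (κ : ℝ) < κ' + 2 * mesh ^ (j + 1 - l) := by linarith
        have h4 : (κ' : ℝ) < κ + 2 * mesh ^ (j + 1 - l) := by linarith
        exact ⟨by exact_mod_cast h3, by exact_mod_cast h4⟩
    refine hΓl.trans ?_
    have := Finset.single_le_sum
      (f := fun l => if p l κ κ' then separationWeight (j + 1 - l) else 0)
      (fun l _ => by split_ifs <;> simp [separationWeight_nonneg])
      (Finset.mem_range.2 (show l < j + 2 by omega))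
    simpa [hpl] using this
  calc _ ≤ ∑ κ ∈ Finset.range n, ∑ κ' ∈ Finset.range n, ∑ l ∈ Finset.range (j + 2),
        (if p l κ κ' then separationWeight (j + 1 - l) else 0) :=
        Finset.sum_le_sum fun κ hκ => Finset.sum_le_sum fun κ' hκ' => hpt κ hκ κ' hκ'
    _ = ∑ l ∈ Finset.range (j + 2), ∑ κ ∈ Finset.range n, ∑ κ' ∈ Finset.range n,
        (if p l κ κ' then separationWeight (j + 1 - l) else 0) := by
        simp_rw [Finset.sum_comm (s := Finset.range n) (t := Finset.range (j + 2))]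
    _ ≤ _ := by
        refine Finset.sum_le_sum fun l _ => ?_
        have hW := separationWeight_nonneg (j + 1 - l)
        set W := separationWeight (j + 1 - l)
        set m := mesh ^ (j + 1 - l) with hmdef
        have hin : ∀ κ, ∑ κ' ∈ Finset.range n, (if p l κ κ' then W else 0) ≤
            if κ / m ∈ activeCells K c c' l then 4 * (m : ℝ) * W else 0 := by
          intro κ
          by_cases hκ : κ / m ∈ activeCells K c c' l
          · simp only [p, ← hmdef, hκ, true_and, if_true]
            rw [← Finset.sum_filter, Finset.sum_const, nsmul_eq_mul]
            gcongr
            exact_mod_cast card_filter_near_le n κ m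
          · simp [p, ← hmdef, hκ]
        refine (Finset.sum_le_sum fun κ _ => hin κ).trans ?_
        rw [← Finset.sum_filter, Finset.sum_const, nsmul_eq_mul]
        have h1 : ((((Finset.range n).filter fun κ => κ / m ∈ activeCells K c c' l).card : ℕ) : ℝ) ≤
            (activeCells K c c' l).card * m := by
          exact_mod_cast card_filter_div_le _ n (pow_pos mesh_pos _)
        calc _ ≤ ((activeCells K c c' l).card * m : ℝ) * (4 * (m : ℝ) * W) := by gcongr
          _ = _ := by rw [hmdef]; push_cast; ring

end ActiveCells

section RandomChoices

/-- Extension of a finite family by a default value. -/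
def extendFin {α : Type*} (a : α) {N : ℕ} (w : Fin N → α) (i : ℕ) : α :=
  if h : i < N then w ⟨i, h⟩ else a

theorem extendFin_val {α : Type*} (a : α) {N : ℕ} (w : Fin N → α) (i : Fin N) :
    extendFin a w i = w i := by
  simp [extendFin]

/-- Averaging an adapted functional that decreases on average at each step. -/
theorem sum_extendFin_le {α : Type*} [Fintype α] (a : α) (N : ℕ) (F : ℕ → (ℕ → α) → ℝ)
    (hF : ∀ l c c', (∀ i < l, c i = c' i) → F l c = F l c')
    (hstep : ∀ l < N, ∀ c, ∑ x, F (l + 1) (Function.update c l x) ≤ Fintype.card α * F l c) :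
    ∑ w : Fin N → α, F N (extendFin a w) ≤ Fintype.card α ^ N * F 0 fun _ => a := by
  induction N with
  | zero =>
    simp only [Finset.univ_unique, Finset.sum_singleton, pow_zero, one_mul]
    exact (hF 0 _ _ fun i hi => absurd hi (Nat.not_lt_zero i)).le
  | succ N ih =>
    rw [← (Fin.snocEquiv fun _ => α).sum_comp, Fintype.sum_prod_type_right]
    have h1 : ∀ (w : Fin N → α) (x : α), F (N + 1) (extendFin a (Fin.snocEquiv (fun _ => α) (x, w)))
        = F (N + 1) (Function.update (extendFin a w) N x) := by
      intro w x
      refine hF _ _ _ fun i hi => ?_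
      rcases Nat.lt_succ_iff_lt_or_eq.1 hi with h | rfl
      · rw [Function.update_of_ne h.ne]
        simp [extendFin, hi, h, Fin.snocEquiv, Fin.snoc]
      · simp [extendFin, Fin.snocEquiv, Fin.snoc]
    simp_rw [h1]
    calc _ ≤ ∑ w : Fin N → α, (Fintype.card α : ℝ) * F N (extendFin a w) :=
          Finset.sum_le_sum fun w _ => hstep N (Nat.lt_succ_self N) _
      _ ≤ _ := by
          rw [← Finset.mul_sum, pow_succ']
          rw [mul_assoc]
          exact mul_le_mul_of_nonneg_left (ih fun l hl => hstep l (by omega)) (Nat.cast_nonneg _)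

theorem sum_exp_indicator_le {ι : Type*} [Fintype ι] [DecidableEq ι] [Nonempty ι] {s : Finset ι}
    {b t : ℝ} (hs : (s.card : ℝ) ≤ b) (ht : 0 ≤ t) :
    ∑ y : ι, Real.exp (t * if y ∈ s then 1 else 0) ≤
      Fintype.card ι * Real.exp (b / Fintype.card ι * (Real.exp t - 1)) := by
  have hD : (0 : ℝ) < Fintype.card ι := by exact_mod_cast Fintype.card_pos
  have h1 : ∀ y : ι, Real.exp (t * if y ∈ s then 1 else 0) =
      1 + if y ∈ s then Real.exp t - 1 else 0 := by
    intro y; split_ifs <;> simp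
  simp_rw [h1]
  rw [Finset.sum_add_distrib, ← Finset.sum_filter, Finset.sum_const, Finset.sum_const,
    nsmul_eq_mul, nsmul_eq_mul, Finset.filter_mem_eq_inter, Finset.univ_inter, Finset.card_univ,
    mul_one]
  have h2 : 0 ≤ Real.exp t - 1 := by linarith [Real.one_le_exp ht]
  have h3 := Real.add_one_le_exp (b / Fintype.card ι * (Real.exp t - 1))
  calc _ ≤ (Fintype.card ι : ℝ) + b * (Real.exp t - 1) := by gcongr
    _ = Fintype.card ι * (b / Fintype.card ι * (Real.exp t - 1) + 1) := by field_simp; ring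
    _ ≤ _ := by gcongr

theorem sum_exp_card_filter_le {D K : ℕ} [NeZero D] {S : Finset ℕ} (hS : ∀ k ∈ S, k + 1 < K)
    {B : ℕ → Finset (Fin D)} {b : ℝ} (hB : ∀ k, ((B k).card : ℝ) ≤ b) {θ : ℝ} (hθ : 0 ≤ θ) :
    ∑ x : Fin K → Fin D, Real.exp (θ * (S.filter fun k =>
        extendFin 0 x k ∈ B k ∨ extendFin 0 x (k + 1) ∈ B (k + 1)).card) ≤
      (D : ℝ) ^ K * Real.exp (2 * b / D * (Real.exp (2 * θ) - 1) * S.card) := by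
  classical
  have hb : 0 ≤ b := (Nat.cast_nonneg _).trans (hB 0)
  have hD : (0 : ℝ) < D := by exact_mod_cast Nat.pos_of_neZero D
  let m : ℕ → ℝ := fun κ => (if κ ∈ S then 1 else 0) +
    (if κ ∈ S.image (· + 1) then 1 else 0)
  have hm0 : ∀ κ, 0 ≤ m κ := fun κ => by simp only [m]; split_ifs <;> norm_num
  have hmsum : ∑ κ : Fin K, m κ ≤ 2 * S.card := by
    rw [Fin.sum_univ_eq_sum_range m]
    simp only [m]
    rw [Finset.sum_add_distrib, Finset.sum_ite_mem, Finset.sum_ite_mem,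
      Finset.sum_const, Finset.sum_const, nsmul_eq_mul, nsmul_eq_mul, mul_one, mul_one, two_mul]
    refine add_le_add (Nat.cast_le.2 (Finset.card_le_card Finset.inter_subset_right))
      (Nat.cast_le.2 ?_)
    exact (Finset.card_le_card Finset.inter_subset_right).trans Finset.card_image_le
  have hpt : ∀ x : Fin K → Fin D, θ * (S.filter fun k =>
        extendFin 0 x k ∈ B k ∨ extendFin 0 x (k + 1) ∈ B (k + 1)).card ≤
      ∑ κ : Fin K, θ * m κ * if x κ ∈ B κ then 1 else 0 := by
    intro x
    have e : ∑ κ : Fin K, m κ * (if x κ ∈ B κ then 1 else 0) =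
        ∑ κ ∈ Finset.range K, m κ * (if extendFin 0 x κ ∈ B κ then 1 else 0) := by
      rw [← Fin.sum_univ_eq_sum_range fun κ => m κ * (if extendFin 0 x κ ∈ B κ then (1 : ℝ) else 0)]
      simp [extendFin_val]
    simp_rw [mul_assoc]
    rw [← Finset.mul_sum, e]
    gcongr
    simp only [m, add_mul, ite_mul, one_mul, zero_mul]
    rw [Finset.sum_add_distrib, Finset.sum_ite_mem, Finset.sum_ite_mem,
      Finset.inter_eq_right.2 fun k hk => Finset.mem_range.2 (by have := hS k hk; omega),
      Finset.inter_eq_right.2 fun k hk => by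
        obtain ⟨k', hk', rfl⟩ := Finset.mem_image.1 hk
        exact Finset.mem_range.2 (hS k' hk'),
      Finset.sum_image fun _ _ _ _ h => Nat.succ_injective h, ← Finset.sum_filter,
      ← Finset.sum_filter, Finset.sum_const, Finset.sum_const, nsmul_eq_mul, nsmul_eq_mul, mul_one,
      mul_one, Finset.filter_or]
    exact_mod_cast Finset.card_union_le _ _
  calc _ ≤ ∑ x : Fin K → Fin D, ∏ κ : Fin K,
        Real.exp (θ * m κ * if x κ ∈ B κ then 1 else 0) := by
        refine Finset.sum_le_sum fun x _ => ?_
        rw [← Real.exp_sum]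
        exact Real.exp_le_exp.2 (hpt x)
    _ = ∏ κ : Fin K, ∑ y : Fin D, Real.exp (θ * m κ * if y ∈ B κ then 1 else 0) := by
        rw [Finset.prod_univ_sum]; simp
    _ ≤ ∏ κ : Fin K, (D * Real.exp (b / D * (Real.exp (2 * θ) - 1) * m κ)) := by
        refine Finset.prod_le_prod (fun κ _ => by positivity) fun κ _ => ?_
        have := sum_exp_indicator_le (s := B κ) (hB κ) (mul_nonneg hθ (hm0 κ))
        rw [Fintype.card_fin] at this
        refine this.trans ?_
        rw [mul_assoc (b / (D : ℝ))]
        gcongr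
        have h1 : Real.exp θ ≤ Real.exp (2 * θ) := Real.exp_le_exp.2 (by linarith)
        have h2 : 1 ≤ Real.exp θ := Real.one_le_exp hθ
        simp only [m]
        split_ifs
        · norm_num; rw [mul_comm θ 2]; linarith
        · norm_num; linarith
        · norm_num; linarith
        · simp
    _ = D ^ K * Real.exp (b / D * (Real.exp (2 * θ) - 1) * ∑ κ : Fin K, m κ) := by
        rw [Finset.prod_mul_distrib, Finset.prod_const, ← Real.exp_sum, ← Finset.mul_sum]
        simp
    _ ≤ _ := by
        have h2 : 1 ≤ Real.exp (2 * θ) := Real.one_le_exp (by linarith)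
        have h3 : 0 ≤ b / D * (Real.exp (2 * θ) - 1) :=
          mul_nonneg (by positivity) (by linarith)
        refine mul_le_mul_of_nonneg_left (Real.exp_le_exp.2 ?_) (by positivity)
        calc _ ≤ b / D * (Real.exp (2 * θ) - 1) * (2 * S.card) := by gcongr
          _ = _ := by ring

theorem sum_exp_card_activeCells_le {D K l : ℕ} [NeZero D] (hK : mesh ^ (l + 1) + 2 ≤ K)
    (c : ℕ → Fin K → Fin D) (c' : ℕ → ℕ → Fin D) {θ : ℝ} (hθ : 0 ≤ θ) :
    ∑ x : Fin K → Fin D, Real.exp (θ * (activeCells K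
        (fun i => extendFin 0 (Function.update c l x i)) c' (l + 1)).card) ≤
      (D : ℝ) ^ K * Real.exp (18 * mesh / D * (Real.exp (2 * θ) - 1) *
        (activeCells K (fun i => extendFin 0 (c i)) c' l).card) := by
  set S := (Finset.range (mesh ^ (l + 1))).filter fun k =>
    k / mesh ∈ activeCells K (fun i => extendFin 0 (c i)) c' l with hS
  set B := badLabels K (fun i => extendFin 0 (c i)) c' l with hB
  have h1 : ∀ x : Fin K → Fin D, activeCells K
        (fun i => extendFin 0 (Function.update c l x i)) c' (l + 1) = S.filter fun k =>
        extendFin 0 x k ∈ B k ∨ extendFin 0 x (k + 1) ∈ B (k + 1) := by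
    intro x
    have hupd : ∀ i < l, (fun i => extendFin (0 : Fin D) (Function.update c l x i)) i =
        (fun i => extendFin 0 (c i)) i := fun i hi => by
      simp only
      rw [Function.update_of_ne hi.ne]
    simp only [activeCells]
    rw [activeCells_congr K c' hupd, hS, Finset.filter_filter]
    simp_rw [badLabels_congr K c' hupd, Function.update_self]
    rfl
  simp_rw [h1]
  refine (sum_exp_card_filter_le (b := 9) (fun k hk => ?_) (fun k => ?_) hθ).trans ?_
  · rw [hS, Finset.mem_filter, Finset.mem_range] at hk
    omega
  · exact_mod_cast card_badLabels_le _ _ _ _ _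
  · have h2 : (S.card : ℝ) ≤ (activeCells K (fun i => extendFin 0 (c i)) c' l).card * mesh := by
      exact_mod_cast card_filter_div_le _ _ mesh_pos
    have h3 : 1 ≤ Real.exp (2 * θ) := Real.one_le_exp (by linarith)
    have h4 : 0 ≤ 2 * 9 / D * (Real.exp (2 * θ) - 1) := mul_nonneg (by positivity) (by linarith)
    refine mul_le_mul_of_nonneg_left (Real.exp_le_exp.2 ?_) (by positivity)
    calc _ ≤ 2 * 9 / D * (Real.exp (2 * θ) - 1) *
          ((activeCells K (fun i => extendFin 0 (c i)) c' l).card * mesh) := by gcongr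
      _ = _ := by ring

theorem exists_separationWeight_le : ∃ C > 0, ∀ q : ℕ,
    4 * ((mesh : ℝ) ^ q) ^ 2 * separationWeight q ≤ C * (1 / 2) ^ q := by
  refine ⟨24 * 2 ^ 84, by norm_num, fun q => ?_⟩
  cases q with
  | zero => norm_num [separationWeight]
  | succ q =>
    set x : ℝ := (64 ^ q) ^ 2 / 2048 with hx
    have hx0 : 0 < x := by positivity
    have h1 : x ^ 4 / 24 ≤ Real.exp x := by
      have := Real.pow_div_factorial_le_exp x hx0.le 4
      norm_num [Nat.factorial] at this ⊢
      exact this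
    have h2 : Real.exp (-x) ≤ 24 / x ^ 4 := by
      rw [Real.exp_neg, ← inv_div]
      gcongr
    rw [separationWeight]
    calc _ ≤ 4 * ((mesh : ℝ) ^ (q + 1)) ^ 2 * (24 / x ^ 4) := by gcongr
      _ = 4 * 24 * (2 ^ 44) * 2 ^ 36 * (1 / 4096) ^ q := by
          have hm : (mesh : ℝ) = 2 ^ 18 := by rw [cast_mesh]; norm_num
          rw [hx, hm, show (64 : ℝ) = 2 ^ 6 by norm_num, show (4096 : ℝ) = 2 ^ 12 by norm_num,
            show (2048 : ℝ) = 2 ^ 11 by norm_num]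
          have hp : ∀ k : ℕ, ((2 : ℝ) ^ k) ^ q = (2 ^ q) ^ k := fun k => by
            rw [← pow_mul, ← pow_mul, mul_comm]
          rw [one_div, inv_pow, pow_succ ((2 : ℝ) ^ 18), hp 18, hp 6, hp 12]
          field_simp
      _ ≤ 24 * 2 ^ 84 * ((1 / 2) * (1 / 2) ^ q) := by
          have : (1 / 4096 : ℝ) ^ q ≤ (1 / 2) ^ q := by gcongr; norm_num
          nlinarith [pow_pos (show (0 : ℝ) < 1 / 2 by norm_num) q]
      _ = _ := by ring

theorem sum_half_pow_le (l N₀ N : ℕ) :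
    ∑ j ∈ Finset.Ico N₀ N, (if l < j + 2 then (1 / 2 : ℝ) ^ (j + 1 - l) else 0) ≤
      2 * (1 / 2) ^ (N₀ - l) := by
  have h1 : ∀ M, N₀ ≤ M → ∑ j ∈ Finset.Ico N₀ M,
      (if l < j + 2 then (1 / 2 : ℝ) ^ (j + 1 - l) else 0) ≤
        2 * (1 / 2) ^ (N₀ + 1 - l) - 2 * (1 / 2) ^ (M + 1 - l) := by
    intro M hM
    induction M, hM using Nat.le_induction with
    | base => simp
    | succ M hM ih =>
      rw [Finset.sum_Ico_succ_top hM]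
      split_ifs with h
      · rw [show M + 1 + 1 - l = (M + 1 - l) + 1 by omega, pow_succ]
        linarith
      · rw [show M + 1 + 1 - l = M + 1 - l by omega]
        linarith
  rcases le_total N₀ N with h | h
  · refine (h1 N h).trans ?_
    have h2 : (1 / 2 : ℝ) ^ (N₀ + 1 - l) ≤ (1 / 2) ^ (N₀ - l) :=
      pow_le_pow_of_le_one (by norm_num) (by norm_num) (by omega)
    have : (0 : ℝ) < (1 / 2) ^ (N + 1 - l) := by positivity
    linarith
  · rw [Finset.Ico_eq_empty_of_le h]; simp only [Finset.sum_empty]; positivity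

/-- The choices at all levels and cells, extended by a default value. -/
def extendChoices {N K D : ℕ} [NeZero D] (w : Fin N → Fin K → Fin D) (i : ℕ) : ℕ → Fin D :=
  extendFin 0 (extendFin (fun _ => 0) w i)

/-- Exponential moment of the total weighted number of active cells. -/
theorem exists_sum_exp_card_activeCells_le : ∃ C : ℝ, 0 < C ∧ ∀ (b : ℝ), 0 ≤ b →
    ∀ (D : ℕ) [NeZero D], 144 * mesh * Real.exp (2 * (C * b)) ≤ D →
    ∀ (N₀ N K : ℕ), mesh ^ N + 2 ≤ K → ∀ c' : ℕ → ℕ → Fin D,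
    ∑ w : Fin N → Fin K → Fin D, Real.exp (b * ∑ j ∈ Finset.Ico N₀ N,
      ∑ l ∈ Finset.range (j + 2), ((activeCells K (extendChoices w) c' l).card : ℝ) *
        (4 * (mesh ^ (j + 1 - l)) ^ 2 * separationWeight (j + 1 - l))) ≤
      Fintype.card (Fin N → Fin K → Fin D) * Real.exp (C * b * (1 / 2) ^ N₀) := by
  obtain ⟨C, hC, hψ⟩ := exists_separationWeight_le
  refine ⟨4 * C, by positivity, fun b hb D _ hD N₀ N K hK c' => ?_⟩
  set ψ : ℕ → ℝ := fun q => 4 * ((mesh : ℝ) ^ q) ^ 2 * separationWeight q with hψdef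
  have hψ0 : ∀ q, 0 ≤ ψ q := fun q => mul_nonneg (by positivity) (separationWeight_nonneg q)
  set Θ : ℝ := 4 * C * b with hΘ
  have hΘ0 : 0 ≤ Θ := by positivity
  have hDpos : (0 : ℝ) < D := by exact_mod_cast Nat.pos_of_neZero D
  let A : (ℕ → Fin K → Fin D) → ℕ → ℝ := fun c l =>
    ((activeCells K (fun i => extendFin 0 (c i)) c' l).card : ℝ)
  let w : ℕ → ℝ := fun l => b * ∑ j ∈ Finset.Ico N₀ N, if l < j + 2 then ψ (j + 1 - l) else 0
  let θ : ℕ → ℝ := fun l => Θ * (1 / 2) ^ (N₀ - l)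
  have hθ0 : ∀ l, 0 ≤ θ l := fun l => by positivity
  have hθΘ : ∀ l, θ l ≤ Θ := fun l =>
    mul_le_of_le_one_right hΘ0 (pow_le_one₀ (by norm_num) (by norm_num))
  have hA0 : ∀ c l, 0 ≤ A c l := fun c l => Nat.cast_nonneg _
  have hA : ∀ l c d, (∀ i < l, c i = d i) → A c l = A d l := fun l c d h => by
    simp only [A]
    rw [activeCells_congr K c' fun i hi => by rw [h i hi]]
  have hw : ∀ l, w l ≤ θ l / 2 := by
    intro l
    calc w l ≤ b * ∑ j ∈ Finset.Ico N₀ N,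
          C * (if l < j + 2 then (1 / 2 : ℝ) ^ (j + 1 - l) else 0) := by
          simp only [w]
          gcongr with j hj
          split_ifs
          · exact hψ _
          · simp
      _ ≤ b * (C * (2 * (1 / 2) ^ (N₀ - l))) := by
          rw [← Finset.mul_sum]
          gcongr
          exact sum_half_pow_le l N₀ N
      _ = θ l / 2 := by simp only [θ, hΘ]; ring
  let F : ℕ → (ℕ → Fin K → Fin D) → ℝ := fun l c =>
    Real.exp (∑ i ∈ Finset.range l, w i * A c i + θ l * A c l)
  have hF : ∀ l c d, (∀ i < l, c i = d i) → F l c = F l d := fun l c d h => by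
    simp only [F]
    rw [hA l c d h, Finset.sum_congr rfl fun i hi => by
      rw [hA i c d fun k hk => h k (hk.trans (Finset.mem_range.1 hi))]]
  have hcard : (Fintype.card (Fin K → Fin D) : ℝ) = (D : ℝ) ^ K := by simp
  have hstep : ∀ l < N, ∀ c, ∑ x, F (l + 1) (Function.update c l x) ≤
      Fintype.card (Fin K → Fin D) * F l c := by
    intro l hl c
    have h1 : ∀ x, F (l + 1) (Function.update c l x) =
        Real.exp (∑ i ∈ Finset.range (l + 1), w i * A c i) *
          Real.exp (θ (l + 1) * A (Function.update c l x) (l + 1)) := by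
      intro x
      simp only [F]
      rw [← Real.exp_add, Finset.sum_congr rfl fun i hi => by
        rw [hA i (Function.update c l x) c fun k hk => Function.update_of_ne (by
          have := Finset.mem_range.1 hi
          omega) _ _]]
    have hKl : mesh ^ (l + 1) + 2 ≤ K := by
      have : mesh ^ (l + 1) ≤ mesh ^ N := Nat.pow_le_pow_right mesh_pos hl
      omega
    have h2 := sum_exp_card_activeCells_le hKl c c' (hθ0 (l + 1))
    have h3 : 18 * mesh / D * (Real.exp (2 * θ (l + 1)) - 1) ≤ θ l / 2 := by
      have e1 : Real.exp (2 * θ (l + 1)) - 1 ≤ 2 * θ (l + 1) * Real.exp (2 * Θ) := by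
        have := Real.add_one_le_exp (-(2 * θ (l + 1)))
        have e2 : Real.exp (2 * θ (l + 1)) * Real.exp (-(2 * θ (l + 1))) = 1 := by
          rw [← Real.exp_add]; simp
        have e3 : Real.exp (2 * θ (l + 1)) ≤ Real.exp (2 * Θ) :=
          Real.exp_le_exp.2 (by linarith [hθΘ (l + 1)])
        nlinarith [Real.exp_pos (2 * θ (l + 1)), hθ0 (l + 1)]
      have e4 : θ (l + 1) ≤ 2 * θ l := by
        have : (1 / 2 : ℝ) ^ (N₀ - (l + 1)) ≤ 2 * (1 / 2) ^ (N₀ - l) := by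
          rcases lt_or_ge l N₀ with h | h
          · rw [show N₀ - l = (N₀ - (l + 1)) + 1 by omega, pow_succ]; linarith
          · rw [show N₀ - l = 0 by omega, show N₀ - (l + 1) = 0 by omega]; norm_num
        simp only [θ]
        nlinarith
      have e5 : 18 * mesh / D * (Real.exp (2 * θ (l + 1)) - 1) ≤
          18 * mesh / D * (4 * θ l * Real.exp (2 * Θ)) := by
        gcongr
        exact e1.trans (mul_le_mul_of_nonneg_right (by linarith) (Real.exp_pos _).le)
      refine e5.trans ?_
      rw [div_mul_eq_mul_div, div_le_iff₀ hDpos]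
      nlinarith [hθ0 l, mul_le_mul_of_nonneg_left hD (hθ0 l)]
    rw [Finset.sum_congr rfl fun x _ => h1 x, ← Finset.mul_sum, hcard]
    calc _ ≤ Real.exp (∑ i ∈ Finset.range (l + 1), w i * A c i) *
          (D ^ K * Real.exp (θ l / 2 * A c l)) := by
          gcongr
          refine h2.trans ?_
          gcongr
      _ = D ^ K * Real.exp (∑ i ∈ Finset.range (l + 1), w i * A c i + θ l / 2 * A c l) := by
          rw [Real.exp_add]; ring
      _ ≤ D ^ K * F l c := by
          refine mul_le_mul_of_nonneg_left (Real.exp_le_exp.2 ?_) (by positivity)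
          rw [Finset.sum_range_succ]
          nlinarith [mul_le_mul_of_nonneg_right (hw l) (hA0 c l)]
  have hmain := sum_extendFin_le (fun _ => (0 : Fin D)) N F hF hstep
  have hend : Fintype.card (Fin K → Fin D) ^ N * F 0 (fun _ _ => 0) =
      Fintype.card (Fin N → Fin K → Fin D) * Real.exp (4 * C * b * (1 / 2) ^ N₀) := by
    simp [F, θ, A, activeCells, hΘ]
  rw [← hend]
  refine le_trans (Finset.sum_le_sum fun x _ => ?_) hmain
  simp only [F]
  apply Real.exp_le_exp.2
  have hswap : ∑ j ∈ Finset.Ico N₀ N, ∑ l ∈ Finset.range (j + 2),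
      ((activeCells K (extendChoices x) c' l).card : ℝ) *
        (4 * (mesh ^ (j + 1 - l)) ^ 2 * separationWeight (j + 1 - l)) =
      ∑ l ∈ Finset.range (N + 1), ∑ j ∈ Finset.Ico N₀ N,
        A (extendFin (fun _ => 0) x) l * if l < j + 2 then ψ (j + 1 - l) else 0 := by
    rw [Finset.sum_comm]
    refine Finset.sum_congr rfl fun j hj => ?_
    have hj' := (Finset.mem_Ico.1 hj).2
    have hsub : Finset.range (j + 2) = (Finset.range (N + 1)).filter (· < j + 2) := by
      ext i; simp only [Finset.mem_range, Finset.mem_filter]; omega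
    rw [hsub, Finset.sum_filter]
    refine Finset.sum_congr rfl fun l _ => ?_
    rw [mul_ite, mul_zero]
    rfl
  rw [hswap, Finset.mul_sum, Finset.sum_range_succ]
  have hterm : ∀ l, b * ∑ j ∈ Finset.Ico N₀ N,
      A (extendFin (fun _ => 0) x) l * (if l < j + 2 then ψ (j + 1 - l) else 0) =
      w l * A (extendFin (fun _ => 0) x) l := by
    intro l
    rw [← Finset.mul_sum]
    simp only [w]
    ring
  simp_rw [hterm]
  have := mul_le_mul_of_nonneg_right (hw N) (hA0 (extendFin (fun _ => 0) x) N)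
  have := mul_nonneg (hθ0 N) (hA0 (extendFin (fun _ => 0) x) N)
  linarith

end RandomChoices

section Tent

theorem continuous_tent : Continuous tent := by unfold tent; fun_prop

theorem contDiffOn_tent (q : ℤ) : ContDiffOn ℝ 1 tent (Set.Icc q (q + 1)) := by
  rcases lt_trichotomy q (-1) with h | rfl | h
  · refine (contDiffOn_const (c := 0)).congr fun x hx => tent_eq_zero ?_
    have : (q : ℝ) ≤ -2 := by exact_mod_cast (by omega : q ≤ -2)
    rw [abs_of_nonpos] <;> linarith [hx.1, hx.2]
  · refine (contDiffOn_const.add contDiffOn_id : ContDiffOn ℝ 1 (fun x : ℝ => 1 + x) _).congr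
      fun x hx => ?_
    have h1 := hx.1
    have h2 := hx.2
    push_cast at h1 h2
    rw [tent_eq (abs_le.2 ⟨h1, by linarith⟩), abs_of_nonpos (by linarith)]
    ring
  · rcases (show 0 ≤ q by omega).eq_or_lt with rfl | h0
    · refine (contDiffOn_const.sub contDiffOn_id : ContDiffOn ℝ 1 (fun x : ℝ => 1 - x) _).congr
        fun x hx => ?_
      have h1 := hx.1
      have h2 := hx.2
      push_cast at h1 h2
      rw [tent_eq (abs_le.2 ⟨by linarith, by linarith⟩), abs_of_nonneg h1]
    · refine (contDiffOn_const (c := 0)).congr fun x hx => tent_eq_zero ?_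
      have : (1 : ℝ) ≤ q := by exact_mod_cast h0
      rw [abs_of_nonneg] <;> linarith [hx.1, hx.2]

end Tent

section ZigzagPath

variable {D : ℕ} {E : Type*} [NormedAddCommGroup E] [InnerProductSpace ℝ E]

/-- The directions available to the zigzag path: the random ones and the deterministic ones. -/
abbrev Direction (D : ℕ) : Type := Fin D ⊕ (Fin 2 × Fin (4 * mesh))

/-- The zigzag of level `i`, with random directions `f`. -/
noncomputable def zigzag (K : ℕ) (e : Direction D → E) (f : ℕ → Fin D) (i : ℕ) (u : ℝ) : E :=
  ∑ κ ∈ Finset.range K,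
    tent (mesh ^ (i + 1) * u - κ) • (e (Sum.inl (f κ)) + e (Sum.inr (detLabel i κ)))

/-- The path from `x` to `x + v` with `m` levels of zigzags in the random directions `c`. -/
noncomputable def zigzagPath (K : ℕ) (e : Direction D → E) (x v : E) (s : ℝ) (c : ℕ → ℕ → Fin D)
    (m : ℕ) (u : ℝ) : E :=
  x + u • v + ∑ i ∈ Finset.range m, (s * (1 / 64) ^ i) • zigzag K e (c i) i u

theorem inner_zigzag_inl {e : Direction D → E} (he : Orthonormal ℝ e) (K : ℕ) (f : ℕ → Fin D)
    (i : ℕ) (u : ℝ) (y : Fin D) :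
    inner ℝ (zigzag K e f i u) (e (Sum.inl y)) = labelWeight K f y (mesh ^ (i + 1) * u) := by
  rw [orthonormal_iff_ite] at he
  simp only [zigzag, labelWeight, sum_inner, real_inner_smul_left, inner_add_left, he,
    Sum.inl.injEq, reduceCtorEq, if_false, add_zero, mul_ite, mul_one, mul_zero]

theorem inner_zigzag_inr {e : Direction D → E} (he : Orthonormal ℝ e) (K : ℕ) (f : ℕ → Fin D)
    (i : ℕ) (u : ℝ) (y : Fin 2 × Fin (4 * mesh)) :
    inner ℝ (zigzag K e f i u) (e (Sum.inr y)) =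
      labelWeight K (detLabel i) y (mesh ^ (i + 1) * u) := by
  rw [orthonormal_iff_ite] at he
  simp only [zigzag, labelWeight, sum_inner, real_inner_smul_left, inner_add_left, he,
    Sum.inr.injEq, reduceCtorEq, if_false, zero_add, mul_ite, mul_one, mul_zero]

theorem inner_zigzagPath_sub_inl {e : Direction D → E} (he : Orthonormal ℝ e) (K : ℕ) (x : E)
    {v : E} (hv : ∀ y, inner ℝ v (e y) = 0) (s : ℝ) (c c' : ℕ → ℕ → Fin D) (m : ℕ) (u u' : ℝ)
    (y : Fin D) :
    inner ℝ (zigzagPath K e x v s c m u - zigzagPath K e x v s c' m u') (e (Sum.inl y)) =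
      s * (pathCoord K c m y u - pathCoord K c' m y u') := by
  simp only [zigzagPath, pathCoord, inner_sub_left, inner_add_left, real_inner_smul_left, hv,
    sum_inner, inner_zigzag_inl he, mul_sub, Finset.mul_sum, mul_assoc]
  ring

theorem inner_zigzagPath_sub_inr {e : Direction D → E} (he : Orthonormal ℝ e) (K : ℕ) (x : E)
    {v : E} (hv : ∀ y, inner ℝ v (e y) = 0) (s : ℝ) (c c' : ℕ → ℕ → Fin D) (m : ℕ) (u u' : ℝ)
    (y : Fin 2 × Fin (4 * mesh)) :
    inner ℝ (zigzagPath K e x v s c m u - zigzagPath K e x v s c' m u') (e (Sum.inr y)) =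
      s * (pathCoord K detLabel m y u - pathCoord K detLabel m y u') := by
  simp only [zigzagPath, pathCoord, inner_sub_left, inner_add_left, real_inner_smul_left, hv,
    sum_inner, inner_zigzag_inr he, mul_sub, Finset.mul_sum, mul_assoc]
  ring

theorem norm_add_le_two {e : Direction D → E} (he : Orthonormal ℝ e) (y z : Direction D) :
    ‖e y + e z‖ ≤ 2 := by
  have := norm_add_le (e y) (e z)
  rw [he.1, he.1] at this
  linarith

theorem norm_zigzag_le {e : Direction D → E} (he : Orthonormal ℝ e) (K : ℕ) (f : ℕ → Fin D)
    (i : ℕ) {u : ℝ} (hu : 0 ≤ u) : ‖zigzag K e f i u‖ ≤ 2 := by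
  have h1 := sum_tent_le_one (τ := mesh ^ (i + 1) * u) (by positivity) (Finset.range K)
  calc _ ≤ ∑ κ ∈ Finset.range K, tent (mesh ^ (i + 1) * u - κ) * 2 := by
        refine norm_sum_le_of_le _ fun κ _ => ?_
        rw [norm_smul, Real.norm_of_nonneg (tent_nonneg _)]
        exact mul_le_mul_of_nonneg_left (norm_add_le_two he _ _) (tent_nonneg _)
    _ ≤ 2 := by rw [← Finset.sum_mul]; linarith

theorem norm_zigzag_sub_le {e : Direction D → E} (he : Orthonormal ℝ e) (K : ℕ) (f : ℕ → Fin D)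
    (i : ℕ) {u u' : ℝ} (hu : 0 ≤ u) (hu' : 0 ≤ u') :
    ‖zigzag K e f i u - zigzag K e f i u'‖ ≤ 8 * (mesh ^ (i + 1) * |u - u'|) := by
  have h1 := sum_abs_tent_sub_le (τ := mesh ^ (i + 1) * u) (τ' := mesh ^ (i + 1) * u')
    (by positivity) (by positivity) (Finset.range K)
  rw [← mul_sub, abs_mul, abs_of_nonneg (by positivity : (0 : ℝ) ≤ mesh ^ (i + 1))] at h1
  rw [zigzag, zigzag, ← Finset.sum_sub_distrib]
  calc _ ≤ ∑ κ ∈ Finset.range K,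
        |tent (mesh ^ (i + 1) * u - κ) - tent (mesh ^ (i + 1) * u' - κ)| * 2 := by
        refine norm_sum_le_of_le _ fun κ _ => ?_
        rw [← sub_smul, norm_smul, Real.norm_eq_abs]
        exact mul_le_mul_of_nonneg_left (norm_add_le_two he _ _) (abs_nonneg _)
    _ ≤ _ := by rw [← Finset.sum_mul]; linarith

theorem sum_pow_mesh_le (m : ℕ) :
    ∑ i ∈ Finset.range m, (1 / 64 : ℝ) ^ i * mesh ^ (i + 1) ≤
      64 * (4096 / 4095) * (mesh ^ m * (1 / 64) ^ m) := by
  have h1 : ∀ i : ℕ, (1 / 64 : ℝ) ^ i * mesh ^ (i + 1) = 262144 * 4096 ^ i := fun i => by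
    rw [cast_mesh, pow_succ, ← mul_assoc, ← mul_pow]; norm_num; ring
  have h2 : (mesh : ℝ) ^ m * (1 / 64) ^ m = 4096 ^ m := by
    rw [cast_mesh, ← mul_pow]; norm_num
  simp_rw [h1]
  rw [← Finset.mul_sum, h2]
  linarith [sum_range_pow_le m]

theorem sum_Ico_pow_le (m n : ℕ) :
    ∑ i ∈ Finset.Ico m n, (1 / 64 : ℝ) ^ i ≤ 64 / 63 * (1 / 64) ^ m := by
  rcases le_total m n with h | h
  · have : (0 : ℝ) < (1 / 64) ^ n := by positivity
    rw [geom_sum_Ico (by norm_num) h, div_le_iff_of_neg (by norm_num)]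
    linarith
  · rw [Finset.Ico_eq_empty_of_le h]; simp only [Finset.sum_empty]; positivity

theorem norm_zigzagPath_sub_le {e : Direction D → E} (he : Orthonormal ℝ e) (K : ℕ) (x v : E)
    {s : ℝ} (hs : 0 ≤ s) (c : ℕ → ℕ → Fin D) {m n : ℕ} (hmn : m ≤ n) {u u' : ℝ} (hu : 0 ≤ u)
    (hu' : 0 ≤ u') :
    ‖zigzagPath K e x v s c n u - zigzagPath K e x v s c m u'‖ ≤
      ‖v‖ * |u - u'| + s * (1 / 64) ^ m * (513 * (mesh ^ m * |u - u'|)) +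
        (if m < n then s * (1 / 64) ^ m * (128 / 63) else 0) := by
  have hsplit : zigzagPath K e x v s c n u - zigzagPath K e x v s c m u' =
      (u - u') • v + ∑ i ∈ Finset.range m, (s * (1 / 64) ^ i) •
        (zigzag K e (c i) i u - zigzag K e (c i) i u') +
      ∑ i ∈ Finset.Ico m n, (s * (1 / 64) ^ i) • zigzag K e (c i) i u := by
    simp only [zigzagPath, smul_sub, Finset.sum_sub_distrib, sub_smul,
      ← Finset.sum_range_add_sum_Ico _ hmn]
    abel
  rw [hsplit]
  refine (norm_add_le _ _).trans (add_le_add ((norm_add_le _ _).trans (add_le_add ?_ ?_)) ?_)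
  · rw [norm_smul, Real.norm_eq_abs, mul_comm]
  · calc _ ≤ ∑ i ∈ Finset.range m, s * (1 / 64) ^ i * (8 * (mesh ^ (i + 1) * |u - u'|)) := by
          refine norm_sum_le_of_le _ fun i _ => ?_
          rw [norm_smul, Real.norm_of_nonneg (by positivity)]
          exact mul_le_mul_of_nonneg_left (norm_zigzag_sub_le he _ _ _ hu hu') (by positivity)
      _ = 8 * s * |u - u'| * ∑ i ∈ Finset.range m, (1 / 64 : ℝ) ^ i * mesh ^ (i + 1) := by
          rw [Finset.mul_sum]
          exact Finset.sum_congr rfl fun i _ => by ring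
      _ ≤ 8 * s * |u - u'| * (64 * (4096 / 4095) * (mesh ^ m * (1 / 64) ^ m)) := by
          gcongr
          exact sum_pow_mesh_le m
      _ ≤ _ := by
          have : 0 ≤ s * (1 / 64) ^ m * (mesh ^ m * |u - u'|) := by positivity
          nlinarith
  · split_ifs with h
    · calc _ ≤ ∑ i ∈ Finset.Ico m n, s * (1 / 64) ^ i * 2 := by
            refine norm_sum_le_of_le _ fun i _ => ?_
            rw [norm_smul, Real.norm_of_nonneg (by positivity)]
            exact mul_le_mul_of_nonneg_left (norm_zigzag_le he _ _ _ hu) (by positivity)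
        _ = 2 * s * ∑ i ∈ Finset.Ico m n, (1 / 64 : ℝ) ^ i := by
            rw [Finset.mul_sum]
            exact Finset.sum_congr rfl fun i _ => by ring
        _ ≤ 2 * s * (64 / 63 * (1 / 64) ^ m) := by
            gcongr
            exact sum_Ico_pow_le m n
        _ = _ := by ring
    · rw [Finset.Ico_eq_empty_of_le (not_lt.1 h)]; simp

theorem dist_zigzagPath_zero_le {e : Direction D → E} (he : Orthonormal ℝ e) (K : ℕ) (x v : E)
    {s : ℝ} (hs : 0 ≤ s) (c : ℕ → ℕ → Fin D) (n : ℕ) {u : ℝ} (hu : 0 ≤ u) :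
    ‖zigzagPath K e x v s c n u - (x + u • v)‖ ≤ 3 * s := by
  have h1 := norm_zigzagPath_sub_le he K x v hs c (Nat.zero_le n) hu hu
  have h2 : zigzagPath K e x v s c 0 u = x + u • v := by simp [zigzagPath]
  rw [h2] at h1
  refine h1.trans ?_
  simp only [sub_self, abs_zero, mul_zero, add_zero, zero_add, pow_zero, mul_one]
  split_ifs <;> linarith

theorem continuous_zigzagPath (K : ℕ) (e : Direction D → E) (x v : E) (s : ℝ)
    (c : ℕ → ℕ → Fin D) (n : ℕ) : Continuous (zigzagPath K e x v s c n) := by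
  have := continuous_tent
  unfold zigzagPath zigzag
  fun_prop

theorem contDiffOn_zigzagPath (K : ℕ) (e : Direction D → E) (x v : E) (s : ℝ)
    (c : ℕ → ℕ → Fin D) (n k : ℕ) :
    ContDiffOn ℝ 1 (zigzagPath K e x v s c n)
      (Set.Icc ((k : ℝ) / mesh ^ n) ((k + 1 : ℕ) / mesh ^ n)) := by
  unfold zigzagPath zigzag
  refine (contDiffOn_const.add (contDiffOn_id.smul contDiffOn_const)).add
    (ContDiffOn.sum fun i hi => contDiffOn_const.smul (ContDiffOn.sum fun κ _ => ?_))
  refine ContDiffOn.smul ?_ contDiffOn_const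
  have hi' : i + 1 ≤ n := Finset.mem_range.1 hi
  set q := k / mesh ^ (n - (i + 1)) with hq
  refine (contDiffOn_tent ((q : ℤ) - κ)).comp (by fun_prop) fun u hu => ?_
  have hsplit : mesh ^ n = mesh ^ (i + 1) * mesh ^ (n - (i + 1)) := by
    rw [← pow_add]; congr 1; omega
  have hsplit' : (mesh : ℝ) ^ n = mesh ^ (i + 1) * mesh ^ (n - (i + 1)) := by
    exact_mod_cast hsplit
  have hp : (0 : ℝ) < mesh ^ n := pow_pos cast_mesh_pos _
  have hr : (0 : ℝ) < mesh ^ (n - (i + 1)) := pow_pos cast_mesh_pos _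
  have h1 := (div_le_iff₀ hp).1 hu.1
  have h2 := (le_div_iff₀ hp).1 hu.2
  have h3 : q * mesh ^ (n - (i + 1)) ≤ k := Nat.div_mul_le_self _ _
  have h4 : k + 1 ≤ (q + 1) * mesh ^ (n - (i + 1)) := by
    have := Nat.lt_div_mul_add (a := k) (pow_pos mesh_pos (n - (i + 1)))
    rw [← hq] at this
    rw [add_mul]; omega
  have h3' : (q : ℝ) * mesh ^ (n - (i + 1)) ≤ k := by exact_mod_cast h3
  have h4' : ((k + 1 : ℕ) : ℝ) ≤ (q + 1) * mesh ^ (n - (i + 1)) := by exact_mod_cast h4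
  rw [hsplit'] at h1 h2
  have h5 : (q : ℝ) ≤ mesh ^ (i + 1) * u := by
    refine le_of_mul_le_mul_right (h3'.trans (h1.trans_eq ?_)) hr
    ring
  have h6 : mesh ^ (i + 1) * u ≤ (q : ℝ) + 1 := by
    refine le_of_mul_le_mul_right ((le_of_eq ?_).trans (h2.trans h4')) hr
    ring
  push_cast
  constructor <;> linarith

/-- The grid point of mesh `mesh ^ (j + 1)` to the left of a point `u` of `[0, 1)`, compared to
the full path. -/
theorem norm_zigzagPath_sub_floor_le {e : Direction D → E} (he : Orthonormal ℝ e) (K : ℕ) (x v : E)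
    {s : ℝ} (hs : 0 ≤ s) (c : ℕ → ℕ → Fin D) {j n : ℕ} (hjn : j < n) {u : ℝ} (hu : 0 ≤ u)
    (hv : ‖v‖ ≤ s * 4096 ^ j) :
    ‖zigzagPath K e x v s c n u -
      zigzagPath K e x v s c (j + 1) (⌊(mesh : ℝ) ^ (j + 1) * u⌋₊ / mesh ^ (j + 1))‖ ≤
      18 * (s * (1 / 64) ^ j) := by
  have hp : (0 : ℝ) < mesh ^ (j + 1) := pow_pos cast_mesh_pos _
  set u' : ℝ := ⌊(mesh : ℝ) ^ (j + 1) * u⌋₊ / mesh ^ (j + 1) with hu'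
  have h1 := norm_zigzagPath_sub_le he K x v hs c (show j + 1 ≤ n by omega) hu
    (show 0 ≤ u' by positivity)
  have h2 : mesh ^ (j + 1) * |u - u'| ≤ 1 := by
    have e0 : (mesh : ℝ) ^ (j + 1) * |u - u'| = |mesh ^ (j + 1) * (u - u')| := by
      rw [abs_mul, abs_of_pos hp]
    rw [e0, mul_sub, hu', mul_div_cancel₀ _ hp.ne', abs_le]
    have e1 := Nat.floor_le (show 0 ≤ (mesh : ℝ) ^ (j + 1) * u by positivity)
    have e2 := Nat.lt_floor_add_one ((mesh : ℝ) ^ (j + 1) * u)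
    constructor <;> linarith
  have h3 : ‖v‖ * |u - u'| ≤ s * (1 / 64) ^ j := by
    calc _ ≤ s * 4096 ^ j * |u - u'| := by gcongr
      _ ≤ s * 4096 ^ j * (1 / mesh ^ (j + 1)) := by
          gcongr
          rw [le_div_iff₀ hp]; linarith
      _ ≤ s * 4096 ^ j * (1 / mesh ^ j) := by
          gcongr
          · exact pow_pos cast_mesh_pos _
          · rw [cast_mesh]; norm_num
          · omega
      _ = s * (1 / 64) ^ j := by
          rw [cast_mesh, mul_assoc, one_div, ← inv_pow, ← mul_pow]; norm_num
  have h4 : s * (1 / 64) ^ (j + 1) * (513 * (mesh ^ (j + 1) * |u - u'|)) ≤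
      s * (1 / 64) ^ (j + 1) * 513 := by
    gcongr; linarith
  have h5 : (if j + 1 < n then s * (1 / 64) ^ (j + 1) * (128 / 63) else 0) ≤
      s * (1 / 64) ^ (j + 1) * (128 / 63) := by
    split_ifs
    · rfl
    · positivity
  have h6 : 0 ≤ s * (1 / 64) ^ j := by positivity
  rw [pow_succ (1 / 64 : ℝ)] at h1 h4 h5
  linarith

theorem norm_zigzagPath_sub_self_le {e : Direction D → E} (he : Orthonormal ℝ e) (K : ℕ) (x v : E)
    {s : ℝ} (hs : 0 ≤ s) (hs1 : s ≤ 1) (c : ℕ → ℕ → Fin D) (n : ℕ) {u u' : ℝ} (hu : 0 ≤ u)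
    (hu' : 0 ≤ u') :
    ‖zigzagPath K e x v s c n u - zigzagPath K e x v s c n u'‖ ≤
      (‖v‖ + 513 * mesh ^ n) * |u - u'| := by
  have h1 := norm_zigzagPath_sub_le he K x v hs c le_rfl hu hu' (n := n)
  rw [if_neg (lt_irrefl n)] at h1
  have h2 : s * (1 / 64 : ℝ) ^ n ≤ 1 :=
    mul_le_one₀ hs1 (by positivity) (pow_le_one₀ (by norm_num) (by norm_num))
  have h3 : s * (1 / 64) ^ n * (513 * (mesh ^ n * |u - u'|)) ≤ 1 * (513 * (mesh ^ n * |u - u'|)) := by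
    gcongr
  linarith

end ZigzagPath

/-- The zigzag paths are admissible. -/
theorem piecewiseC1Path_zigzagPath {D d : ℕ} (K : ℕ) (e : Direction D → EuclideanSpace ℝ (Fin d))
    (x v : EuclideanSpace ℝ (Fin d)) (s : ℝ) (c : ℕ → ℕ → Fin D) (n : ℕ) :
    PiecewiseC1Path d (zigzagPath K e x v s c n) := by
  have hp : (0 : ℝ) < mesh ^ n := pow_pos cast_mesh_pos _
  refine ⟨(continuous_zigzagPath K e x v s c n).continuousOn, mesh ^ n,
    fun k => (k : ℝ) / mesh ^ n, by simp, ?_, fun k _ => ?_, fun k _ =>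
      contDiffOn_zigzagPath K e x v s c n k⟩
  · push_cast
    exact div_self hp.ne'
  · push_cast
    gcongr
    linarith

section FieldCovariance

variable {d : ℕ}

/-- The covariance kernel of the field, indexed by levels starting at `0`. -/
noncomputable def fieldKernel (d : ℕ) (s t : ℕ × EuclideanSpace ℝ (Fin d)) : ℝ :=
  wnKernel d (s.1 + 1) (t.1 + 1) s.2 t.2

/-- The field, indexed by levels starting at `0`. -/
def fieldProcess {Ω : Type} (h : ℕ → EuclideanSpace ℝ (Fin d) → Ω → ℝ)
    (t : ℕ × EuclideanSpace ℝ (Fin d)) : Ω → ℝ := h (t.1 + 1) t.2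

theorem IsWhiteNoiseField.isGaussianFamily {Ω : Type} [MeasurableSpace Ω] {P : Measure Ω}
    {h : ℕ → EuclideanSpace ℝ (Fin d) → Ω → ℝ} (hh : IsWhiteNoiseField d P h) :
    IsGaussianFamily P (fieldProcess h) (fieldKernel d) where
  measurable _ := hh.1 _ _
  symm _ _ := wnKernel_comm _ _ _ _
  exists_pos := ⟨(0, 0), wnKernel_one_pos 0⟩
  map_eq N idx c := hh.2.1 N (fun i => ((idx i).1 + 1, (idx i).2)) c fun _ => Nat.le_add_left 1 _

/-- The increment of the field between two consecutive levels at a point. -/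
noncomputable def levelIncrement (p : ℕ) (y : EuclideanSpace ℝ (Fin d)) :
    (ℕ × EuclideanSpace ℝ (Fin d)) →₀ ℝ :=
  Finsupp.single (p + 1, y) 1 - Finsupp.single (p, y) 1

theorem kernelForm_single_levelIncrement_of_lt {n p : ℕ} (h : p < n)
    (x y : EuclideanSpace ℝ (Fin d)) :
    kernelForm (fieldKernel d) (Finsupp.single (n, x) 1) (levelIncrement p y) =
      dyadicKernel d (p + 1) x y := by
  rw [levelIncrement, map_sub, kernelForm_single, kernelForm_single, fieldKernel, fieldKernel]
  simp only [mul_one, one_mul]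
  rw [wnKernel_eq_of_min_eq (show min (n + 1) (p + 1 + 1) = p + 1 + 1 by omega),
    wnKernel_eq_of_min_eq (show min (n + 1) (p + 1) = p + 1 by omega), wnKernel_succ (p + 1)]
  ring

theorem kernelForm_single_levelIncrement_of_le {n p : ℕ} (h : n ≤ p)
    (x y : EuclideanSpace ℝ (Fin d)) :
    kernelForm (fieldKernel d) (Finsupp.single (n, x) 1) (levelIncrement p y) = 0 := by
  rw [levelIncrement, map_sub, kernelForm_single, kernelForm_single, fieldKernel, fieldKernel]
  simp only [mul_one, one_mul]
  rw [wnKernel_eq_of_min_eq (show min (n + 1) (p + 1 + 1) = n + 1 by omega),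
    wnKernel_eq_of_min_eq (show min (n + 1) (p + 1) = n + 1 by omega), sub_self]

theorem fieldKernel_comm (s t : ℕ × EuclideanSpace ℝ (Fin d)) :
    fieldKernel d s t = fieldKernel d t s := wnKernel_comm _ _ _ _

theorem kernelForm_levelIncrement_of_lt {p p' : ℕ} (h : p < p') (x y : EuclideanSpace ℝ (Fin d)) :
    kernelForm (fieldKernel d) (levelIncrement p x) (levelIncrement p' y) = 0 := by
  rw [levelIncrement, map_sub, LinearMap.sub_apply, kernelForm_single_levelIncrement_of_le h,
    kernelForm_single_levelIncrement_of_le h.le, sub_self]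

theorem kernelForm_levelIncrement (p p' : ℕ) (x y : EuclideanSpace ℝ (Fin d)) :
    kernelForm (fieldKernel d) (levelIncrement p x) (levelIncrement p' y) =
      if p = p' then dyadicKernel d (p + 1) x y else 0 := by
  rcases lt_trichotomy p p' with h | rfl | h
  · rw [if_neg h.ne, kernelForm_levelIncrement_of_lt h]
  · rw [if_pos rfl, levelIncrement, map_sub, LinearMap.sub_apply,
      kernelForm_single_levelIncrement_of_lt (Nat.lt_succ_self p),
      kernelForm_single_levelIncrement_of_le le_rfl, sub_zero]
  · rw [if_neg h.ne', kernelForm_comm fieldKernel_comm, kernelForm_levelIncrement_of_lt h]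

/-- The vector along which the field is tilted downwards near the points `Y j κ`. -/
noncomputable def tiltVector (a : ℝ) (q N₀ N : ℕ) (Y : ℕ → ℕ → EuclideanSpace ℝ (Fin d)) :
    (ℕ × EuclideanSpace ℝ (Fin d)) →₀ ℝ :=
  a • ∑ j ∈ Finset.Ico N₀ N, ∑ κ ∈ Finset.range (mesh ^ (j + 1)),
    levelIncrement (6 * j + q) (Y j κ)

theorem kernelForm_tiltVector (a : ℝ) (q N₀ N : ℕ) (Y Y' : ℕ → ℕ → EuclideanSpace ℝ (Fin d)) :
    kernelForm (fieldKernel d) (tiltVector a q N₀ N Y) (tiltVector a q N₀ N Y') =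
      a ^ 2 * ∑ j ∈ Finset.Ico N₀ N, ∑ κ ∈ Finset.range (mesh ^ (j + 1)),
        ∑ κ' ∈ Finset.range (mesh ^ (j + 1)),
          dyadicKernel d (6 * j + q + 1) (Y j κ) (Y' j κ') := by
  simp only [tiltVector, map_smul, LinearMap.smul_apply, smul_eq_mul]
  rw [← mul_assoc, ← sq]
  congr 1
  simp only [map_sum, LinearMap.sum_apply, kernelForm_levelIncrement]
  refine Finset.sum_congr rfl fun j hj => ?_
  rw [Finset.sum_comm, Finset.sum_eq_single_of_mem j hj fun y _ hy => ?_, Finset.sum_comm]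
  · simp
  · simp [hy]

theorem kernelForm_single_tiltVector (a : ℝ) {q N₀ N n : ℕ} (hn : 6 * N + q ≤ n)
    (x : EuclideanSpace ℝ (Fin d)) (Y : ℕ → ℕ → EuclideanSpace ℝ (Fin d)) :
    kernelForm (fieldKernel d) (Finsupp.single (n, x) 1) (tiltVector a q N₀ N Y) =
      a * ∑ j ∈ Finset.Ico N₀ N, ∑ κ ∈ Finset.range (mesh ^ (j + 1)),
        dyadicKernel d (6 * j + q + 1) x (Y j κ) := by
  simp only [tiltVector, map_smul, map_sum, smul_eq_mul]
  congr 1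
  refine Finset.sum_congr rfl fun j hj => Finset.sum_congr rfl fun κ _ => ?_
  have := (Finset.mem_Ico.1 hj).2
  rw [kernelForm_single_levelIncrement_of_lt (by omega)]

theorem le_kernelForm_single_tiltVector (hd : 2592 ≤ d) {a : ℝ} (ha : 0 ≤ a) {q N₀ N n : ℕ}
    (hn : 6 * N + q ≤ n) {x : EuclideanSpace ℝ (Fin d)} {Y : ℕ → ℕ → EuclideanSpace ℝ (Fin d)}
    (hx : ∀ j, N₀ ≤ j → j < N → ∃ κ < mesh ^ (j + 1),
      d * dist x (Y j κ) ^ 2 ≤ 324 * ((1 / 2) ^ (6 * j + q + 1)) ^ 2) :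
    a * (Real.exp (-1296) / 4 * (N - N₀ : ℕ)) ≤
      kernelForm (fieldKernel d) (Finsupp.single (n, x) 1) (tiltVector a q N₀ N Y) := by
  rw [kernelForm_single_tiltVector a hn]
  gcongr
  rw [← Nat.card_Ico, mul_comm, ← nsmul_eq_mul]
  refine Finset.card_nsmul_le_sum _ _ _ fun j hj => ?_
  obtain ⟨κ, hκ, hdist⟩ := hx j (Finset.mem_Ico.1 hj).1 (Finset.mem_Ico.1 hj).2
  refine (exp_le_dyadicKernel hd _ _ _ hdist).trans ?_
  exact Finset.single_le_sum (f := fun κ => dyadicKernel d (6 * j + q + 1) x (Y j κ))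
    (fun κ _ => dyadicKernel_nonneg _ _ _) (Finset.mem_range.2 hκ)

theorem abs_dyadicKernel_sub_le (k : ℕ) (x y w : EuclideanSpace ℝ (Fin d)) :
    |dyadicKernel d k x w - dyadicKernel d k y w| ≤ 2 * (d * dist x y * 4 ^ (k + 1)) := by
  have h1 := wnKernel_succ k x w
  have h2 := wnKernel_succ k y w
  have h3 := abs_wnKernel_diag_sub_le k x y w
  have h4 := abs_wnKernel_diag_sub_le (k + 1) x y w
  have h5 : (d : ℝ) * dist x y * 4 ^ k ≤ d * dist x y * 4 ^ (k + 1) := by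
    gcongr
    · norm_num
    · omega
  rw [abs_le] at *
  constructor <;> linarith

theorem abs_kernelForm_sub_tiltVector_le {a : ℝ} (ha : 0 ≤ a) {q N₀ N n : ℕ}
    (hn : 6 * N + q ≤ n) (x y : EuclideanSpace ℝ (Fin d))
    (Y : ℕ → ℕ → EuclideanSpace ℝ (Fin d)) :
    |kernelForm (fieldKernel d) (Finsupp.single (n, x) 1 - Finsupp.single (n, y) 1)
      (tiltVector a q N₀ N Y)| ≤
      a * (N * (mesh ^ N * (2 * (d * dist x y * 4 ^ (n + 1))))) := by
  rw [map_sub, LinearMap.sub_apply, kernelForm_single_tiltVector a hn,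
    kernelForm_single_tiltVector a hn, ← mul_sub, abs_mul, abs_of_nonneg ha]
  gcongr
  rw [← Finset.sum_sub_distrib]
  simp_rw [← Finset.sum_sub_distrib]
  set b : ℝ := 2 * (d * dist x y * 4 ^ (n + 1)) with hb
  have hb0 : 0 ≤ b := by positivity
  calc _ ≤ ∑ j ∈ Finset.Ico N₀ N, (mesh : ℝ) ^ N * b := by
        refine (Finset.abs_sum_le_sum_abs _ _).trans (Finset.sum_le_sum fun j hj => ?_)
        have hj' := (Finset.mem_Ico.1 hj).2
        calc _ ≤ ∑ κ ∈ Finset.range (mesh ^ (j + 1)), b := by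
              refine (Finset.abs_sum_le_sum_abs _ _).trans (Finset.sum_le_sum fun κ _ => ?_)
              refine (abs_dyadicKernel_sub_le _ _ _ _).trans ?_
              rw [hb]
              gcongr
              · norm_num
              · omega
          _ = (mesh : ℝ) ^ (j + 1) * b := by simp
          _ ≤ (mesh : ℝ) ^ N * b := by
              gcongr
              · rw [cast_mesh]; norm_num
              · omega
    _ = (N - N₀ : ℕ) * ((mesh : ℝ) ^ N * b) := by simp
    _ ≤ _ := by
        gcongr
        omega

theorem kernelForm_sub_self_le (n : ℕ) (x y : EuclideanSpace ℝ (Fin d)) :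
    kernelForm (fieldKernel d) (Finsupp.single (n, x) 1 - Finsupp.single (n, y) 1)
      (Finsupp.single (n, x) 1 - Finsupp.single (n, y) 1) ≤ 2 * (d * dist x y * 4 ^ (n + 1)) := by
  simp only [map_sub, LinearMap.sub_apply, kernelForm_single, fieldKernel, mul_one, one_mul]
  have h1 := abs_wnKernel_diag_sub_le (n + 1) x y x
  have h2 := abs_wnKernel_diag_sub_le (n + 1) x y y
  rw [abs_le] at h1 h2
  linarith

theorem kernelForm_single_self_le (n : ℕ) (x : EuclideanSpace ℝ (Fin d)) :
    kernelForm (fieldKernel d) (Finsupp.single (n, x) 1) (Finsupp.single (n, x) 1) ≤ n + 1 := by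
  rw [kernelForm_single, fieldKernel, mul_one, one_mul]
  exact_mod_cast wnKernel_diag_le (n + 1) x x

end FieldCovariance

theorem exists_orthonormal_direction_orthogonal {d D : ℕ} (hD : D + 8 * mesh + 1 ≤ d)
    (v : EuclideanSpace ℝ (Fin d)) :
    ∃ e : Direction D → EuclideanSpace ℝ (Fin d), Orthonormal ℝ e ∧ ∀ y, inner ℝ v (e y) = 0 := by
  have hrank : D + 8 * mesh ≤ Module.finrank ℝ (ℝ ∙ v)ᗮ := by
    have h1 := Submodule.finrank_add_finrank_orthogonal (ℝ ∙ v)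
    have h2 := (finrank_span_le_card (R := ℝ) ({v} : Set (EuclideanSpace ℝ (Fin d)))).trans_eq
      (by simp : _ = 1)
    rw [finrank_euclideanSpace_fin] at h1
    omega
  have hcard : Fintype.card (Direction D) ≤
      Fintype.card (Fin (Module.finrank ℝ (ℝ ∙ v)ᗮ)) := by
    simp only [Direction, Fintype.card_sum, Fintype.card_prod, Fintype.card_fin]
    omega
  obtain ⟨g⟩ := Function.Embedding.nonempty_of_card_le hcard
  refine ⟨fun y => (stdOrthonormalBasis ℝ (ℝ ∙ v)ᗮ (g y) : EuclideanSpace ℝ (Fin d)), ?_, fun y => ?_⟩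
  · exact ((stdOrthonormalBasis ℝ (ℝ ∙ v)ᗮ).orthonormal.comp_linearIsometry
      (ℝ ∙ v)ᗮ.subtypeₗᵢ).comp g g.injective
  · exact Submodule.mem_orthogonal_singleton_iff_inner_right.1
      (stdOrthonormalBasis ℝ (ℝ ∙ v)ᗮ (g y)).2

theorem lintegral_biUnion_finset_le {α ι : Type*} [MeasurableSpace α] {μ : Measure α}
    (s : Finset ι) (t : ι → Set α) (f : α → ENNReal) :
    ∫⁻ a in ⋃ i ∈ s, t i, f a ∂μ ≤ ∑ i ∈ s, ∫⁻ a in t i, f a ∂μ := by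
  classical
  induction s using Finset.induction_on with
  | empty => simp
  | insert i s hi ih =>
    rw [Finset.set_biUnion_insert, Finset.sum_insert hi]
    exact (lintegral_union_le _ _ _).trans (by gcongr)

/-- The event that along the path `Z : ℝ → T` the process is above `-α` at some point of the grid of
mesh `1 / M`, or its exponential fluctuates too much within some cell of that grid. -/
def pathBadSet {T Ω : Type*} (X : T → Ω → ℝ) (Z : ℝ → T) (ξ α δ : ℝ) (M : ℕ) : Set Ω :=
  ⋃ k ∈ Finset.range M, ({ω | -α ≤ X (Z (k / M)) ω} ∪
    {ω | ENNReal.ofReal (Real.exp δ / M) ≤ ∫⁻ u in Set.Icc ((k : ℝ) / M) ((k + 1) / M),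
      ENNReal.ofReal (Real.exp (ξ * (X (Z u) ω - X (Z (k / M)) ω)))})

section PathEstimate

variable {T Ω : Type*} [MeasurableSpace Ω] {P : Measure Ω} {X : T → Ω → ℝ} {K : T → T → ℝ}

namespace IsGaussianFamily

theorem setLIntegral_tiltDensity_le (h : IsGaussianFamily P X K) (g : T →₀ ℝ) (s : T)
    {α V β : ℝ} (hV : K s s ≤ V) (hβ : β ≤ kernelForm K (Finsupp.single s 1) g) :
    ∫⁻ ω in {ω | -α ≤ X s ω}, tiltDensity X K g ω ∂P ≤
      ENNReal.ofReal (Real.exp (α + V / 2 - β)) := by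
  have hm : MeasurableSet {ω | -α ≤ X s ω} := measurableSet_le measurable_const (h.measurable s)
  rw [← lintegral_indicator hm]
  calc _ ≤ ∫⁻ ω, ENNReal.ofReal (Real.exp α) * (tiltDensity X K g ω *
          ENNReal.ofReal (Real.exp (processEval X (Finsupp.single s 1) ω))) ∂P := by
        refine lintegral_mono fun ω => ?_
        by_cases hω : ω ∈ {ω | -α ≤ X s ω}
        · rw [Set.indicator_of_mem hω, mul_left_comm, ← ENNReal.ofReal_mul (by positivity),
            ← Real.exp_add]
          refine le_mul_of_one_le_right' ?_
          rw [ENNReal.one_le_ofReal, Real.one_le_exp_iff, processEval_single]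
          have : -α ≤ X s ω := hω
          linarith
        · rw [Set.indicator_of_notMem hω]
          exact zero_le
    _ ≤ _ := by
        rw [lintegral_const_mul' _ _ ENNReal.ofReal_ne_top, h.lintegral_tiltDensity_mul_exp,
          ← ENNReal.ofReal_mul (by positivity), ← Real.exp_add, kernelForm_single,
          kernelForm_comm h.symm g]
        refine ENNReal.ofReal_le_ofReal (Real.exp_le_exp.2 ?_)
        linarith

theorem measurable_cell_lintegral (h : IsGaussianFamily P X K) {Z : ℝ → T}
    (hZ : ∀ ω, Continuous fun u => X (Z u) ω) (ξ : ℝ) (s : T) :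
    Measurable fun p : ℝ × Ω => ENNReal.ofReal (Real.exp (ξ * (X (Z p.1) p.2 - X s p.2))) := by
  have h1 : Measurable fun p : ℝ × Ω => X (Z p.1) p.2 :=
    measurable_uncurry_of_continuous_of_measurable (u := fun u ω => X (Z u) ω) hZ
      fun u => h.measurable _
  have h2 : Measurable fun p : ℝ × Ω => X s p.2 := (h.measurable s).comp measurable_snd
  exact ENNReal.measurable_ofReal.comp (Real.measurable_exp.comp ((h1.sub h2).const_mul ξ))

theorem setLIntegral_tiltDensity_cell_le [SFinite P] (h : IsGaussianFamily P X K) (g : T →₀ ℝ)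
    {Z : ℝ → T} (hZ : ∀ ω, Continuous fun u => X (Z u) ω) {ξ : ℝ} (hξ : 0 ≤ ξ) (s : T)
    {I : Set ℝ}
    (hvar : ∀ u ∈ I, kernelForm K (Finsupp.single (Z u) 1 - Finsupp.single s 1)
      (Finsupp.single (Z u) 1 - Finsupp.single s 1) ≤ 1)
    (hdrift : ∀ u ∈ I, |kernelForm K (Finsupp.single (Z u) 1 - Finsupp.single s 1) g| ≤ 1)
    {c : ℝ} (hc : 0 < c) :
    ∫⁻ ω in {ω | ENNReal.ofReal c ≤
      ∫⁻ u in I, ENNReal.ofReal (Real.exp (ξ * (X (Z u) ω - X s ω)))}, tiltDensity X K g ω ∂P ≤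
      ENNReal.ofReal (Real.exp (ξ ^ 2 / 2 + ξ) / c) * volume I := by
  have hjoint := h.measurable_cell_lintegral hZ ξ s
  have hmeas : Measurable fun ω => ∫⁻ u in I, ENNReal.ofReal (Real.exp (ξ * (X (Z u) ω - X s ω))) :=
    hjoint.lintegral_prod_left'
  have hm := measurableSet_le (measurable_const (a := ENNReal.ofReal c)) hmeas
  rw [← withDensity_apply _ hm]
  refine (meas_ge_le_lintegral_div hmeas.aemeasurable (by simpa using hc)
    ENNReal.ofReal_ne_top).trans ?_
  rw [lintegral_withDensity_eq_lintegral_mul _ (h.measurable_tiltDensity g) hmeas]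
  simp only [Pi.mul_apply]
  have h1 : ∫⁻ ω, tiltDensity X K g ω *
      (∫⁻ u in I, ENNReal.ofReal (Real.exp (ξ * (X (Z u) ω - X s ω)))) ∂P =
      ∫⁻ u in I, ∫⁻ ω, tiltDensity X K g ω *
        ENNReal.ofReal (Real.exp (ξ * (X (Z u) ω - X s ω))) ∂P := by
    rw [← lintegral_lintegral_swap]
    · refine lintegral_congr fun ω => (lintegral_const_mul' _ _ ?_).symm
      exact ENNReal.ofReal_ne_top
    · exact (((h.measurable_tiltDensity g).comp measurable_fst).mul
        (hjoint.comp measurable_swap)).aemeasurable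
  rw [h1, ENNReal.ofReal_div_of_pos hc,
    ← ENNReal.mul_div_right_comm]
  gcongr
  rw [← setLIntegral_const]
  refine setLIntegral_mono measurable_const fun u hu => ?_
  have h2 := h.lintegral_tiltDensity_mul_exp g
    (ξ • (Finsupp.single (Z u) 1 - Finsupp.single s 1))
  simp only [processEval_smul, processEval_sub, processEval_single, one_mul] at h2
  rw [h2, kernelForm_comm h.symm g]
  refine ENNReal.ofReal_le_ofReal (Real.exp_le_exp.2 ?_)
  simp only [map_smul, LinearMap.smul_apply, smul_eq_mul]
  have h3 := hvar u hu
  have h4 := (abs_le.1 (hdrift u hu)).1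
  nlinarith [mul_le_mul_of_nonneg_left h3 (mul_nonneg hξ hξ), mul_le_mul_of_nonneg_left h4 hξ]

theorem measurableSet_pathBadSet (h : IsGaussianFamily P X K)
    {Z : ℝ → T} (hZ : ∀ ω, Continuous fun u => X (Z u) ω) (ξ α δ : ℝ) (M : ℕ) :
    MeasurableSet (pathBadSet X Z ξ α δ M) := by
  refine Finset.measurableSet_biUnion _ fun k _ => (measurableSet_le measurable_const
    (h.measurable _)).union (measurableSet_le measurable_const ?_)
  exact (h.measurable_cell_lintegral hZ ξ (Z (k / M))).lintegral_prod_left'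

theorem setLIntegral_tiltDensity_pathBadSet_le [SFinite P] (h : IsGaussianFamily P X K)
    (g : T →₀ ℝ) {Z : ℝ → T} (hZ : ∀ ω, Continuous fun u => X (Z u) ω) {ξ : ℝ} (hξ : 0 ≤ ξ)
    {α V β : ℝ} (δ : ℝ) {M : ℕ} (hM : 0 < M)
    (hV : ∀ k < M, K (Z (k / M)) (Z (k / M)) ≤ V)
    (hβ : ∀ k < M, β ≤ kernelForm K (Finsupp.single (Z (k / M)) 1) g)
    (hvar : ∀ k < M, ∀ u ∈ Set.Icc ((k : ℝ) / M) ((k + 1) / M),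
      kernelForm K (Finsupp.single (Z u) 1 - Finsupp.single (Z (k / M)) 1)
        (Finsupp.single (Z u) 1 - Finsupp.single (Z (k / M)) 1) ≤ 1)
    (hdrift : ∀ k < M, ∀ u ∈ Set.Icc ((k : ℝ) / M) ((k + 1) / M),
      |kernelForm K (Finsupp.single (Z u) 1 - Finsupp.single (Z (k / M)) 1) g| ≤ 1) :
    ∫⁻ ω in pathBadSet X Z ξ α δ M, tiltDensity X K g ω ∂P ≤
      ENNReal.ofReal (M * (Real.exp (α + V / 2 - β) + Real.exp (ξ ^ 2 / 2 + ξ - δ))) := by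
  have hM' : (0 : ℝ) < M := by exact_mod_cast hM
  calc _ ≤ ∑ k ∈ Finset.range M, ENNReal.ofReal
        (Real.exp (α + V / 2 - β) + Real.exp (ξ ^ 2 / 2 + ξ - δ)) := by
        rw [pathBadSet]
        refine (lintegral_biUnion_finset_le _ _ _).trans (Finset.sum_le_sum fun k hk => ?_)
        have hk' := Finset.mem_range.1 hk
        refine (lintegral_union_le _ _ _).trans ?_
        rw [ENNReal.ofReal_add (by positivity) (by positivity)]
        refine add_le_add (h.setLIntegral_tiltDensity_le g _ (hV k hk') (hβ k hk')) ?_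
        refine (h.setLIntegral_tiltDensity_cell_le g hZ hξ _ (hvar k hk')
          (hdrift k hk') (by positivity)).trans_eq ?_
        rw [Real.volume_Icc, ← ENNReal.ofReal_mul (by positivity)]
        congr 1
        rw [Real.exp_sub]
        field_simp
        ring
    _ = _ := by
        rw [Finset.sum_const, Finset.card_range, nsmul_eq_mul, ENNReal.ofReal_mul hM'.le,
          ENNReal.ofReal_natCast]

end IsGaussianFamily

end PathEstimate

theorem lintegral_exp_le_of_notMem_pathBadSet {T Ω : Type*} {X : T → Ω → ℝ} {Z : ℝ → T} {ξ : ℝ} (hξ : 0 ≤ ξ) {α δ : ℝ} {M : ℕ}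
    (hM : 0 < M) {ω : Ω} (hω : ω ∉ pathBadSet X Z ξ α δ M) :
    ∫⁻ u in Set.Icc (0 : ℝ) 1, ENNReal.ofReal (Real.exp (ξ * X (Z u) ω)) ≤
      ENNReal.ofReal (Real.exp (δ - ξ * α)) := by
  have hM' : (0 : ℝ) < M := by exact_mod_cast hM
  have hcover : Set.Icc (0 : ℝ) 1 ⊆
      ⋃ k ∈ Finset.range M, Set.Icc ((k : ℝ) / M) ((k + 1) / M) := by
    intro u hu
    simp only [Set.mem_iUnion, Finset.mem_range, exists_prop]
    rcases eq_or_lt_of_le hu.2 with rfl | hu1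
    · refine ⟨M - 1, by omega, ?_, ?_⟩
      · rw [div_le_one hM']; exact_mod_cast Nat.sub_le M 1
      · rw [le_div_iff₀ hM', one_mul]; exact_mod_cast (by omega : M ≤ M - 1 + 1)
    · refine ⟨⌊u * M⌋₊, (Nat.floor_lt (mul_nonneg hu.1 hM'.le)).2 (by nlinarith), ?_, ?_⟩
      · rw [div_le_iff₀ hM']; exact Nat.floor_le (mul_nonneg hu.1 hM'.le)
      · rw [le_div_iff₀ hM']; exact (Nat.lt_floor_add_one _).le
  simp only [pathBadSet, Set.mem_iUnion, Set.mem_union, Set.mem_ofPred_eq, not_exists, not_or,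
    not_le, Finset.mem_range] at hω
  calc _ ≤ ∑ k ∈ Finset.range M, ENNReal.ofReal (Real.exp (δ - ξ * α) / M) := by
        refine (lintegral_mono_set hcover).trans ((lintegral_biUnion_finset_le _ _ _).trans
          (Finset.sum_le_sum fun k hk => ?_))
        obtain ⟨h1, h2⟩ := hω k (Finset.mem_range.1 hk)
        have h3 : ∀ u, ENNReal.ofReal (Real.exp (ξ * X (Z u) ω)) =
            ENNReal.ofReal (Real.exp (ξ * X (Z (k / M)) ω)) *
              ENNReal.ofReal (Real.exp (ξ * (X (Z u) ω - X (Z (k / M)) ω))) := fun u => by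
          rw [← ENNReal.ofReal_mul (by positivity), ← Real.exp_add]
          congr 2
          ring
        rw [lintegral_congr h3, lintegral_const_mul' _ _ ENNReal.ofReal_ne_top]
        refine (mul_le_mul_right h2.le _).trans ?_
        rw [← ENNReal.ofReal_mul (by positivity), ← mul_div_assoc, ← Real.exp_add]
        refine ENNReal.ofReal_le_ofReal ?_
        gcongr
        nlinarith
    _ = _ := by
        rw [Finset.sum_const, Finset.card_range, nsmul_eq_mul, ← ENNReal.ofReal_natCast,
          ← ENNReal.ofReal_mul hM'.le]
        congr 1
        field_simp

theorem expMetricSetDist_le_of_lintegral_le {d : ℕ} {ξ : ℝ} {H : EuclideanSpace ℝ (Fin d) → ℝ}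
    (hH : Continuous H) {K₁ K₂ : Set (EuclideanSpace ℝ (Fin d))}
    {f : ℝ → EuclideanSpace ℝ (Fin d)} (hf : PiecewiseC1Path d f) (hf0 : f 0 ∈ K₁) (hf1 : f 1 ∈ K₂)
    {V c : ℝ} (hV : 0 ≤ V) (hc : 0 ≤ c)
    (hlip : ∀ u ∈ Set.Icc (0 : ℝ) 1, ∀ w ∈ Set.Icc (0 : ℝ) 1, ‖f u - f w‖ ≤ V * |u - w|)
    (h_lint : ∫⁻ u in Set.Icc (0 : ℝ) 1, ENNReal.ofReal (Real.exp (ξ * H (f u))) ≤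
      ENNReal.ofReal c) :
    expMetricSetDist d ξ H K₁ K₂ ≤ V * c := by
  have hmem : (∫ t in Set.Icc (0 : ℝ) 1, Real.exp (ξ * H (f t)) * ‖deriv f t‖) ∈
      {r : ℝ | ∃ f : ℝ → EuclideanSpace ℝ (Fin d), PiecewiseC1Path d f ∧ f 0 ∈ K₁ ∧ f 1 ∈ K₂ ∧
        r = ∫ t in Set.Icc (0 : ℝ) 1, Real.exp (ξ * H (f t)) * ‖deriv f t‖} :=
    ⟨f, hf, hf0, hf1, rfl⟩
  refine (csInf_le ⟨0, ?_⟩ hmem).trans ?_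
  · rintro r ⟨f, -, -, -, rfl⟩
    exact integral_nonneg fun t => by positivity
  have hcont : ContinuousOn (fun u => Real.exp (ξ * H (f u))) (Set.Icc 0 1) :=
    Real.continuous_exp.comp_continuousOn ((hH.comp_continuousOn hf.1).const_mul ξ)
  have hintble : IntegrableOn (fun u => Real.exp (ξ * H (f u))) (Set.Icc 0 1) :=
    hcont.integrableOn_compact isCompact_Icc
  have hderiv : ∀ u ∈ Set.Ioo (0 : ℝ) 1, ‖deriv f u‖ ≤ V := fun u hu => by
    refine norm_deriv_le_of_lip' hV ?_
    filter_upwards [Ioo_mem_nhds hu.1 hu.2] with w hw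
    rw [Real.norm_eq_abs]
    exact hlip w (Set.Ioo_subset_Icc_self hw) u (Set.Ioo_subset_Icc_self hu)
  calc _ ≤ ∫ u in Set.Icc (0 : ℝ) 1, V * Real.exp (ξ * H (f u)) := by
        rw [integral_Icc_eq_integral_Ioo, integral_Icc_eq_integral_Ioo]
        refine integral_mono_of_nonneg (Filter.Eventually.of_forall fun t => by positivity)
          ((hintble.mono_set Set.Ioo_subset_Icc_self).const_mul V) ?_
        filter_upwards [ae_restrict_mem measurableSet_Ioo] with u hu
        rw [mul_comm]
        gcongr
        exact hderiv u hu
    _ = V * ∫ u in Set.Icc (0 : ℝ) 1, Real.exp (ξ * H (f u)) := integral_const_mul _ _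
    _ ≤ V * c := by
        gcongr
        rw [← ENNReal.ofReal_le_ofReal_iff hc, ofReal_integral_eq_lintegral_ofReal hintble
          (Filter.Eventually.of_forall fun _ => by positivity)]
        exact h_lint

section SecondMoment

variable {d D : ℕ} {e : Direction D → EuclideanSpace ℝ (Fin d)}

theorem inner_sq_le_dist_sq (he : Orthonormal ℝ e) (y : Direction D)
    (p p' : EuclideanSpace ℝ (Fin d)) : (inner ℝ (p - p') (e y)) ^ 2 ≤ dist p p' ^ 2 := by
  refine sq_le_sq' ?_ ?_ <;> rw [dist_eq_norm] <;>
    have h := abs_le.1 (abs_real_inner_le_norm (p - p') (e y)) <;>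
    rw [he.1 y, mul_one] at h
  exacts [h.1, h.2]

/-- The points of a zigzag path at which the field is tilted. -/
noncomputable def zigzagNode (K : ℕ) (e : Direction D → EuclideanSpace ℝ (Fin d))
    (x v : EuclideanSpace ℝ (Fin d)) (s : ℝ) (c : ℕ → ℕ → Fin D) (j κ : ℕ) :
    EuclideanSpace ℝ (Fin d) :=
  zigzagPath K e x v s c (j + 1) (κ / mesh ^ (j + 1))

theorem dyadicKernel_le_exp_of_inner {q : ℕ} {s : ℝ} (hs : d * s ^ 2 = ((1 / 2) ^ (q + 1)) ^ 2)
    (he : Orthonormal ℝ e) (j : ℕ) (y : Direction D) (p p' : EuclideanSpace ℝ (Fin d)) {t : ℝ}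
    (hin : inner ℝ (p - p') (e y) = s * t) :
    dyadicKernel d (6 * j + q + 1) p p' ≤ Real.exp (-((64 ^ j) ^ 2 * t ^ 2 / 8)) := by
  refine (dyadicKernel_le_exp _ _ _).trans (Real.exp_le_exp.2 (neg_le_neg ?_))
  have h1 := inner_sq_le_dist_sq he y p p'
  rw [hin, mul_pow] at h1
  have h2 : ((1 / 2 : ℝ) ^ (6 * j + q + 1)) ^ 2 = ((1 / 2) ^ (q + 1)) ^ 2 / (64 ^ j) ^ 2 := by
    rw [show 6 * j + q + 1 = 6 * j + (q + 1) by ring, pow_add, pow_mul]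
    norm_num
    field_simp
    rw [← mul_pow, ← mul_pow]
    norm_num
  have h3 : (0 : ℝ) < ((1 / 2) ^ (q + 1)) ^ 2 := by positivity
  have h4 : (0 : ℝ) < (64 ^ j) ^ 2 := by positivity
  rw [h2, le_div_iff₀ (by positivity)]
  calc (64 ^ j) ^ 2 * t ^ 2 / 8 * (8 * (((1 / 2) ^ (q + 1)) ^ 2 / (64 ^ j) ^ 2))
      = d * (s ^ 2 * t ^ 2) := by rw [← hs]; field_simp
    _ ≤ _ := by gcongr

theorem kernelForm_tiltVector_zigzagNode_le {q : ℕ} {s : ℝ}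
    (hs : d * s ^ 2 = ((1 / 2) ^ (q + 1)) ^ 2) (he : Orthonormal ℝ e)
    {x v : EuclideanSpace ℝ (Fin d)} (hv : ∀ y, inner ℝ v (e y) = 0) (a : ℝ) {N₀ N K : ℕ}
    (hK : mesh ^ N + 2 ≤ K) (c c' : ℕ → ℕ → Fin D) :
    kernelForm (fieldKernel d) (tiltVector a q N₀ N (zigzagNode K e x v s c))
      (tiltVector a q N₀ N (zigzagNode K e x v s c')) ≤
      a ^ 2 * ∑ j ∈ Finset.Ico N₀ N, ∑ l ∈ Finset.range (j + 2),
        ((activeCells K c c' l).card : ℝ) *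
          (4 * (mesh ^ (j + 1 - l)) ^ 2 * separationWeight (j + 1 - l)) := by
  rw [kernelForm_tiltVector]
  refine mul_le_mul_of_nonneg_left (Finset.sum_le_sum fun j hj => ?_) (sq_nonneg a)
  have hjN := (Finset.mem_Ico.1 hj).2
  have hK' : mesh ^ (j + 1) + 2 ≤ K :=
    (Nat.add_le_add_right (Nat.pow_le_pow_right mesh_pos hjN) 2).trans hK
  refine sum_le_sum_card_activeCells hK' (Γ := fun κ κ' => dyadicKernel d (6 * j + q + 1)
    (zigzagNode K e x v s c j κ) (zigzagNode K e x v s c' j κ')) (fun κ κ' =>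
      dyadicKernel_le_one _ _ _) (fun κ κ' y => ?_) fun κ κ' y => ?_
  · exact dyadicKernel_le_exp_of_inner hs he j (Sum.inl y) _ _
      (inner_zigzagPath_sub_inl he K x hv s c c' (j + 1) _ _ y)
  · exact dyadicKernel_le_exp_of_inner hs he j (Sum.inr y) _ _
      (inner_zigzagPath_sub_inr he K x hv s c c' (j + 1) _ _ y)

theorem le_kernelForm_single_zigzagPath (hd : 2592 ≤ d) {q : ℕ} {s : ℝ} (hs0 : 0 ≤ s)
    (hs : d * s ^ 2 = ((1 / 2) ^ (q + 1)) ^ 2) (he : Orthonormal ℝ e)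
    {x v : EuclideanSpace ℝ (Fin d)} {a : ℝ} (ha : 0 ≤ a) {N₀ N n : ℕ}
    (hn : 6 * N + q ≤ n) (hvs : ‖v‖ ≤ s * 4096 ^ N₀) (K : ℕ) (c : ℕ → ℕ → Fin D) {u : ℝ}
    (hu0 : 0 ≤ u) (hu1 : u < 1) :
    a * (Real.exp (-1296) / 4 * (N - N₀ : ℕ)) ≤
      kernelForm (fieldKernel d) (Finsupp.single (n, zigzagPath K e x v s c N u) 1)
        (tiltVector a q N₀ N (zigzagNode K e x v s c)) := by
  refine le_kernelForm_single_tiltVector hd ha hn fun j hj hjN => ?_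
  have hm : (0 : ℝ) < (mesh : ℝ) ^ (j + 1) := pow_pos cast_mesh_pos _
  refine ⟨⌊(mesh : ℝ) ^ (j + 1) * u⌋₊, ?_, ?_⟩
  · rw [Nat.floor_lt (by positivity)]
    push_cast
    nlinarith
  · have h1 := norm_zigzagPath_sub_floor_le he K x v hs0 c hjN hu0
      (hvs.trans (by gcongr; norm_num))
    rw [dist_eq_norm]
    have h2 : ((1 / 2 : ℝ) ^ (6 * j + q + 1)) ^ 2 = ((1 / 2) ^ (q + 1)) ^ 2 * ((1 / 64) ^ j) ^ 2 := by
      rw [show 6 * j + q + 1 = 6 * j + (q + 1) by ring, pow_add, pow_mul, mul_pow, mul_comm]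
      norm_num
    rw [h2, ← hs]
    calc _ ≤ (d : ℝ) * (18 * (s * (1 / 64) ^ j)) ^ 2 := by
          gcongr
          exact h1
      _ = _ := by ring

end SecondMoment

theorem one_le_measure_zigzagPath_add {d D : ℕ} [NeZero D] {C : ℝ} (hd : 2592 ≤ d)
    {e : Direction D → EuclideanSpace ℝ (Fin d)} (he : Orthonormal ℝ e)
    {x v : EuclideanSpace ℝ (Fin d)} (hv : ∀ y, inner ℝ v (e y) = 0)
    {q : ℕ} {s : ℝ} (hs0 : 0 ≤ s) (hs1 : s ≤ 1) (hs : d * s ^ 2 = ((1 / 2) ^ (q + 1)) ^ 2)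
    {a : ℝ} (ha : 0 ≤ a) {N₀ N n M : ℕ} (hn : 6 * N + q ≤ n) (hvs : ‖v‖ ≤ s * 4096 ^ N₀)
    (hC : ∀ c' : ℕ → ℕ → Fin D,
      ∑ w : Fin N → Fin (mesh ^ N + 2) → Fin D, Real.exp (a ^ 2 * ∑ j ∈ Finset.Ico N₀ N,
        ∑ l ∈ Finset.range (j + 2),
          ((activeCells (mesh ^ N + 2) (extendChoices w) c' l).card : ℝ) *
            (4 * (mesh ^ (j + 1 - l)) ^ 2 * separationWeight (j + 1 - l))) ≤
        Fintype.card (Fin N → Fin (mesh ^ N + 2) → Fin D) * Real.exp (C * a ^ 2 * (1 / 2) ^ N₀))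
    (hC0 : 0 ≤ C) (hM : 0 < M)
    (hvar : 2 * (d * ((‖v‖ + 513 * mesh ^ N) / M) * 4 ^ (n + 1)) ≤ 1)
    (hdrift : a * (N * (mesh ^ N * (2 * (d * ((‖v‖ + 513 * mesh ^ N) / M) * 4 ^ (n + 1))))) ≤ 1)
    {Ω : Type} [MeasurableSpace Ω] {P : Measure Ω} [IsProbabilityMeasure P]
    {h : ℕ → EuclideanSpace ℝ (Fin d) → Ω → ℝ} (hh : IsWhiteNoiseField d P h)
    {ξ : ℝ} (hξ : 0 ≤ ξ) (α δ : ℝ) :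
    1 ≤ P {ω | ∃ c : ℕ → ℕ → Fin D, ∫⁻ u in Set.Icc (0 : ℝ) 1, ENNReal.ofReal
        (Real.exp (ξ * h (n + 1) (zigzagPath (mesh ^ N + 2) e x v s c N u) ω)) ≤
          ENNReal.ofReal (Real.exp (δ - ξ * α))} +
      ENNReal.ofReal (Real.exp (C * a ^ 2 * (1 / 2) ^ N₀) - 1) +
      2 * ENNReal.ofReal (M * (Real.exp (α + (n + 1) / 2 -
        a * (Real.exp (-1296) / 4 * (N - N₀ : ℕ))) + Real.exp (ξ ^ 2 / 2 + ξ - δ))) := by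
  set K := mesh ^ N + 2 with hK
  have hG := hh.isGaussianFamily
  have hM' : (0 : ℝ) < M := by exact_mod_cast hM
  let Y : (Fin N → Fin K → Fin D) → ℝ → EuclideanSpace ℝ (Fin d) := fun w u =>
    zigzagPath K e x v s (extendChoices w) N u
  let Z : (Fin N → Fin K → Fin D) → ℝ → ℕ × EuclideanSpace ℝ (Fin d) := fun w u => (n, Y w u)
  let g : (Fin N → Fin K → Fin D) → (ℕ × EuclideanSpace ℝ (Fin d)) →₀ ℝ := fun w =>
    tiltVector a q N₀ N (zigzagNode K e x v s (extendChoices w))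
  have hZ : ∀ w ω, Continuous fun u => fieldProcess h (Z w u) ω := fun w ω =>
    (hh.2.2 ω (n + 1)).comp (continuous_zigzagPath K e x v s (extendChoices w) N)
  have hgrid : ∀ k < M, (0 : ℝ) ≤ k / M ∧ (k : ℝ) / M < 1 := fun k hk =>
    ⟨by positivity, by rw [div_lt_one hM']; exact_mod_cast hk⟩
  have hdist : ∀ w, ∀ k < M, ∀ u ∈ Set.Icc ((k : ℝ) / M) ((k + 1) / M),
      dist (Y w u) (Y w (k / M)) ≤ (‖v‖ + 513 * mesh ^ N) / M := by
    intro w k hk u hu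
    have h0 := (hgrid k hk).1
    have h1 := norm_zigzagPath_sub_self_le he K x v hs0 hs1 (extendChoices w) N
      (h0.trans hu.1) h0
    rw [dist_eq_norm]
    refine h1.trans ((mul_le_mul_of_nonneg_left ?_ (by positivity)).trans_eq (mul_one_div _ _))
    rw [abs_of_nonneg (sub_nonneg.2 hu.1)]
    have h2 := hu.2
    rw [add_div] at h2
    linarith
  have key := one_le_measure_iUnion_compl_add (P := P)
    (w := fun w => IsGaussianFamily.tiltDensity (fieldProcess h) (fieldKernel d) (g w))
    (bad := fun w => pathBadSet (fieldProcess h) (Z w) ξ α δ M)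
    (ε := ENNReal.ofReal (M * (Real.exp (α + (n + 1) / 2 -
        a * (Real.exp (-1296) / 4 * (N - N₀ : ℕ))) + Real.exp (ξ ^ 2 / 2 + ξ - δ))))
    (η := ENNReal.ofReal (Real.exp (C * a ^ 2 * (1 / 2) ^ N₀) - 1))
    (fun w => hG.measurable_tiltDensity (g w))
    (fun w => hG.measurableSet_pathBadSet (hZ w) ξ α δ M)
    (fun w => hG.lintegral_tiltDensity (g w))
    (fun w => ?_) (fun w => ?_)
  · refine key.trans ?_
    gcongr
    refine Set.iUnion_subset fun w ω hω => ⟨extendChoices w, ?_⟩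
    exact lintegral_exp_le_of_notMem_pathBadSet (X := fieldProcess h) (Z := Z w) hξ hM hω
  · refine hG.setLIntegral_tiltDensity_pathBadSet_le (g w) (hZ w) hξ δ hM (fun k _ => ?_)
      (fun k hk => ?_) (fun k hk u hu => ?_) fun k hk u hu => ?_
    · have := kernelForm_single_self_le n (Y w (k / M))
      rwa [kernelForm_single, one_mul, one_mul] at this
    · exact le_kernelForm_single_zigzagPath hd hs0 hs he ha hn hvs K _ (hgrid k hk).1 (hgrid k hk).2
    · refine (kernelForm_sub_self_le n _ _).trans (le_trans ?_ hvar)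
      gcongr
      exact hdist w k hk u hu
    · refine (abs_kernelForm_sub_tiltVector_le ha hn _ _ _).trans (le_trans ?_ hdrift)
      gcongr
      exact hdist w k hk u hu
  · have hη : (1 : ENNReal) + ENNReal.ofReal (Real.exp (C * a ^ 2 * (1 / 2) ^ N₀) - 1) =
        ENNReal.ofReal (Real.exp (C * a ^ 2 * (1 / 2) ^ N₀)) := by
      rw [← ENNReal.ofReal_one, ← ENNReal.ofReal_add zero_le_one]
      · congr 1; ring
      · rw [sub_nonneg, Real.one_le_exp_iff]
        positivity
    rw [hη, mul_comm, ← ENNReal.ofReal_natCast, ← ENNReal.ofReal_mul (by positivity)]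
    refine le_trans ?_ (ENNReal.ofReal_le_ofReal (hC (extendChoices w)))
    rw [ENNReal.ofReal_sum_of_nonneg fun _ _ => by positivity]
    refine Finset.sum_le_sum fun w' _ => ?_
    rw [hG.lintegral_tiltDensity_mul_tiltDensity, kernelForm_comm hG.symm]
    exact ENNReal.ofReal_le_ofReal (Real.exp_le_exp.2
      (kernelForm_tiltVector_zigzagNode_le hs he hv a le_rfl _ _))

theorem cast_mesh_pow (N : ℕ) : (mesh : ℝ) ^ N = 2 ^ (18 * N) := by
  rw [cast_mesh, pow_mul]
  norm_num

theorem cast_mesh_pow_le_exp {N n k : ℕ} (h : 18 * N ≤ k * n) :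
    (mesh : ℝ) ^ N ≤ Real.exp (k * n) := by
  rw [cast_mesh_pow, ← Nat.cast_mul, ← mul_one ((k * n : ℕ) : ℝ), Real.exp_nat_mul]
  calc (2 : ℝ) ^ (18 * N) ≤ 2 ^ (k * n) := pow_le_pow_right₀ one_le_two h
    _ ≤ Real.exp 1 ^ (k * n) := by
        gcongr
        linarith [Real.exp_one_gt_d9]

/-- On the scale of the grid the field and the drift are nearly constant. -/
theorem mesh_pow_mul_le {N n q : ℕ} (hN : n ≤ 6 * N + q + 5) {b c : ℝ} (hb : 0 ≤ b) (hc : 0 ≤ c) :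
    (mesh : ℝ) ^ N * (2 * (c * ((b + 513 * mesh ^ N) / (mesh ^ (4 * N) : ℕ)) * 4 ^ (n + 1))) ≤
      8 * (c * (b + 513) * 2 ^ (6 * q + 30)) * (1 / 2) ^ n := by
  set m : ℝ := (mesh : ℝ) ^ N with hm
  have hm1 : 1 ≤ m := one_le_pow₀ (by rw [cast_mesh]; norm_num)
  have hm0 : 0 < m := by linarith
  have hM : ((mesh ^ (4 * N) : ℕ) : ℝ) = m ^ 4 := by
    push_cast
    rw [mul_comm 4 N, pow_mul]
  have hlow : (2 : ℝ) ^ (6 * n) ≤ m ^ 2 * 2 ^ (6 * q + 30) := by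
    rw [hm, cast_mesh_pow, ← pow_mul, ← pow_add]
    exact pow_le_pow_right₀ one_le_two (by omega)
  have h4 : (4 : ℝ) ^ (n + 1) * 2 ^ n ≤ 4 * 2 ^ (6 * n) := by
    rw [show (4 : ℝ) = 2 ^ 2 by norm_num, ← pow_mul, ← pow_add, ← pow_add]
    exact pow_le_pow_right₀ one_le_two (by omega)
  rw [hM, one_div, inv_pow, ← div_eq_mul_inv, le_div_iff₀ (by positivity)]
  calc m * (2 * (c * ((b + 513 * m) / m ^ 4) * 4 ^ (n + 1))) * 2 ^ n
      ≤ m * (2 * (c * ((b * m + 513 * m) / m ^ 4) * 4 ^ (n + 1))) * 2 ^ n := by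
        gcongr
        exact le_mul_of_one_le_right hb hm1
    _ = 2 * (c * (b + 513)) / m ^ 2 * (4 ^ (n + 1) * 2 ^ n) := by
        field_simp
    _ ≤ 2 * (c * (b + 513)) / m ^ 2 * (4 * (m ^ 2 * 2 ^ (6 * q + 30))) := by
        exact mul_le_mul_of_nonneg_left (h4.trans (by gcongr)) (by positivity)
    _ = _ := by
        field_simp
        ring

theorem tendsto_measure_of_one_le_add {Ω : Type*} [MeasurableSpace Ω] {P : Measure Ω}
    [IsProbabilityMeasure P] {S : ℕ → Set Ω} {η ε : ℕ → ℝ}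
    (hη : Filter.Tendsto η Filter.atTop (nhds 0)) (hε : Filter.Tendsto ε Filter.atTop (nhds 0))
    (h : ∀ᶠ n in Filter.atTop, 1 ≤ P (S n) + ENNReal.ofReal (η n) + 2 * ENNReal.ofReal (ε n)) :
    Filter.Tendsto (fun n => P (S n)) Filter.atTop (nhds 1) := by
  have h1 : Filter.Tendsto (fun n => (1 : ENNReal) -
      (ENNReal.ofReal (η n) + 2 * ENNReal.ofReal (ε n))) Filter.atTop (nhds 1) := by
    have h2 := ENNReal.tendsto_ofReal hη
    have h3 := ENNReal.Tendsto.const_mul (a := 2) (ENNReal.tendsto_ofReal hε)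
      (Or.inr ENNReal.ofNat_ne_top)
    have h4 := ENNReal.Tendsto.sub (tendsto_const_nhds (x := (1 : ENNReal))) (h2.add h3)
      (Or.inl ENNReal.one_ne_top)
    simpa using h4
  refine tendsto_of_tendsto_of_tendsto_of_le_of_le' h1 tendsto_const_nhds ?_
    (Filter.Eventually.of_forall fun n => prob_le_one)
  filter_upwards [h] with n hn
  rw [tsub_le_iff_right, ← add_assoc]
  exact hn

/-- The tilting needed to push the field down at rate `B`. -/
noncomputable def tiltStrength (B : ℝ) : ℝ := 24 * (14 + B) / (Real.exp (-1296) / 4)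

theorem tendsto_measure_expMetricSetDist {d D : ℕ} [NeZero D] (hd : 2592 ≤ d)
    (hD : D + 8 * mesh + 1 ≤ d) {A τ ξ C : ℝ} (hA : 0 < A) (hτ : 0 < τ) (hξ : τ ≤ ξ) (hC0 : 0 ≤ C)
    (hC : ∀ N₀ N : ℕ, ∀ c' : ℕ → ℕ → Fin D,
      ∑ w : Fin N → Fin (mesh ^ N + 2) → Fin D, Real.exp (tiltStrength (A + 17 / τ) ^ 2 *
        ∑ j ∈ Finset.Ico N₀ N, ∑ l ∈ Finset.range (j + 2),
          ((activeCells (mesh ^ N + 2) (extendChoices w) c' l).card : ℝ) *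
            (4 * (mesh ^ (j + 1 - l)) ^ 2 * separationWeight (j + 1 - l))) ≤
        Fintype.card (Fin N → Fin (mesh ^ N + 2) → Fin D) *
          Real.exp (C * tiltStrength (A + 17 / τ) ^ 2 * (1 / 2) ^ N₀))
    {Ω : Type} [MeasurableSpace Ω] {P : Measure Ω} [IsProbabilityMeasure P]
    {h : ℕ → EuclideanSpace ℝ (Fin d) → Ω → ℝ} (hh : IsWhiteNoiseField d P h)
    {K₁ K₂ : Set (EuclideanSpace ℝ (Fin d))}
    (hK₁ : (interior K₁).Nonempty) (hK₂ : (interior K₂).Nonempty) :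
    Filter.Tendsto
      (fun n : ℕ => P {ω | expMetricSetDist d ξ (fun x => h n x ω) K₁ K₂ ≤
        (2 : ℝ) ^ (-(A * ξ * n))}) Filter.atTop (nhds 1) := by
  obtain ⟨x, hx⟩ := hK₁
  obtain ⟨x', hx'⟩ := hK₂
  obtain ⟨ρ, hρ, hball⟩ := Metric.isOpen_iff.1 isOpen_interior x hx
  obtain ⟨ρ', hρ', hball'⟩ := Metric.isOpen_iff.1 isOpen_interior x' hx'
  set v := x' - x with hv
  obtain ⟨e, he, hve⟩ := exists_orthonormal_direction_orthogonal hD v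
  set B := A + 17 / τ with hB
  have hB0 : 0 < B := by positivity
  set a := tiltStrength B with ha
  have ha0 : 0 ≤ a := by rw [ha, tiltStrength]; positivity
  obtain ⟨q, hq⟩ := exists_pow_lt_of_lt_one (show (0 : ℝ) < min ρ ρ' / 3 by positivity)
    (show (1 / 2 : ℝ) < 1 by norm_num)
  have hd1 : (1 : ℝ) ≤ √d := by
    rw [Real.one_le_sqrt]
    exact_mod_cast (by omega : 1 ≤ d)
  have hd0 : (0 : ℝ) < √d := by linarith
  set s : ℝ := (1 / 2) ^ (q + 1) / √d with hs
  have hs0 : 0 < s := by positivity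
  have hsq : s ≤ (1 / 2) ^ q := by
    refine (div_le_self (by positivity) hd1).trans ?_
    exact pow_le_pow_of_le_one (by norm_num) (by norm_num) (Nat.le_succ q)
  have hs1 : s ≤ 1 := hsq.trans (pow_le_one₀ (by norm_num) (by norm_num))
  have hds : d * s ^ 2 = ((1 / 2) ^ (q + 1)) ^ 2 := by
    rw [hs, div_pow, Real.sq_sqrt (Nat.cast_nonneg d)]
    field_simp
  have hmin : 3 * s < min ρ ρ' := by linarith
  have hξ0 : 0 < ξ := hτ.trans_le hξ
  have hlog : Real.log 2 ≤ 1 := by linarith [Real.log_two_lt_d9]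
  let N : ℕ → ℕ := fun n => (n - q) / 6
  let N₀ : ℕ → ℕ := fun n => (n - q) / 6 / 2
  have hN₀ : Filter.Tendsto N₀ Filter.atTop Filter.atTop := by
    refine Filter.tendsto_atTop.2 fun b => ?_
    filter_upwards [Filter.eventually_ge_atTop (12 * b + q + 12)] with n hn
    simp only [N₀]
    omega
  have hvs : ∀ᶠ n in Filter.atTop, ‖v‖ ≤ s * 4096 ^ N₀ n := by
    have h1 := ((tendsto_pow_atTop_atTop_of_one_lt (show (1 : ℝ) < 4096 by norm_num)).comp
      hN₀).eventually_ge_atTop (‖v‖ / s)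
    filter_upwards [h1] with n hn
    rw [div_le_iff₀ hs0] at hn
    simpa [mul_comm] using hn
  set c₁ : ℝ := 8 * (d * (‖v‖ + 513) * 2 ^ (6 * q + 30)) with hc₁
  have hc₁0 : 0 ≤ c₁ := by positivity
  have hvar : ∀ᶠ n : ℕ in Filter.atTop, c₁ * (1 / 2) ^ n ≤ 1 := by
    have h1 : Filter.Tendsto (fun n : ℕ => c₁ * (1 / 2) ^ n) Filter.atTop (nhds (c₁ * 0)) :=
      (tendsto_pow_atTop_nhds_zero_of_lt_one (by norm_num) (by norm_num)).const_mul c₁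
    rw [mul_zero] at h1
    exact h1.eventually_le_const one_pos
  have hdrift : ∀ᶠ n : ℕ in Filter.atTop, a * (n * (c₁ * (1 / 2) ^ n)) ≤ 1 := by
    have h1 : Filter.Tendsto (fun n : ℕ => a * c₁ * (n * (1 / 2) ^ n)) Filter.atTop
        (nhds (a * c₁ * 0)) :=
      (tendsto_self_mul_const_pow_of_lt_one (by norm_num) (by norm_num)).const_mul (a * c₁)
    rw [mul_zero] at h1
    filter_upwards [h1.eventually_le_const one_pos] with n hn
    linarith
  have hexp : Filter.Tendsto (fun n : ℕ => Real.exp (-(n : ℝ))) Filter.atTop (nhds 0) :=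
    Real.tendsto_exp_neg_atTop_nhds_zero.comp tendsto_natCast_atTop_atTop
  have hcost : ∀ᶠ n : ℕ in Filter.atTop,
      (‖v‖ + 513) * Real.exp (-(n : ℝ)) ≤ Real.exp (-(A * ξ)) := by
    have h1 := hexp.const_mul (‖v‖ + 513)
    rw [mul_zero] at h1
    exact h1.eventually_le_const (Real.exp_pos _)
  rw [← Filter.tendsto_add_atTop_iff_nat 1]
  refine tendsto_measure_of_one_le_add
    (η := fun n => Real.exp (C * a ^ 2 * (1 / 2) ^ N₀ n) - 1)
    (ε := fun n => (Real.exp (1 / 2) + Real.exp (ξ ^ 2 / 2 + ξ)) * Real.exp (-(n : ℝ))) ?_ ?_ ?_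
  · have h1 : Filter.Tendsto (fun n => C * a ^ 2 * (1 / 2) ^ N₀ n) Filter.atTop
        (nhds (C * a ^ 2 * 0)) :=
      ((tendsto_pow_atTop_nhds_zero_of_lt_one (by norm_num) (by norm_num)).comp hN₀).const_mul _
    have h2 := ((Real.continuous_exp.tendsto _).comp h1).sub_const 1
    simpa using h2
  · simpa using hexp.const_mul (Real.exp (1 / 2) + Real.exp (ξ ^ 2 / 2 + ξ))
  filter_upwards [hvs, hvar, hdrift, hcost, Filter.eventually_ge_atTop (2 * q + 10)]
    with n hvs hvar hdrift hcost hn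
  have hNle : 6 * N n + q ≤ n := by simp only [N]; omega
  have hNge : n ≤ 6 * N n + q + 5 := by simp only [N]; omega
  have hsmall := mesh_pow_mul_le hNge (norm_nonneg v) (Nat.cast_nonneg d)
  have hgap : (n : ℝ) / 24 ≤ (N n - N₀ n : ℕ) := by
    rw [div_le_iff₀ (by norm_num)]
    exact_mod_cast (by simp only [N, N₀]; omega : n ≤ (N n - N₀ n) * 24)
  have key := one_le_measure_zigzagPath_add hd he hve hs0.le hs1 hds ha0 hNle hvs
    (hC (N₀ n) (N n)) hC0 (M := mesh ^ (4 * N n)) (pow_pos mesh_pos _) ?_ ?_ hh (x := x) hξ0.le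
    (B * n) (13 * n)
  · refine key.trans (add_le_add (add_le_add (measure_mono ?_) le_rfl) ?_)
    · rintro ω ⟨c, hω⟩
      refine (expMetricSetDist_le_of_lintegral_le (hh.2.2 ω (n + 1))
        (piecewiseC1Path_zigzagPath _ e x v s c (N n)) ?_ ?_ (V := ‖v‖ + 513 * mesh ^ N n)
        (by positivity) (Real.exp_pos _).le
        (fun u hu w hw => norm_zigzagPath_sub_self_le he _ x v hs0.le hs1 c _ hu.1 hw.1) hω).trans ?_
      · refine interior_subset (hball ?_)
        rw [Metric.mem_ball, dist_eq_norm]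
        have h1 := dist_zigzagPath_zero_le he (mesh ^ N n + 2) x v hs0.le c (N n) le_rfl
        rw [zero_smul, add_zero] at h1
        exact h1.trans_lt (hmin.trans_le (min_le_left _ _))
      · refine interior_subset (hball' ?_)
        rw [Metric.mem_ball, dist_eq_norm]
        have h1 := dist_zigzagPath_zero_le he (mesh ^ N n + 2) x v hs0.le c (N n) zero_le_one
        rw [one_smul, hv, add_sub_cancel] at h1
        exact h1.trans_lt (hmin.trans_le (min_le_right _ _))
      · have h1 : (mesh : ℝ) ^ N n ≤ Real.exp (3 * n) :=
          cast_mesh_pow_le_exp (k := 3) (by omega)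
        have h2 : (1 : ℝ) ≤ Real.exp (3 * n) := Real.one_le_exp (by positivity)
        have h3 : 17 * n ≤ ξ * (17 / τ * n) := by
          have : 1 ≤ ξ / τ := (one_le_div hτ).2 hξ
          calc (17 : ℝ) * n = 1 * (17 * n) := by ring
            _ ≤ ξ / τ * (17 * n) := by gcongr
            _ = _ := by ring
        calc (‖v‖ + 513 * mesh ^ N n) * Real.exp (13 * n - ξ * (B * n))
            ≤ (‖v‖ * Real.exp (3 * n) + 513 * Real.exp (3 * n)) *
              Real.exp (13 * n - ξ * (B * n)) := by
              gcongr
              exact le_mul_of_one_le_right (norm_nonneg v) h2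
          _ = (‖v‖ + 513) * Real.exp (3 * n + (13 * n - ξ * (B * n))) := by
              rw [Real.exp_add]; ring
          _ ≤ (‖v‖ + 513) * Real.exp (-(n : ℝ) + -(A * ξ * n)) := by
              refine mul_le_mul_of_nonneg_left (Real.exp_le_exp.2 ?_) (by positivity)
              rw [hB]
              nlinarith
          _ = (‖v‖ + 513) * Real.exp (-(n : ℝ)) * Real.exp (-(A * ξ * n)) := by
              rw [Real.exp_add, ← mul_assoc]
          _ ≤ Real.exp (-(A * ξ)) * Real.exp (-(A * ξ * n)) := by gcongr
          _ ≤ (2 : ℝ) ^ (-(A * ξ * (n + 1 : ℕ))) := by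
              rw [← Real.exp_add, Real.rpow_def_of_pos two_pos]
              refine Real.exp_le_exp.2 ?_
              push_cast
              have : 0 ≤ A * ξ * (n + 1) := by positivity
              nlinarith
    · refine mul_le_mul_right (ENNReal.ofReal_le_ofReal ?_) _
      have h1 : ((mesh ^ (4 * N n) : ℕ) : ℝ) ≤ Real.exp (12 * n) := by
        rw [Nat.cast_pow]
        exact cast_mesh_pow_le_exp (k := 12) (by omega)
      have h2 : (14 + B) * n ≤ a * (Real.exp (-1296) / 4 * (N n - N₀ n : ℕ)) := by
        calc (14 + B) * n = a * (Real.exp (-1296) / 4 * (n / 24)) := by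
              rw [ha, tiltStrength]
              field_simp
          _ ≤ _ := by gcongr
      calc _ ≤ Real.exp (12 * n) * (Real.exp (B * n + (n + 1) / 2 - (14 + B) * n) +
            Real.exp (ξ ^ 2 / 2 + ξ - 13 * n)) := by
            refine mul_le_mul h1 (add_le_add_left (Real.exp_le_exp.2 ?_) _) (by positivity)
              (by positivity)
            linarith
        _ ≤ _ := by
            rw [mul_add, add_mul (Real.exp _), ← Real.exp_add, ← Real.exp_add, ← Real.exp_add, ← Real.exp_add]
            refine add_le_add (Real.exp_le_exp.2 ?_) (Real.exp_le_exp.2 ?_)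
            · have : (0 : ℝ) ≤ n := Nat.cast_nonneg n
              linarith
            · linarith
  · refine le_trans ?_ hvar
    refine le_trans ?_ hsmall
    exact le_mul_of_one_le_left (by positivity) (one_le_pow₀ (by rw [cast_mesh]; norm_num))
  · refine le_trans ?_ hdrift
    gcongr
    simp only [N]
    omega

theorem exists_dimension_tendsto_measure_expMetricSetDist {A τ : ℝ} (hA : 0 < A) (hτ : 0 < τ) :
    ∃ d₀ : ℕ, ∀ d, d₀ ≤ d → ∀ ξ : ℝ, τ ≤ ξ →
      ∀ (Ω : Type) (_ : MeasurableSpace Ω) (P : Measure Ω), IsProbabilityMeasure P →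
      ∀ h : ℕ → EuclideanSpace ℝ (Fin d) → Ω → ℝ, IsWhiteNoiseField d P h →
      ∀ K₁ K₂ : Set (EuclideanSpace ℝ (Fin d)),
        (interior K₁).Nonempty → (interior K₂).Nonempty →
        Filter.Tendsto
          (fun n : ℕ => P {ω | expMetricSetDist d ξ (fun x => h n x ω) K₁ K₂ ≤
            (2 : ℝ) ^ (-(A * ξ * n))})
          Filter.atTop (nhds 1) := by
  obtain ⟨C, hC0, hC⟩ := exists_sum_exp_card_activeCells_le
  set b : ℝ := tiltStrength (A + 17 / τ) ^ 2 with hb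
  set D₀ : ℕ := ⌈144 * mesh * Real.exp (2 * (C * b))⌉₊ + 1 with hD₀
  refine ⟨D₀ + 8 * mesh + 1, fun d hd ξ hξ Ω _ P _ h hh K₁ K₂ hK₁ hK₂ => ?_⟩
  have hD : 144 * mesh * Real.exp (2 * (C * b)) ≤ D₀ := by
    rw [hD₀]
    push_cast
    linarith [Nat.le_ceil (144 * mesh * Real.exp (2 * (C * b)))]
  have hmesh : 2592 ≤ mesh := by norm_num [mesh]
  have : NeZero D₀ := ⟨Nat.succ_ne_zero _⟩
  exact tendsto_measure_expMetricSetDist (by omega) hd hA hτ hξ hC0.le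
    (fun N₀ N c' => hC b (sq_nonneg _) D₀ hD N₀ N _ le_rfl c') hh hK₁ hK₂

/-- For any fixed `A > 0` there exist a constant `C > 0` and a function
`L : ℕ → (0,∞)` with `L(d) → 0` such that for every integer `d ≥ C`, every `ξ ≥ L(d)`, and
every pair of disjoint compact sets `K₁, K₂ ⊂ ℝ^d` with non-empty interiors,
`ℙ[D_n(K₁,K₂) ≤ 2^{−Aξn}] → 1` as `n → ∞`. -/
theorem exponential_metric_set_to_set (A : ℝ) (hA : 0 < A) :
    ∃ (C : ℝ) (L : ℕ → ℝ), 0 < C ∧ (∀ d, 0 < L d) ∧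
      Filter.Tendsto L Filter.atTop (nhds 0) ∧
      ∀ d : ℕ, 2 ≤ d → C ≤ (d : ℝ) → ∀ ξ : ℝ, L d ≤ ξ →
      ∀ (Ω : Type) (_ : MeasurableSpace Ω) (P : Measure Ω), IsProbabilityMeasure P →
      ∀ h : ℕ → EuclideanSpace ℝ (Fin d) → Ω → ℝ, IsWhiteNoiseField d P h →
      ∀ K₁ K₂ : Set (EuclideanSpace ℝ (Fin d)),
        IsCompact K₁ → IsCompact K₂ → Disjoint K₁ K₂ →
        (interior K₁).Nonempty → (interior K₂).Nonempty →
        Filter.Tendsto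
          (fun n : ℕ => P {ω | expMetricSetDist d ξ (fun x => h n x ω) K₁ K₂ ≤
            (2 : ℝ) ^ (-(A * ξ * n))})
          Filter.atTop (nhds 1) := by
  choose d₀ hd₀ using fun k : ℕ =>
    exists_dimension_tendsto_measure_expMetricSetDist hA (Nat.one_div_pos_of_nat (α := ℝ) (n := k))
  let k : ℕ → ℕ := fun d => Nat.findGreatest (fun k => d₀ k ≤ d) d
  have hk : Filter.Tendsto k Filter.atTop Filter.atTop := by
    refine Filter.tendsto_atTop.2 fun b => ?_
    filter_upwards [Filter.eventually_ge_atTop (max b (d₀ b))] with d hd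
    exact Nat.le_findGreatest ((le_max_left _ _).trans hd) ((le_max_right _ _).trans hd)
  refine ⟨d₀ 0 + 1, fun d => 1 / ((k d : ℝ) + 1), by positivity, fun d => Nat.one_div_pos_of_nat,
    (tendsto_one_div_add_atTop_nhds_zero_nat (𝕜 := ℝ)).comp hk,
    fun d _ hd ξ hξ Ω _ P hP h hh K₁ K₂ _ _ _ hK₁ hK₂ => ?_⟩
  have hd' : d₀ 0 ≤ d := by
    have : (d₀ 0 : ℝ) ≤ d := by linarith
    exact_mod_cast this
  exact hd₀ (k d) d (Nat.findGreatest_spec (P := fun k => d₀ k ≤ d) (Nat.zero_le d) hd') ξ hξ Ω _ P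
    hP h hh K₁ K₂ hK₁ hK₂
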